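/- arXiv:1908.06333 — 2 statements merged into one kernel-verified Lean document; each statement's English description precedes it below -/
import Mathlib

section
/- Let r = r(n) ≥ 3 and m = m(n) with r^{-2} n ≤ m = o(r^{-3} n^{3/2}) as n → ∞, and let h_4 be an integer with 1 ≤ h_4 ≤ M_4. Then: (a) if C^{++}_{0,0,0,h_4} = ∅ and h_4 < M_4, then C^{++}_{0,0,0,h_4+1} = ∅; and (b) if C^{++}_{0,0,0,h_4} ≠ ∅, then, uniformly over such h_4, |C^{++}_{0,0,0,h_4}| / |C^{++}_{0,0,0,h_4−1}| = [ C(2r−2, 2) C(2r−4, r−2) C( m − 2(h_4−1), 2 ) · ( C(n, 2r−2) − ((r^2 − r − 1)/((r−1)(2r−3))) C(r,2) m C(n−2, 2r−4) ) ] / ( h_4 [ N − C(r,2) m C(n−2, r−2) ]^2 ) · ( 1 + O( ( r^6 m n log(r^{-2}n) + r^8 m^2 ) / n^4 ) ). -/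
open Filter Finset

/-- `Hgraphs n r m`: the set of `r`-graphs on vertex set `Fin n` with exactly `m` edges. -/
def Hgraphs (n r m : ℕ) : Finset (Finset (Finset (Fin n))) :=
  Finset.univ.filter fun H => (∀ e ∈ H, e.card = r) ∧ H.card = m

/-- A hypergraph is linear if any two distinct edges share at most one vertex. -/
def IsLinear {n : ℕ} (H : Finset (Finset (Fin n))) : Prop :=
  ∀ e ∈ H, ∀ f ∈ H, e ≠ f → (e ∩ f).card ≤ 1

instance {n : ℕ} : DecidablePred (IsLinear (n := n)) := fun _ => by
  unfold IsLinear; infer_instance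

/-- `Lgraphs n r m`: the set of linear `r`-graphs on `Fin n` with exactly `m` edges. -/
def Lgraphs (n r m : ℕ) : Finset (Finset (Finset (Fin n))) :=
  (Hgraphs n r m).filter IsLinear

/-- The degree of a vertex: the number of edges containing it. -/
def hdegree {n : ℕ} (H : Finset (Finset (Fin n))) (v : Fin n) : ℕ :=
  (H.filter fun e => v ∈ e).card

/-- `C` is a cluster of `H`: the edge set of a component, with at least two edges, of the
graph on the edges of `H` in which two edges are adjacent iff they are linked (they meet in
exactly two vertices). -/
def IsCluster {n : ℕ} (H C : Finset (Finset (Fin n))) : Prop :=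
  C ⊆ H ∧ 2 ≤ C.card ∧
  (∀ e ∈ C, ∀ f ∈ C,
    Relation.ReflTransGen (fun a b => a ∈ C ∧ b ∈ C ∧ (a ∩ b).card = 2) e f) ∧
  (∀ e ∈ C, ∀ f ∈ H, (e ∩ f).card = 2 → f ∈ C)

/-- Type-1 cluster: three edges spanning `3r-4` vertices, one edge `e` linked to each of
`f, g` through two disjoint `2`-subsets of `e`, with `f` and `g` meeting only inside `e`. -/
def IsType1 {n : ℕ} (r : ℕ) (C : Finset (Finset (Fin n))) : Prop :=
  ∃ e f g : Finset (Fin n), C = {e, f, g} ∧ e ≠ f ∧ e ≠ g ∧ f ≠ g ∧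
    (C.sup id).card = 3 * r - 4 ∧
    (e ∩ f).card = 2 ∧ (e ∩ g).card = 2 ∧ Disjoint (e ∩ f) (e ∩ g) ∧ f ∩ g ⊆ e

/-- Type-2 cluster: as Type-1 but the two `2`-subsets of `e` share exactly one vertex. -/
def IsType2 {n : ℕ} (r : ℕ) (C : Finset (Finset (Fin n))) : Prop :=
  ∃ e f g : Finset (Fin n), C = {e, f, g} ∧ e ≠ f ∧ e ≠ g ∧ f ≠ g ∧
    (C.sup id).card = 3 * r - 4 ∧
    (e ∩ f).card = 2 ∧ (e ∩ g).card = 2 ∧ ((e ∩ f) ∩ (e ∩ g)).card = 1 ∧ f ∩ g ⊆ e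

/-- Type-3 cluster: three edges containing a common `2`-subset and pairwise disjoint
outside it. -/
def IsType3 {n : ℕ} (r : ℕ) (C : Finset (Finset (Fin n))) : Prop :=
  ∃ e f g : Finset (Fin n), C = {e, f, g} ∧ e ≠ f ∧ e ≠ g ∧ f ≠ g ∧
    (C.sup id).card = 3 * r - 4 ∧
    ∃ s : Finset (Fin n), s.card = 2 ∧ e ∩ f = s ∧ e ∩ g = s ∧ f ∩ g = s

/-- Type-4 cluster: exactly two linked edges. -/
def IsType4 {n : ℕ} (C : Finset (Finset (Fin n))) : Prop :=
  ∃ e f : Finset (Fin n), C = {e, f} ∧ e ≠ f ∧ (e ∩ f).card = 2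

/-- The number of clusters of `H` satisfying a property `P`. -/
noncomputable def clusterCount {n : ℕ} (H : Finset (Finset (Fin n)))
    (P : Finset (Finset (Fin n)) → Prop) : ℕ :=
  {C | IsCluster H C ∧ P C}.ncard

noncomputable def M0star (n r m : ℕ) : ℕ :=
  ⌈Real.log ((n : ℝ) / (r : ℝ) ^ 2) + 81 * (r : ℝ) ^ 2 * (m : ℝ) / (n : ℝ)⌉₊

noncomputable def M0 (n r m : ℕ) : ℕ := M0star n r m + 3

noncomputable def M1 (n r m : ℕ) : ℕ :=
  ⌈Real.log ((n : ℝ) / (r : ℝ) ^ 2) + 81 * (r : ℝ) ^ 8 * (m : ℝ) ^ 3 / (2 * (n : ℝ) ^ 4)⌉₊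

noncomputable def M2 (n r m : ℕ) : ℕ :=
  ⌈Real.log ((n : ℝ) / (r : ℝ) ^ 2) + 81 * (r : ℝ) ^ 7 * (m : ℝ) ^ 3 / (2 * (n : ℝ) ^ 4)⌉₊

noncomputable def M3 (n r m : ℕ) : ℕ :=
  ⌈Real.log ((n : ℝ) / (r : ℝ) ^ 2) + 81 * (r : ℝ) ^ 6 * (m : ℝ) ^ 3 / (2 * (n : ℝ) ^ 4)⌉₊

noncomputable def M4 (n r m : ℕ) : ℕ :=
  ⌈Real.log ((n : ℝ) / (r : ℝ) ^ 2) + 81 * (r : ℝ) ^ 4 * (m : ℝ) ^ 2 / (2 * (n : ℝ) ^ 2)⌉₊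

/-- `H_r^+(n,m)` with a prescribed degree bound `d₀` in place of property (g). -/
def HplusAux (n r m d₀ : ℕ) : Set (Finset (Finset (Fin n))) :=
  {H | H ∈ Hgraphs n r m ∧
    (∀ e ∈ H, ∀ f ∈ H, e ≠ f → (e ∩ f).card ≤ 2) ∧
    (∀ C, IsCluster H C → IsType1 r C ∨ IsType2 r C ∨ IsType3 r C ∨ IsType4 C) ∧
    (∀ C D, IsCluster H C → IsCluster H D → C ≠ D →
      ((C.sup id) ∩ (D.sup id)).card ≤ 1) ∧
    (∀ C D E, IsCluster H C → IsCluster H D → IsCluster H E →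
      C ≠ D → C ≠ E → D ≠ E →
      (IsType1 r C ∨ IsType2 r C ∨ IsType3 r C) →
      (IsType1 r D ∨ IsType2 r D ∨ IsType3 r D) →
      (IsType1 r E ∨ IsType2 r E ∨ IsType3 r E) →
      9 * r - 13 ≤ ((C.sup id) ∪ (D.sup id) ∪ (E.sup id)).card) ∧
    (∀ C D E, IsCluster H C → IsCluster H D → IsCluster H E →
      C ≠ D → C ≠ E → D ≠ E → IsType4 C → IsType4 D → IsType4 E →
      6 * r - 8 ≤ ((C.sup id) ∪ (D.sup id) ∪ (E.sup id)).card) ∧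
    clusterCount H (IsType1 r) ≤ M1 n r m ∧
    clusterCount H (IsType2 r) ≤ M2 n r m ∧
    clusterCount H (IsType3 r) ≤ M3 n r m ∧
    clusterCount H IsType4 ≤ M4 n r m ∧
    (∀ v, hdegree H v ≤ d₀)}

/-- `H_r^+(n,m)`: `r`-graphs with `m` edges satisfying properties (a)–(g). -/
noncomputable def Hplus (n r m : ℕ) : Set (Finset (Finset (Fin n))) :=
  HplusAux n r m (M0 n r m)

/-- `H_r^{++}(n,m)`: as `H_r^+(n,m)` but with the stronger degree bound `M₀*`. -/
noncomputable def Hplusplus (n r m : ℕ) : Set (Finset (Finset (Fin n))) :=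
  HplusAux n r m (M0star n r m)

/-- `C^+_{h₁,h₂,h₃,h₄}`: members of `H_r^+(n,m)` with exactly `hᵢ` Type-`i` clusters. -/
noncomputable def Cplus (n r m h₁ h₂ h₃ h₄ : ℕ) : Set (Finset (Finset (Fin n))) :=
  {H ∈ Hplus n r m | clusterCount H (IsType1 r) = h₁ ∧ clusterCount H (IsType2 r) = h₂ ∧
    clusterCount H (IsType3 r) = h₃ ∧ clusterCount H IsType4 = h₄}

/-- `C^{++}_{h₁,h₂,h₃,h₄}`: members of `H_r^{++}(n,m)` with exactly `hᵢ` Type-`i` clusters. -/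
noncomputable def Cplusplus (n r m h₁ h₂ h₃ h₄ : ℕ) : Set (Finset (Finset (Fin n))) :=
  {H ∈ Hplusplus n r m | clusterCount H (IsType1 r) = h₁ ∧ clusterCount H (IsType2 r) = h₂ ∧
    clusterCount H (IsType3 r) = h₃ ∧ clusterCount H IsType4 = h₄}

/-- The edges of `K` linked to no edge of `K`. -/
def isolatedEdges {n : ℕ} (K : Finset (Finset (Fin n))) : Finset (Finset (Fin n)) :=
  K.filter fun e => ∀ f ∈ K, (e ∩ f).card ≠ 2

/-- The ordered pairs of linked edges of `K`. -/
def linkedPairs {n : ℕ} (K : Finset (Finset (Fin n))) :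
    Finset (Finset (Fin n) × Finset (Fin n)) :=
  (K ×ˢ K).filter fun p => (p.1 ∩ p.2).card = 2

/-- Uniform hypergraphs of degree at most `D` all of whose clusters are of Type 4, subject to
the conditions on the spans of clusters. -/
structure IsAdmissible {n : ℕ} (r D : ℕ) (K : Finset (Finset (Fin n))) : Prop where
  unif : ∀ e ∈ K, e.card = r
  inter : ∀ e ∈ K, ∀ f ∈ K, e ≠ f → (e ∩ f).card ≤ 2
  matching : ∀ e f g, (e, f) ∈ linkedPairs K → (e, g) ∈ linkedPairs K → f = g
  span_two : ∀ p q, p ∈ linkedPairs K → q ∈ linkedPairs K → q.1 ≠ p.1 → q.1 ≠ p.2 →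
    ((p.1 ∪ p.2) ∩ (q.1 ∪ q.2)).card ≤ 1
  span_three : ∀ p q t, p ∈ linkedPairs K → q ∈ linkedPairs K → t ∈ linkedPairs K →
    q.1 ≠ p.1 → q.1 ≠ p.2 → t.1 ≠ p.1 → t.1 ≠ p.2 → t.1 ≠ q.1 → t.1 ≠ q.2 →
    6 * r - 8 ≤ ((p.1 ∪ p.2) ∪ (q.1 ∪ q.2) ∪ (t.1 ∪ t.2)).card
  deg : ∀ v, hdegree K v ≤ D

open Classical in
/-- The admissible hypergraphs with `s` isolated edges and `h` clusters. -/
noncomputable def admissibleClass (n r D s h : ℕ) : Finset (Finset (Finset (Fin n))) :=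
  univ.filter fun K =>
    IsAdmissible r D K ∧ (isolatedEdges K).card = s ∧ (linkedPairs K).card = 2 * h

section Combinatorics

variable {n r D s h : ℕ} {K L : Finset (Finset (Fin n))} {e f : Finset (Fin n)}

theorem mem_admissibleClass : K ∈ admissibleClass n r D s h ↔
    IsAdmissible r D K ∧ (isolatedEdges K).card = s ∧ (linkedPairs K).card = 2 * h := by
  simp [admissibleClass]

theorem mem_isolatedEdges : e ∈ isolatedEdges K ↔ e ∈ K ∧ ∀ f ∈ K, (e ∩ f).card ≠ 2 := by
  simp [isolatedEdges]

theorem mem_linkedPairs {p : Finset (Fin n) × Finset (Fin n)} :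
    p ∈ linkedPairs K ↔ p.1 ∈ K ∧ p.2 ∈ K ∧ (p.1 ∩ p.2).card = 2 := by
  simp [linkedPairs, and_assoc]

theorem linkedPairs_mono (hLK : L ⊆ K) : linkedPairs L ⊆ linkedPairs K := by
  intro p hp
  rw [mem_linkedPairs] at hp ⊢
  exact ⟨hLK hp.1, hLK hp.2.1, hp.2.2⟩

theorem linkedPairs_swap {p : Finset (Fin n) × Finset (Fin n)} (hp : p ∈ linkedPairs K) :
    p.swap ∈ linkedPairs K := by
  rw [mem_linkedPairs] at hp ⊢
  exact ⟨hp.2.1, hp.1, by rw [inter_comm]; exact hp.2.2⟩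

theorem hdegree_mono (hLK : L ⊆ K) (v : Fin n) : hdegree L v ≤ hdegree K v :=
  card_le_card (filter_subset_filter _ hLK)

theorem IsAdmissible.mono (hK : IsAdmissible r D K) (hLK : L ⊆ K) : IsAdmissible r D L where
  unif e he := hK.unif e (hLK he)
  inter e he f hf := hK.inter e (hLK he) f (hLK hf)
  matching e f g h₁ h₂ := hK.matching e f g (linkedPairs_mono hLK h₁) (linkedPairs_mono hLK h₂)
  span_two p q h₁ h₂ := hK.span_two p q (linkedPairs_mono hLK h₁) (linkedPairs_mono hLK h₂)
  span_three p q t h₁ h₂ h₃ := hK.span_three p q t (linkedPairs_mono hLK h₁)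
    (linkedPairs_mono hLK h₂) (linkedPairs_mono hLK h₃)
  deg v := (hdegree_mono hLK v).trans (hK.deg v)

theorem hdegree_insert_le (e : Finset (Fin n)) (v : Fin n) :
    hdegree (insert e L) v ≤ hdegree L v + 1 := by
  unfold hdegree
  rw [filter_insert]
  split_ifs
  · exact card_insert_le _ _
  · omega

theorem hdegree_insert_of_notMem {v : Fin n} (hv : v ∉ e) :
    hdegree (insert e L) v = hdegree L v := by
  unfold hdegree
  rw [filter_insert, if_neg hv]

theorem linkedPairs_insert (he : e.card ≠ 2) (hsp : ∀ g ∈ L, (e ∩ g).card ≤ 1) :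
    linkedPairs (insert e L) = linkedPairs L := by
  ext ⟨a, b⟩
  simp only [mem_linkedPairs, mem_insert]
  constructor
  · rintro ⟨rfl | ha, rfl | hb, hab⟩
    · simp at hab; omega
    · have := hsp b hb; omega
    · have := hsp a ha; rw [inter_comm] at this; omega
    · exact ⟨ha, hb, hab⟩
  · rintro ⟨ha, hb, hab⟩
    exact ⟨Or.inr ha, Or.inr hb, hab⟩

theorem isolatedEdges_insert (he : e.card ≠ 2) (hsp : ∀ g ∈ L, (e ∩ g).card ≤ 1) :
    isolatedEdges (insert e L) = insert e (isolatedEdges L) := by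
  ext a
  simp only [mem_isolatedEdges, mem_insert, forall_eq_or_imp]
  constructor
  · rintro ⟨rfl | ha, h1, h2⟩
    · exact Or.inl rfl
    · exact Or.inr ⟨ha, h2⟩
  · rintro (rfl | ⟨ha, h2⟩)
    · refine ⟨Or.inl rfl, by simpa using he, fun g hg => ?_⟩
      have := hsp g hg; omega
    · refine ⟨Or.inr ha, ?_, h2⟩
      have := hsp a ha; rw [inter_comm] at this; omega

theorem linkedPairs_insert_insert (he : e.card ≠ 2) (hf : f.card ≠ 2) (hef : (e ∩ f).card = 2)
    (hse : ∀ g ∈ L, (e ∩ g).card ≤ 1) (hsf : ∀ g ∈ L, (f ∩ g).card ≤ 1) :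
    linkedPairs (insert e (insert f L)) = insert (e, f) (insert (f, e) (linkedPairs L)) := by
  ext ⟨a, b⟩
  simp only [mem_linkedPairs, mem_insert, Prod.mk.injEq]
  constructor
  · rintro ⟨rfl | rfl | ha, rfl | rfl | hb, hab⟩
    · simp at hab; omega
    · simp
    · have := hse b hb; omega
    · simp
    · simp at hab; omega
    · have := hsf b hb; omega
    · have := hse a ha; rw [inter_comm] at this; omega
    · have := hsf a ha; rw [inter_comm] at this; omega
    · exact Or.inr (Or.inr ⟨ha, hb, hab⟩)
  · rintro (⟨rfl, rfl⟩ | ⟨rfl, rfl⟩ | ⟨ha, hb, hab⟩)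
    · simp [hef]
    · rw [inter_comm] at hef; simp [hef]
    · simp [ha, hb, hab]

theorem isolatedEdges_insert_insert (hef : (e ∩ f).card = 2)
    (hse : ∀ g ∈ L, (e ∩ g).card ≤ 1) (hsf : ∀ g ∈ L, (f ∩ g).card ≤ 1) :
    isolatedEdges (insert e (insert f L)) = isolatedEdges L := by
  ext a
  simp only [mem_isolatedEdges, mem_insert, forall_eq_or_imp]
  constructor
  · rintro ⟨rfl | rfl | ha, h1, h2, h3⟩
    · exact absurd hef h2
    · rw [inter_comm] at hef; exact absurd hef h1
    · exact ⟨ha, h3⟩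
  · rintro ⟨ha, h3⟩
    refine ⟨Or.inr (Or.inr ha), ?_, ?_, h3⟩
    · have := hse a ha; rw [inter_comm] at this; omega
    · have := hsf a ha; rw [inter_comm] at this; omega

theorem notMem_of_sparse (he : 2 ≤ e.card) (hsp : ∀ g ∈ L, (e ∩ g).card ≤ 1) : e ∉ L := by
  intro h
  have := hsp e h
  simp at this; omega

theorem IsAdmissible.sparse_of_isolated (hK : IsAdmissible r D K) (he : e ∈ isolatedEdges K) :
    ∀ g ∈ K.erase e, (e ∩ g).card ≤ 1 := by
  intro g hg
  rw [mem_isolatedEdges] at he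
  rw [mem_erase] at hg
  have := hK.inter e he.1 g hg.2 hg.1.symm
  have := he.2 g hg.2
  omega

theorem IsAdmissible.sparse_of_linked (hK : IsAdmissible r D K) (hp : (e, f) ∈ linkedPairs K) :
    ∀ g ∈ (K.erase e).erase f, (e ∩ g).card ≤ 1 := by
  intro g hg
  simp only [mem_erase] at hg
  have h1 := mem_linkedPairs.1 hp
  have := hK.inter e h1.1 g hg.2.2 hg.2.1.symm
  have : (e ∩ g).card ≠ 2 := fun h2 =>
    hg.1 (hK.matching e g f (mem_linkedPairs.2 ⟨h1.1, hg.2.2, h2⟩) hp)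
  omega

theorem IsAdmissible.sparse_of_linked' (hK : IsAdmissible r D K) (hp : (e, f) ∈ linkedPairs K) :
    ∀ g ∈ (K.erase e).erase f, (f ∩ g).card ≤ 1 := by
  intro g hg
  rw [erase_right_comm] at hg
  exact hK.sparse_of_linked (linkedPairs_swap hp) g hg

theorem erase_isolated_mem (hr : 3 ≤ r) (hK : K ∈ admissibleClass n r D (s + 1) h)
    (he : e ∈ isolatedEdges K) : K.erase e ∈ admissibleClass n r D s h := by
  rw [mem_admissibleClass] at hK ⊢
  obtain ⟨hK, hs, hh⟩ := hK
  have heK := (mem_isolatedEdges.1 he).1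
  have hc : e.card = r := hK.unif e heK
  have hsp := hK.sparse_of_isolated he
  have h1 := isolatedEdges_insert (by omega) hsp
  have h2 := linkedPairs_insert (by omega) hsp
  rw [insert_erase heK] at h1 h2
  refine ⟨hK.mono (erase_subset _ _), ?_, by rw [← h2, hh]⟩
  rw [h1, card_insert_of_notMem] at hs
  · omega
  · intro h; exact notMem_of_sparse (by omega) hsp (mem_isolatedEdges.1 h).1

theorem ne_of_linked (hr : 3 ≤ r) (hK : IsAdmissible r D K) (hp : (e, f) ∈ linkedPairs K) :
    e ≠ f := by
  rintro rfl
  have h := mem_linkedPairs.1 hp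
  have := hK.unif e h.1
  simp at h; omega

theorem insert_erase_erase_of_linked (hr : 3 ≤ r) (hK : IsAdmissible r D K)
    (hp : (e, f) ∈ linkedPairs K) : insert e (insert f ((K.erase e).erase f)) = K := by
  have h := mem_linkedPairs.1 hp
  rw [insert_erase, insert_erase h.1]
  exact mem_erase.2 ⟨(ne_of_linked hr hK hp).symm, h.2.1⟩

theorem erase_linked_mem (hr : 3 ≤ r) (hK : K ∈ admissibleClass n r D s (h + 1))
    (hp : (e, f) ∈ linkedPairs K) : (K.erase e).erase f ∈ admissibleClass n r D s h := by
  rw [mem_admissibleClass] at hK ⊢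
  obtain ⟨hK, hs, hh⟩ := hK
  have hp' := mem_linkedPairs.1 hp
  have hce : e.card = r := hK.unif e hp'.1
  have hcf : f.card = r := hK.unif f hp'.2.1
  have hse := hK.sparse_of_linked hp
  have hsf := hK.sparse_of_linked' hp
  have hne := ne_of_linked hr hK hp
  have h1 := isolatedEdges_insert_insert hp'.2.2 hse hsf
  have h2 := linkedPairs_insert_insert (e := e) (f := f) (by omega) (by omega) hp'.2.2 hse hsf
  rw [insert_erase_erase_of_linked hr hK hp] at h1 h2
  refine ⟨hK.mono ((erase_subset _ _).trans (erase_subset _ _)), by rw [← h1, hs], ?_⟩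
  rw [h2, card_insert_of_notMem, card_insert_of_notMem] at hh
  · omega
  · intro h
    exact notMem_of_sparse (by omega) hsf (mem_linkedPairs.1 h).1
  · intro h
    rcases mem_insert.1 h with h | h
    · exact hne (by simpa using congrArg Prod.fst h)
    · exact notMem_of_sparse (by omega) hse (mem_linkedPairs.1 h).1

theorem insert_isolated_mem (hr : 3 ≤ r) (hL : L ∈ admissibleClass n r D s h) (he : e.card = r)
    (hsp : ∀ g ∈ L, (e ∩ g).card ≤ 1) (hd : ∀ v ∈ e, hdegree L v < D) :
    insert e L ∈ admissibleClass n r D (s + 1) h := by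
  rw [mem_admissibleClass] at hL ⊢
  obtain ⟨hL, hs, hh⟩ := hL
  have h1 := isolatedEdges_insert (by omega) hsp
  have h2 := linkedPairs_insert (by omega) hsp
  refine ⟨⟨?_, ?_, ?_, ?_, ?_, ?_⟩, ?_, by rw [h2, hh]⟩
  · simp only [mem_insert, forall_eq_or_imp]
    exact ⟨he, hL.unif⟩
  · intro a ha b hb hab
    rw [mem_insert] at ha hb
    rcases ha with rfl | ha
    · rcases hb with rfl | hb
      · exact absurd rfl hab
      · exact (hsp b hb).trans (by norm_num)
    · rcases hb with rfl | hb
      · rw [inter_comm]; exact (hsp a ha).trans (by norm_num)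
      · exact hL.inter a ha b hb hab
  · rw [h2]; exact hL.matching
  · rw [h2]; exact hL.span_two
  · rw [h2]; exact hL.span_three
  · intro v
    by_cases hv : v ∈ e
    · have := hd v hv
      have := hdegree_insert_le (L := L) e v
      omega
    · rw [hdegree_insert_of_notMem hv]; exact hL.deg v
  · rw [h1, card_insert_of_notMem, hs]
    intro h; exact notMem_of_sparse (by omega) hsp (mem_isolatedEdges.1 h).1

theorem insert_linked_mem (hr : 3 ≤ r) (hL : L ∈ admissibleClass n r D s h) (he : e.card = r)
    (hf : f.card = r) (hef : (e ∩ f).card = 2) (hse : ∀ g ∈ L, (e ∩ g).card ≤ 1)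
    (hsf : ∀ g ∈ L, (f ∩ g).card ≤ 1)
    (h2 : ∀ p ∈ linkedPairs L, ((p.1 ∪ p.2) ∩ (e ∪ f)).card ≤ 1)
    (h3 : ∀ p ∈ linkedPairs L, ∀ q ∈ linkedPairs L, q.1 ≠ p.1 → q.1 ≠ p.2 →
      6 * r - 8 ≤ ((p.1 ∪ p.2) ∪ (q.1 ∪ q.2) ∪ (e ∪ f)).card)
    (hd : ∀ v ∈ e ∪ f, hdegree L v + 2 ≤ D) :
    insert e (insert f L) ∈ admissibleClass n r D s (h + 1) := by
  rw [mem_admissibleClass] at hL ⊢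
  obtain ⟨hL, hs, hh⟩ := hL
  have hne : e ≠ f := by
    rintro rfl
    simp at hef; omega
  have heL := notMem_of_sparse (by omega) hse
  have hfL := notMem_of_sparse (by omega) hsf
  have hi := isolatedEdges_insert_insert hef hse hsf
  have hl := linkedPairs_insert_insert (by omega) (by omega) hef hse hsf
  have hfe : (f ∩ e).card = 2 := by rw [inter_comm]; exact hef
  have hset : ∀ p ∈ linkedPairs (insert e (insert f L)),
      (p ∈ linkedPairs L ∧ p.1 ∈ L ∧ p.2 ∈ L) ∨
      ((p.1 = e ∨ p.1 = f) ∧ (p.2 = e ∨ p.2 = f) ∧ p.1 ≠ p.2 ∧ p.1 ∪ p.2 = e ∪ f) := by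
    intro p hp
    rw [hl, mem_insert, mem_insert] at hp
    rcases hp with rfl | rfl | hp
    · exact Or.inr ⟨Or.inl rfl, Or.inr rfl, hne, rfl⟩
    · exact Or.inr ⟨Or.inr rfl, Or.inl rfl, hne.symm, union_comm _ _⟩
    · have := mem_linkedPairs.1 hp
      exact Or.inl ⟨hp, this.1, this.2.1⟩
  refine ⟨⟨?_, ?_, ?_, ?_, ?_, ?_⟩, by rw [hi, hs], ?_⟩
  · simp only [mem_insert, forall_eq_or_imp]
    exact ⟨he, hf, hL.unif⟩
  · intro a ha b hb hab
    rw [mem_insert, mem_insert] at ha hb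
    rcases ha with rfl | rfl | ha <;> rcases hb with rfl | rfl | hb
    · exact absurd rfl hab
    · exact hef.le
    · exact (hse b hb).trans (by norm_num)
    · exact hfe.le
    · exact absurd rfl hab
    · exact (hsf b hb).trans (by norm_num)
    · rw [inter_comm]; exact (hse a ha).trans (by norm_num)
    · rw [inter_comm]; exact (hsf a ha).trans (by norm_num)
    · exact hL.inter a ha b hb hab
  · intro a b c hab hac
    rcases hset _ hab with ⟨h1, h1a, h1b⟩ | ⟨h1a, h1b, h1n, -⟩ <;>
      rcases hset _ hac with ⟨h2, h2a, h2b⟩ | ⟨h2a, h2b, h2n, -⟩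
    · exact hL.matching a b c h1 h2
    · exfalso; rcases h2a with h | h <;> dsimp only at h h1a <;> subst h <;> contradiction
    · exfalso; rcases h1a with h | h <;> dsimp only at h h2a <;> subst h <;> contradiction
    · dsimp only at *
      rcases h1a with rfl | rfl <;> rcases h1b with rfl | rfl <;> rcases h2b with rfl | rfl <;>
        first | rfl | contradiction
  · intro p q hp hq hqp1 hqp2
    rcases hset _ hp with ⟨hp', -⟩ | ⟨h1a, h1b, h1n, h1u⟩ <;>
      rcases hset _ hq with ⟨hq', -⟩ | ⟨h2a, h2b, h2n, h2u⟩
    · exact hL.span_two p q hp' hq' hqp1 hqp2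
    · rw [h2u]; exact h2 p hp'
    · rw [h1u, inter_comm]; exact h2 q hq'
    · exfalso; grind
  · intro p q t hp hq ht hqp1 hqp2 htp1 htp2 htq1 htq2
    rcases hset _ hp with ⟨hp', -⟩ | ⟨h1a, h1b, h1n, h1u⟩ <;>
      rcases hset _ hq with ⟨hq', -⟩ | ⟨h2a, h2b, h2n, h2u⟩ <;>
      rcases hset _ ht with ⟨ht', -⟩ | ⟨h3a, h3b, h3n, h3u⟩
    · exact hL.span_three p q t hp' hq' ht' hqp1 hqp2 htp1 htp2 htq1 htq2
    · rw [h3u]; exact h3 p hp' q hq' hqp1 hqp2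
    · rw [h2u, union_right_comm]; exact h3 p hp' t ht' htp1 htp2
    · exfalso; grind
    · rw [h1u, union_assoc, union_comm]; exact h3 q hq' t ht' htq1 htq2
    · exfalso; grind
    · exfalso; grind
    · exfalso; grind
  · intro v
    by_cases hv : v ∈ e ∪ f
    · have := hd v hv
      have := hdegree_insert_le (L := L) f v
      have := hdegree_insert_le (L := insert f L) e v
      omega
    · rw [mem_union, not_or] at hv
      rw [hdegree_insert_of_notMem hv.1, hdegree_insert_of_notMem hv.2]
      exact hL.deg v
  · rw [hl, card_insert_of_notMem, card_insert_of_notMem, hh]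
    · ring
    · intro h; exact hfL (mem_linkedPairs.1 h).1
    · intro h
      rcases mem_insert.1 h with h | h
      · exact hne (by simpa using congrArg Prod.fst h)
      · exact heL (mem_linkedPairs.1 h).1

end Combinatorics

section Clusters

variable {n r D s h m : ℕ} {K H : Finset (Finset (Fin n))}

theorem card_eq_isolated_add_linked
    (hm : ∀ e f g, (e, f) ∈ linkedPairs K → (e, g) ∈ linkedPairs K → f = g) :
    K.card = (isolatedEdges K).card + (linkedPairs K).card := by
  have h1 : (K.filter fun e => ¬ ∀ f ∈ K, (e ∩ f).card ≠ 2) = (linkedPairs K).image Prod.fst := by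
    ext e
    simp only [mem_filter, mem_image, Prod.exists, mem_linkedPairs]
    push Not
    constructor
    · rintro ⟨he, f, hf, hef⟩
      exact ⟨e, f, ⟨he, hf, hef⟩, rfl⟩
    · rintro ⟨e', f, ⟨he, hf, hef⟩, rfl⟩
      exact ⟨he, f, hf, hef⟩
  rw [← card_filter_add_card_filter_not (s := K) (fun e => ∀ f ∈ K, (e ∩ f).card ≠ 2), h1,
    card_image_of_injOn]
  · rfl
  · rintro ⟨e, f⟩ h ⟨e', g⟩ h' heq
    obtain rfl : e = e' := heq
    rw [hm e f g h h']

theorem isCluster_pair (hr : 3 ≤ r) (hu : ∀ e ∈ H, e.card = r)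
    (hm : ∀ e f g, (e, f) ∈ linkedPairs H → (e, g) ∈ linkedPairs H → f = g)
    {e f : Finset (Fin n)} (hp : (e, f) ∈ linkedPairs H) : IsCluster H {e, f} := by
  have hp' := mem_linkedPairs.1 hp
  dsimp only at hp'
  have hne : e ≠ f := by
    rintro rfl
    have h1 := hu e hp'.1
    have h2 := hp'.2.2
    simp at h2; omega
  have hfe : (f ∩ e).card = 2 := by rw [inter_comm]; exact hp'.2.2
  refine ⟨?_, by rw [card_pair hne], ?_, ?_⟩
  · intro a ha
    simp only [mem_insert, mem_singleton] at ha
    rcases ha with rfl | rfl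
    exacts [hp'.1, hp'.2.1]
  · intro a ha b hb
    simp only [mem_insert, mem_singleton] at ha hb
    rcases ha with rfl | rfl <;> rcases hb with rfl | rfl
    · exact .refl
    · exact .single ⟨by simp, by simp, hp'.2.2⟩
    · exact .single ⟨by simp, by simp, hfe⟩
    · exact .refl
  · intro a ha g hg hag
    simp only [mem_insert, mem_singleton] at ha ⊢
    rcases ha with rfl | rfl
    · exact Or.inr (hm a g f (mem_linkedPairs.2 ⟨hp'.1, hg, hag⟩) hp)
    · exact Or.inl (hm a g e (mem_linkedPairs.2 ⟨hp'.2.1, hg, hag⟩) (linkedPairs_swap hp))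

theorem isCluster_iff (hr : 3 ≤ r) (hu : ∀ e ∈ H, e.card = r)
    (hm : ∀ e f g, (e, f) ∈ linkedPairs H → (e, g) ∈ linkedPairs H → f = g)
    {C : Finset (Finset (Fin n))} :
    IsCluster H C ↔ ∃ p ∈ linkedPairs H, C = {p.1, p.2} := by
  constructor
  · rintro ⟨hCH, hC2, hconn, hcl⟩
    obtain ⟨e, he, f, hf, hef⟩ := one_lt_card.1 hC2
    rcases (hconn e he f hf).cases_head with h | ⟨g, ⟨-, hg, heg⟩, -⟩
    · exact absurd h hef
    have hp : (e, g) ∈ linkedPairs H := mem_linkedPairs.2 ⟨hCH he, hCH hg, heg⟩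
    refine ⟨(e, g), hp, ?_⟩
    apply Subset.antisymm
    · intro a ha
      have := hconn e he a ha
      induction this with
      | refl => simp
      | tail _ hbc ih =>
        obtain ⟨hb, hc, hbc⟩ := hbc
        exact (isCluster_pair hr hu hm hp).2.2.2 _ (ih hb) _ (hCH hc) hbc
    · intro a ha
      simp only [mem_insert, mem_singleton] at ha
      rcases ha with rfl | rfl <;> assumption
  · rintro ⟨⟨e, f⟩, hp, rfl⟩
    exact isCluster_pair hr hu hm hp

theorem IsType1.card_eq {C : Finset (Finset (Fin n))} (h : IsType1 r C) : C.card = 3 := by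
  obtain ⟨e, f, g, rfl, h1, h2, h3, -⟩ := h
  exact card_eq_three.2 ⟨e, f, g, h1, h2, h3, rfl⟩

theorem IsType2.card_eq {C : Finset (Finset (Fin n))} (h : IsType2 r C) : C.card = 3 := by
  obtain ⟨e, f, g, rfl, h1, h2, h3, -⟩ := h
  exact card_eq_three.2 ⟨e, f, g, h1, h2, h3, rfl⟩

theorem IsType3.card_eq {C : Finset (Finset (Fin n))} (h : IsType3 r C) : C.card = 3 := by
  obtain ⟨e, f, g, rfl, h1, h2, h3, -⟩ := h
  exact card_eq_three.2 ⟨e, f, g, h1, h2, h3, rfl⟩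

theorem IsType4.card_eq {C : Finset (Finset (Fin n))} (h : IsType4 C) : C.card = 2 := by
  obtain ⟨e, f, rfl, h1, -⟩ := h
  exact card_pair h1

theorem matching_of_isType4 (h4 : ∀ C, IsCluster H C → IsType4 C) (hr : 3 ≤ r)
    (hu : ∀ e ∈ H, e.card = r) (e f g : Finset (Fin n)) (hf : (e, f) ∈ linkedPairs H)
    (hg : (e, g) ∈ linkedPairs H) : f = g := by
  classical
  by_contra hfg
  set R : Finset (Fin n) → Finset (Fin n) → Prop :=
    fun a b => a ∈ H ∧ b ∈ H ∧ (a ∩ b).card = 2 with hR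
  have hf' := mem_linkedPairs.1 hf
  have hg' := mem_linkedPairs.1 hg
  dsimp only at hf' hg'
  set C := H.filter fun a => Relation.ReflTransGen R e a with hC
  have heC : e ∈ C := mem_filter.2 ⟨hf'.1, .refl⟩
  have hfC : f ∈ C := mem_filter.2 ⟨hf'.2.1, .single hf'⟩
  have hgC : g ∈ C := mem_filter.2 ⟨hg'.2.1, .single hg'⟩
  have hef : e ≠ f := by
    rintro rfl
    have h1 := hu e hf'.1
    have h2 := hf'.2.2
    simp at h2; omega
  have heg : e ≠ g := by
    rintro rfl
    have h1 := hu e hg'.1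
    have h2 := hg'.2.2
    simp at h2; omega
  have hsub : ({e, f, g} : Finset (Finset (Fin n))) ⊆ C := by
    intro a ha
    simp only [mem_insert, mem_singleton] at ha
    rcases ha with rfl | rfl | rfl <;> assumption
  have h3 : 3 ≤ C.card := by
    rw [← card_eq_three.2 ⟨e, f, g, hef, heg, hfg, rfl⟩]
    exact card_le_card hsub
  have hpath : ∀ a, Relation.ReflTransGen R e a →
      Relation.ReflTransGen (fun a b => a ∈ C ∧ b ∈ C ∧ (a ∩ b).card = 2) e a := by
    intro a ha
    induction ha with
    | refl => exact .refl
    | tail hab hbc ih =>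
      exact ih.tail ⟨mem_filter.2 ⟨hbc.1, hab⟩, mem_filter.2 ⟨hbc.2.1, hab.tail hbc⟩, hbc.2.2⟩
  have hclus : IsCluster H C := by
    refine ⟨filter_subset _ _, by omega, ?_, ?_⟩
    · intro a ha b hb
      refine Relation.ReflTransGen.trans ?_ (hpath b (mem_filter.1 hb).2)
      have : Std.Symm (fun a b => a ∈ C ∧ b ∈ C ∧ (a ∩ b).card = 2) :=
        ⟨fun a b hab => ⟨hab.2.1, hab.1, by rw [inter_comm]; exact hab.2.2⟩⟩
      exact Relation.ReflTransGen.stdSymm.symm _ _ (hpath a (mem_filter.1 ha).2)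
    · intro a ha b hb hab
      rw [hC, mem_filter] at ha ⊢
      exact ⟨hb, ha.2.tail ⟨ha.1, hb, hab⟩⟩
  have := (h4 C hclus).card_eq
  omega

theorem clusterCount_eq_zero {P : Finset (Finset (Fin n)) → Prop} :
    clusterCount H P = 0 ↔ ∀ C, IsCluster H C → ¬ P C := by
  rw [clusterCount, Set.ncard_eq_zero (Set.toFinite _), Set.eq_empty_iff_forall_notMem]
  simp

theorem pair_eq_iff_of_linked
    (hm : ∀ e f g, (e, f) ∈ linkedPairs H → (e, g) ∈ linkedPairs H → f = g)
    {p q : Finset (Fin n) × Finset (Fin n)} (hp : p ∈ linkedPairs H) (hq : q ∈ linkedPairs H) :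
    ({p.1, p.2} : Finset (Finset (Fin n))) = {q.1, q.2} ↔ q.1 = p.1 ∨ q.1 = p.2 := by
  obtain ⟨a, b⟩ := p
  obtain ⟨c, d⟩ := q
  dsimp only
  constructor
  · intro h
    have : c ∈ ({a, b} : Finset (Finset (Fin n))) := by rw [h]; simp
    simpa using this
  · rintro (rfl | rfl)
    · rw [hm c b d hp hq]
    · rw [hm c d a hq (linkedPairs_swap hp), pair_comm]

theorem two_mul_clusterCount (hr : 3 ≤ r) (hu : ∀ e ∈ H, e.card = r)
    (hm : ∀ e f g, (e, f) ∈ linkedPairs H → (e, g) ∈ linkedPairs H → f = g) :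
    (linkedPairs H).card = 2 * clusterCount H IsType4 := by
  classical
  have hne : ∀ p ∈ linkedPairs H, p.1 ≠ p.2 := by
    intro p hp h
    have h' := mem_linkedPairs.1 hp
    have h1 := hu p.1 h'.1
    have h2 := h'.2.2
    rw [← h] at h2
    simp at h2; omega
  have h1 : {C | IsCluster H C ∧ IsType4 C} =
      (((linkedPairs H).image fun p => ({p.1, p.2} : Finset (Finset (Fin n)))) :
        Set (Finset (Finset (Fin n)))) := by
    ext C
    simp only [Set.mem_ofPred_eq, isCluster_iff hr hu hm, coe_image, Set.mem_image, mem_coe]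
    constructor
    · rintro ⟨⟨p, hp, rfl⟩, -⟩
      exact ⟨p, hp, rfl⟩
    · rintro ⟨p, hp, rfl⟩
      exact ⟨⟨p, hp, rfl⟩, p.1, p.2, rfl, hne p hp, (mem_linkedPairs.1 hp).2.2⟩
  rw [clusterCount, h1, Set.ncard_coe_finset, card_eq_sum_card_image
    (fun p : Finset (Fin n) × Finset (Fin n) => ({p.1, p.2} : Finset (Finset (Fin n)))),
    sum_const_nat (m := 2), mul_comm]
  simp only [forall_mem_image]
  intro p hp
  refine card_eq_two.2 ⟨p, p.swap, fun h => hne p hp (congrArg Prod.fst h), ?_⟩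
  ext q
  rw [mem_filter, mem_insert, mem_singleton]
  constructor
  · rintro ⟨hq, h⟩
    rcases (pair_eq_iff_of_linked hm hp hq).1 h.symm with h | h
    · exact Or.inl (Prod.ext h (hm p.1 q.2 p.2 (h ▸ hq) hp))
    · exact Or.inr (Prod.ext h (hm p.2 q.2 p.1 (h ▸ hq) (linkedPairs_swap hp)))
  · rintro (rfl | rfl)
    · exact ⟨hp, rfl⟩
    · exact ⟨linkedPairs_swap hp, pair_comm _ _⟩

theorem coe_admissibleClass (hr : 3 ≤ r) (hh : h ≤ M4 n r m) (hm : 2 * h ≤ m) :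
    Cplusplus n r m 0 0 0 h = ↑(admissibleClass n r (M0star n r m) (m - 2 * h) h) := by
  ext H
  rw [mem_coe, mem_admissibleClass]
  constructor
  · rintro ⟨⟨hH, hi, ht, h2, -, h3, -, -, -, -, hd⟩, c1, c2, c3, c4⟩
    rw [clusterCount_eq_zero] at c1 c2 c3
    have h4 : ∀ C, IsCluster H C → IsType4 C := by
      intro C hC
      rcases ht C hC with h | h | h | h
      · exact absurd h (c1 C hC)
      · exact absurd h (c2 C hC)
      · exact absurd h (c3 C hC)
      · exact h
    have hu : ∀ e ∈ H, e.card = r := (mem_filter.1 hH).2.1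
    have hcard : H.card = m := (mem_filter.1 hH).2.2
    have hma := matching_of_isType4 h4 hr hu
    have hl := two_mul_clusterCount hr hu hma
    have hc := card_eq_isolated_add_linked hma
    have hcl : ∀ p ∈ linkedPairs H, IsCluster H {p.1, p.2} := fun p hp =>
      (isCluster_iff hr hu hma).2 ⟨p, hp, rfl⟩
    have hne : ∀ p ∈ linkedPairs H, ∀ q ∈ linkedPairs H, q.1 ≠ p.1 → q.1 ≠ p.2 →
        ({p.1, p.2} : Finset (Finset (Fin n))) ≠ {q.1, q.2} := by
      intro p hp q hq h1 h2 h
      rcases (pair_eq_iff_of_linked hma hp hq).1 h with h | h <;> contradiction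
    refine ⟨⟨hu, hi, hma, ?_, ?_, hd⟩, by omega, by omega⟩
    · intro p q hp hq h1 h1'
      simpa using h2 _ _ (hcl p hp) (hcl q hq) (hne p hp q hq h1 h1')
    · intro p q t hp hq ht a1 a2 a3 a4 a5 a6
      simpa using h3 _ _ _ (hcl p hp) (hcl q hq) (hcl t ht) (hne p hp q hq a1 a2)
        (hne p hp t ht a3 a4) (hne q hq t ht a5 a6) (h4 _ (hcl p hp)) (h4 _ (hcl q hq))
        (h4 _ (hcl t ht))
  · rintro ⟨⟨hu, hi, hma, h2, h3, hd⟩, hs, hl⟩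
    have hl' := two_mul_clusterCount hr hu hma
    have hc := card_eq_isolated_add_linked hma
    have hcl : ∀ C, IsCluster H C ↔ ∃ p ∈ linkedPairs H, C = {p.1, p.2} := fun C =>
      isCluster_iff hr hu hma
    have hne : ∀ p ∈ linkedPairs H, ∀ q ∈ linkedPairs H,
        ({p.1, p.2} : Finset (Finset (Fin n))) ≠ {q.1, q.2} → q.1 ≠ p.1 ∧ q.1 ≠ p.2 := by
      intro p hp q hq hne
      rw [Ne, pair_eq_iff_of_linked hma hp hq] at hne
      tauto
    have h4 : ∀ C, IsCluster H C → IsType4 C := by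
      intro C hC
      obtain ⟨p, hp, rfl⟩ := (hcl C).1 hC
      refine ⟨p.1, p.2, rfl, ?_, (mem_linkedPairs.1 hp).2.2⟩
      intro h
      have h' := mem_linkedPairs.1 hp
      have h1 := hu p.1 h'.1
      have h2 := h'.2.2
      rw [← h] at h2
      simp at h2; omega
    have c1 : clusterCount H (IsType1 r) = 0 := clusterCount_eq_zero.2 fun C hC h => by
      have := h.card_eq
      have := (h4 C hC).card_eq
      omega
    have c2 : clusterCount H (IsType2 r) = 0 := clusterCount_eq_zero.2 fun C hC h => by
      have := h.card_eq
      have := (h4 C hC).card_eq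
      omega
    have c3 : clusterCount H (IsType3 r) = 0 := clusterCount_eq_zero.2 fun C hC h => by
      have := h.card_eq
      have := (h4 C hC).card_eq
      omega
    refine ⟨⟨mem_filter.2 ⟨mem_univ _, hu, by omega⟩, hi, fun C hC => ?_, ?_, ?_, ?_,
      by omega, by omega, by omega, by omega, hd⟩, c1, c2, c3, by omega⟩
    · exact Or.inr (Or.inr (Or.inr (h4 C hC)))
    · intro C E hC hE hCE
      obtain ⟨p, hp, rfl⟩ := (hcl C).1 hC
      obtain ⟨q, hq, rfl⟩ := (hcl E).1 hE
      obtain ⟨h1, h1'⟩ := hne p hp q hq hCE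
      simpa using h2 p q hp hq h1 h1'
    · intro C _ _ hC _ _ _ _ _ hC'
      have := (h4 C hC).card_eq
      rcases hC' with h | h | h
      all_goals
        have := h.card_eq
        omega
    · intro C E F hC hE hF hCE hCF hEF _ _ _
      obtain ⟨p, hp, rfl⟩ := (hcl C).1 hC
      obtain ⟨q, hq, rfl⟩ := (hcl E).1 hE
      obtain ⟨t, ht, rfl⟩ := (hcl F).1 hF
      obtain ⟨a1, a2⟩ := hne p hp q hq hCE
      obtain ⟨a3, a4⟩ := hne p hp t ht hCF
      obtain ⟨a5, a6⟩ := hne q hq t ht hEF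
      simpa using h3 p q t hp hq ht a1 a2 a3 a4 a5 a6

end Clusters

/-- The ordered pairs of linked `r`-subsets of `Fin n`. -/
def linkedSets (n r : ℕ) : Finset (Finset (Fin n) × Finset (Fin n)) :=
  (powersetCard r univ ×ˢ powersetCard r univ).filter fun p => (p.1 ∩ p.2).card = 2

section Counting

variable {n r k : ℕ}

theorem mem_linkedSets {p : Finset (Fin n) × Finset (Fin n)} :
    p ∈ linkedSets n r ↔ p.1.card = r ∧ p.2.card = r ∧ (p.1 ∩ p.2).card = 2 := by
  simp [linkedSets, mem_powersetCard, and_assoc]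

theorem card_supersets {P : Finset (Fin n)} (hP : P.card ≤ k) :
    ((powersetCard k univ).filter fun U => P ⊆ U).card = (n - P.card).choose (k - P.card) := by
  have h : (univ \ P : Finset (Fin n)).card = n - P.card := by
    rw [card_sdiff_of_subset (subset_univ _), card_univ, Fintype.card_fin]
  rw [← h, ← card_powersetCard]
  refine card_bij' (fun U _ => U \ P) (fun U _ => U ∪ P) ?_ ?_ ?_ ?_
  · intro U hU
    simp only [mem_filter, mem_powersetCard, subset_univ, true_and] at hU
    rw [mem_powersetCard, card_sdiff_of_subset hU.2, hU.1]
    exact ⟨sdiff_subset_sdiff (subset_univ _) Subset.rfl, rfl⟩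
  · intro U hU
    rw [mem_powersetCard] at hU
    have hd : Disjoint U P := disjoint_of_subset_left hU.1 sdiff_disjoint
    simp only [mem_filter, mem_powersetCard, subset_univ, true_and]
    exact ⟨by rw [card_union_of_disjoint hd]; omega, subset_union_right⟩
  · intro U hU
    simp only [mem_filter, mem_powersetCard, subset_univ, true_and] at hU
    exact sdiff_union_of_subset hU.2
  · intro U hU
    rw [mem_powersetCard] at hU
    have hd : Disjoint U P := disjoint_of_subset_left hU.1 sdiff_disjoint
    exact union_sdiff_cancel_right hd

theorem choose_sub_sub_le (hkn : k ≤ n) (j : ℕ) (hj : j ≤ k) :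
    ((n - j).choose (k - j) : ℝ) ≤ n.choose k * ((k : ℝ) / n) ^ j := by
  induction j with
  | zero => simp
  | succ j ih =>
    have hstep : ((n - (j + 1)).choose (k - (j + 1)) : ℝ) * (n - j) =
        (n - j).choose (k - j) * (k - j) := by
      have h := Nat.add_one_mul_choose_eq (n - (j + 1)) (k - (j + 1))
      rw [show n - (j + 1) + 1 = n - j by omega, show k - (j + 1) + 1 = k - j by omega] at h
      have h' : ((n - j : ℕ) : ℝ) * (n - (j + 1)).choose (k - (j + 1)) =
        (n - j).choose (k - j) * (k - j : ℕ) := by exact_mod_cast h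
      rw [Nat.cast_sub (by omega), Nat.cast_sub (by omega)] at h'
      linarith
    have hn : (0 : ℝ) < n - j := by
      have : (j : ℝ) + 1 ≤ n := by exact_mod_cast hj.trans hkn
      linarith
    have hn0 : (0 : ℝ) < n := by
      have : (0 : ℝ) ≤ j := Nat.cast_nonneg j
      linarith
    have hk : (k : ℝ) ≤ n := by exact_mod_cast hkn
    have hfrac : ((k : ℝ) - j) / (n - j) ≤ k / n := by
      rw [div_le_div_iff₀ hn hn0]
      nlinarith [(Nat.cast_nonneg j : (0 : ℝ) ≤ j)]
    have : ((n - (j + 1)).choose (k - (j + 1)) : ℝ) =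
        (n - j).choose (k - j) * ((k - j) / (n - j)) := by
      field_simp
      linarith
    rw [this, pow_succ, ← mul_assoc]
    have h0 : (0 : ℝ) ≤ (k - j) / (n - j) := by
      apply div_nonneg _ hn.le
      have : (j : ℝ) + 1 ≤ k := by exact_mod_cast hj
      linarith
    exact mul_le_mul (ih (by omega)) hfrac h0 (by positivity)

theorem card_supersets_le (hkn : k ≤ n) (P : Finset (Fin n)) :
    (((powersetCard k univ).filter fun U => P ⊆ U).card : ℝ) ≤
      n.choose k * ((k : ℝ) / n) ^ P.card := by
  by_cases hP : P.card ≤ k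
  · rw [card_supersets hP]
    exact choose_sub_sub_le hkn _ hP
  · rw [filter_eq_empty_iff.2, card_empty, Nat.cast_zero]
    · positivity
    · intro U hU hPU
      have := card_le_card hPU
      rw [(mem_powersetCard.1 hU).2] at this
      omega

theorem card_inter_eq (hr : 2 ≤ r) {e P : Finset (Fin n)} (he : e.card = r) (hP : P.card = 2)
    (hPe : P ⊆ e) :
    ((powersetCard r univ).filter fun f => e ∩ f = P).card = (n - r).choose (r - 2) := by
  have h : (univ \ e : Finset (Fin n)).card = n - r := by
    rw [card_sdiff_of_subset (subset_univ _), card_univ, Fintype.card_fin, he]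
  rw [← h, ← card_powersetCard]
  refine card_bij' (fun U _ => U \ e) (fun U _ => U ∪ P) ?_ ?_ ?_ ?_
  · intro U hU
    simp only [mem_filter, mem_powersetCard, subset_univ, true_and] at hU
    rw [mem_powersetCard]
    refine ⟨sdiff_subset_sdiff (subset_univ _) Subset.rfl, ?_⟩
    have := card_sdiff_add_card_inter U e
    rw [inter_comm, hU.2, hP, hU.1] at this
    omega
  · intro U hU
    rw [mem_powersetCard] at hU
    have hd : Disjoint U e := disjoint_of_subset_left hU.1 sdiff_disjoint
    have hd' : Disjoint U P := disjoint_of_subset_right hPe hd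
    simp only [mem_filter, mem_powersetCard, subset_univ, true_and]
    refine ⟨by rw [card_union_of_disjoint hd']; omega, ?_⟩
    rw [inter_union_distrib_left, disjoint_iff_inter_eq_empty.1 hd.symm, empty_union]
    exact inter_eq_right.2 hPe
  · intro U hU
    simp only [mem_filter, mem_powersetCard, subset_univ, true_and] at hU
    rw [← hU.2, inter_comm]
    exact sdiff_union_inter U e
  · intro U hU
    rw [mem_powersetCard] at hU
    have hd : Disjoint U e := disjoint_of_subset_left hU.1 sdiff_disjoint
    rw [union_sdiff_distrib, sdiff_eq_empty_iff_subset.2 hPe, union_empty]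
    exact sdiff_eq_self_of_disjoint hd

theorem card_linked_to (hr : 2 ≤ r) {e : Finset (Fin n)} (he : e.card = r) :
    ((powersetCard r univ).filter fun f => (e ∩ f).card = 2).card =
      r.choose 2 * (n - r).choose (r - 2) := by
  rw [card_eq_sum_card_fiberwise (f := fun f => e ∩ f) (t := powersetCard 2 e)]
  · rw [sum_const_nat (m := (n - r).choose (r - 2)), card_powersetCard, he]
    intro P hP
    rw [mem_powersetCard] at hP
    rw [← card_inter_eq hr he hP.2 hP.1, filter_filter]
    congr 1
    apply filter_congr
    intro f _
    constructor
    · exact fun h => h.2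
    · exact fun h => ⟨by rw [h, hP.2], h⟩
  · intro f hf
    simp only [coe_filter, Set.mem_ofPred_eq] at hf
    simp only [mem_coe, mem_powersetCard]
    exact ⟨inter_subset_left, hf.2⟩

theorem card_linkedSets_filter_fst (hr : 2 ≤ r) (q : Finset (Fin n) → Prop) [DecidablePred q] :
    ((linkedSets n r).filter fun p => q p.1).card =
      ((powersetCard r univ).filter q).card * (r.choose 2 * (n - r).choose (r - 2)) := by
  rw [card_eq_sum_card_fiberwise (f := Prod.fst) (t := (powersetCard r univ).filter q)]
  · rw [sum_const_nat]
    intro e he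
    rw [mem_filter, mem_powersetCard] at he
    rw [← card_linked_to hr he.1.2]
    refine card_bij' (fun p _ => p.2) (fun f _ => (e, f)) ?_ ?_ ?_ ?_
    · rintro ⟨a, f⟩ h
      simp only [mem_filter, mem_linkedSets] at h
      obtain ⟨⟨h1, -⟩, rfl⟩ := h
      simp [mem_powersetCard, h1]
    · intro f h
      simp only [mem_filter, mem_powersetCard, subset_univ, true_and] at h
      simp [mem_linkedSets, h, he]
    · rintro ⟨a, f⟩ h
      simp only [mem_filter] at h
      simp [h.2]
    · simp
  · rintro p hp
    simp only [coe_filter, Set.mem_ofPred_eq, mem_linkedSets] at hp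
    simp [mem_powersetCard, hp]

theorem card_linkedSets (hr : 2 ≤ r) :
    (linkedSets n r).card = n.choose r * (r.choose 2 * (n - r).choose (r - 2)) := by
  have := card_linkedSets_filter_fst (n := n) hr (fun _ => True)
  simpa using this

theorem card_linkedSets_filter_snd (q : Finset (Fin n) → Prop) [DecidablePred q] :
    ((linkedSets n r).filter fun p => q p.2).card =
      ((linkedSets n r).filter fun p => q p.1).card := by
  refine card_bij' (fun p _ => p.swap) (fun p _ => p.swap) ?_ ?_ (by simp) (by simp)
  all_goals
    intro p hp
    simp only [mem_filter, mem_linkedSets, Prod.fst_swap, Prod.snd_swap] at hp ⊢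
    exact ⟨⟨hp.1.2.1, hp.1.1, by rw [inter_comm]; exact hp.1.2.2⟩, hp.2⟩

theorem card_linkedSets_filter_inter (hr : 2 ≤ r) {P : Finset (Fin n)} (hP : P.card = 2) :
    ((linkedSets n r).filter fun p => P ⊆ p.1 ∧ P ⊆ p.2).card =
      (n - 2).choose (r - 2) * (n - r).choose (r - 2) := by
  rw [card_eq_sum_card_fiberwise (f := Prod.fst)
    (t := (powersetCard r univ).filter fun e => P ⊆ e)]
  · rw [sum_const_nat (m := (n - r).choose (r - 2)), card_supersets (by omega), hP]
    intro e he
    rw [mem_filter, mem_powersetCard] at he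
    rw [← card_inter_eq hr he.1.2 hP he.2]
    refine card_bij' (fun p _ => p.2) (fun f _ => (e, f)) ?_ ?_ ?_ ?_
    · rintro ⟨a, f⟩ h
      simp only [mem_filter, mem_linkedSets] at h
      obtain ⟨⟨h1, h2, h3⟩, rfl⟩ := h
      simp only [mem_filter, mem_powersetCard, subset_univ, true_and]
      exact ⟨h1.2.1, (eq_of_subset_of_card_le (subset_inter h2 h3) (by omega)).symm⟩
    · intro f h
      simp only [mem_filter, mem_powersetCard, subset_univ, true_and] at h
      have : P ⊆ f := by rw [← h.2]; exact inter_subset_right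
      simp [mem_linkedSets, h, he, hP, this]
    · rintro ⟨a, f⟩ h
      simp only [mem_filter] at h
      simp [h.2]
    · simp
  · rintro p hp
    simp only [coe_filter, Set.mem_ofPred_eq, mem_linkedSets] at hp
    simp [mem_powersetCard, hp]

theorem card_linkedSets_filter_or (hr : 2 ≤ r) {P : Finset (Fin n)} (hP : P.card = 2) :
    (((linkedSets n r).filter fun p => P ⊆ p.1 ∨ P ⊆ p.2).card : ℝ) =
      ((r : ℝ) ^ 2 - r - 1) * ((n - 2).choose (r - 2) * (n - r).choose (r - 2)) := by
  have h1 := card_linkedSets_filter_fst (n := n) hr (fun e => P ⊆ e)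
  have h2 := card_linkedSets_filter_snd (n := n) (r := r) (fun e => P ⊆ e)
  have h3 := card_linkedSets_filter_inter (n := n) hr hP
  have h4 := card_union_add_card_inter ((linkedSets n r).filter fun p => P ⊆ p.1)
    ((linkedSets n r).filter fun p => P ⊆ p.2)
  rw [← filter_or, ← filter_and, h3, h2, h1, card_supersets (by omega), hP] at h4
  have h5 : (((linkedSets n r).filter fun p => P ⊆ p.1 ∨ P ⊆ p.2).card : ℝ) +
      (n - 2).choose (r - 2) * (n - r).choose (r - 2) =
      (n - 2).choose (r - 2) * (r.choose 2 * (n - r).choose (r - 2)) +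
      (n - 2).choose (r - 2) * (r.choose 2 * (n - r).choose (r - 2)) := by exact_mod_cast h4
  rw [Nat.cast_choose_two] at h5
  linear_combination h5

theorem card_linkedSets_eq_mul (hr : 2 ≤ r) :
    (linkedSets n r).card = n.choose (2 * r - 2) * ((2 * r - 2).choose r * r.choose 2) := by
  rw [card_linkedSets hr]
  by_cases hn : 2 * r - 2 ≤ n
  · have := Nat.choose_mul (n := n) (k := 2 * r - 2) (s := r) (by omega)
    rw [show 2 * r - 2 - r = r - 2 by omega] at this
    calc _ = r.choose 2 * (n.choose r * (n - r).choose (r - 2)) := by ring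
      _ = _ := by rw [← this]; ring
  · rw [Nat.choose_eq_zero_of_lt (show n < 2 * r - 2 by omega)]
    by_cases hn' : n < r
    · simp [Nat.choose_eq_zero_of_lt hn']
    · rw [Nat.choose_eq_zero_of_lt (show n - r < r - 2 by omega)]; simp

theorem card_linkedSets_filter_span_le (hr : 2 ≤ r) (hn : 2 * r - 2 ≤ n) (W : Finset (Fin n)) :
    (((linkedSets n r).filter fun p => W ⊆ p.1 ∪ p.2).card : ℝ) ≤
      (linkedSets n r).card * ((2 * r : ℝ) / n) ^ W.card := by
  have h1 : ((linkedSets n r).filter fun p => W ⊆ p.1 ∪ p.2).card ≤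
      ((powersetCard (2 * r - 2) univ).filter fun U => W ⊆ U).card *
        ((2 * r - 2).choose r * r.choose 2) := by
    rw [mul_comm]
    refine card_le_mul_card_image_of_maps_to (f := fun p => p.1 ∪ p.2) ?_ _ ?_
    · intro p hp
      simp only [mem_filter, mem_linkedSets] at hp
      simp only [mem_filter, mem_powersetCard, subset_univ, true_and]
      have := card_union_add_card_inter p.1 p.2
      exact ⟨by omega, hp.2⟩
    · intro U hU
      simp only [mem_filter, mem_powersetCard, subset_univ, true_and] at hU
      have : ((2 * r - 2).choose r * r.choose 2) =
          ((powersetCard r U).sigma fun e => powersetCard 2 e).card := by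
        rw [card_sigma, sum_const_nat (m := r.choose 2), card_powersetCard, hU.1]
        intro e he
        rw [card_powersetCard, (mem_powersetCard.1 he).2]
      rw [this]
      refine card_le_card_of_injOn (fun p => ⟨p.1, p.1 ∩ p.2⟩) ?_ ?_
      · intro p hp
        simp only [coe_filter, mem_filter, mem_linkedSets, Set.mem_ofPred_eq] at hp
        obtain ⟨⟨⟨h1, h2, h3⟩, -⟩, rfl⟩ := hp
        simp [mem_powersetCard, h1, h3]
      · rintro ⟨a, b⟩ hp ⟨c, d⟩ hq heq
        simp only [coe_filter, mem_filter, mem_linkedSets, Set.mem_ofPred_eq] at hp hq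
        simp only [Sigma.mk.injEq, heq_eq_eq] at heq
        obtain ⟨rfl, h⟩ := heq
        have hU' : a ∪ b = a ∪ d := hp.2.trans hq.2.symm
        have : b = d := by
          ext v
          have h1 := Finset.ext_iff.1 h v
          have h2 := Finset.ext_iff.1 hU' v
          simp only [mem_inter, mem_union] at h1 h2
          tauto
        rw [this]
  have h2 := card_supersets_le hn W
  have h3 : ((2 * r - 2 : ℕ) : ℝ) / n ≤ 2 * r / n := by
    gcongr
    have : ((2 * r - 2 : ℕ) : ℝ) ≤ (2 * r : ℕ) := by exact_mod_cast Nat.sub_le _ _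
    push_cast at this ⊢
    exact this
  calc (((linkedSets n r).filter fun p => W ⊆ p.1 ∪ p.2).card : ℝ)
      ≤ ((powersetCard (2 * r - 2) univ).filter fun U => W ⊆ U).card *
        ((2 * r - 2).choose r * r.choose 2) := by exact_mod_cast h1
    _ ≤ (n.choose (2 * r - 2) * ((2 * r : ℝ) / n) ^ W.card) *
        ((2 * r - 2).choose r * r.choose 2) := by
        gcongr
        exact h2.trans (by gcongr)
    _ = _ := by rw [card_linkedSets_eq_mul hr]; push_cast; ring

end Counting

section Sieve

/-- The `2`-subsets of edges of `L`. -/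
def shadowPairs {n : ℕ} (L : Finset (Finset (Fin n))) : Finset (Finset (Fin n)) :=
  L.biUnion (powersetCard 2)

theorem sum_card_filter_le_add_offDiag {α β : Type*} [DecidableEq β] (Ω : Finset α)
    (S : Finset β) (rel : β → α → Prop) [∀ b, DecidablePred (rel b)]
    [DecidablePred fun a => ∃ b ∈ S, rel b a] :
    ∑ b ∈ S, (Ω.filter (rel b)).card ≤ (Ω.filter fun a => ∃ b ∈ S, rel b a).card +
      ∑ x ∈ S.offDiag, (Ω.filter fun a => rel x.1 a ∧ rel x.2 a).card := by
  classical
  have h1 : ∑ b ∈ S, (Ω.filter (rel b)).card = ∑ a ∈ Ω, (S.filter fun b => rel b a).card :=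
    sum_card_bipartiteAbove_eq_sum_card_bipartiteBelow rel
  have h2 : ∑ x ∈ S.offDiag, (Ω.filter fun a => rel x.1 a ∧ rel x.2 a).card =
      ∑ a ∈ Ω, (S.offDiag.filter fun x => rel x.1 a ∧ rel x.2 a).card :=
    sum_card_bipartiteAbove_eq_sum_card_bipartiteBelow (fun (x : β × β) a => rel x.1 a ∧ rel x.2 a)
  rw [h1, h2, card_filter, ← sum_add_distrib]
  refine sum_le_sum fun a _ => ?_
  have h3 : (S.offDiag.filter fun x => rel x.1 a ∧ rel x.2 a) =
      (S.filter fun b => rel b a).offDiag := by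
    ext ⟨x, y⟩
    simp only [mem_filter, mem_offDiag]
    tauto
  rw [h3, offDiag_card]
  set t := (S.filter fun b => rel b a).card with ht
  split_ifs with h
  · rcases Nat.lt_or_ge t 2 with h' | h'
    · omega
    · have : 2 * t ≤ t * t := Nat.mul_le_mul_right t h'
      omega
  · have : t = 0 := by
      rw [ht, card_eq_zero, filter_eq_empty_iff]
      intro b hb hba
      exact h ⟨b, hb, hba⟩
    omega

variable {n r D : ℕ} {L : Finset (Finset (Fin n))}

theorem mem_shadowPairs {P : Finset (Fin n)} :
    P ∈ shadowPairs L ↔ P.card = 2 ∧ ∃ g ∈ L, P ⊆ g := by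
  simp only [shadowPairs, mem_biUnion, mem_powersetCard]
  constructor
  · rintro ⟨g, hg, h1, h2⟩
    exact ⟨h2, g, hg, h1⟩
  · rintro ⟨h2, g, hg, h1⟩
    exact ⟨g, hg, h1, h2⟩

theorem card_inter_le_one_iff {e : Finset (Fin n)} :
    (∀ g ∈ L, (e ∩ g).card ≤ 1) ↔ ∀ P ∈ shadowPairs L, ¬ P ⊆ e := by
  constructor
  · intro h P hP hPe
    obtain ⟨h2, g, hg, hPg⟩ := mem_shadowPairs.1 hP
    have := card_le_card (subset_inter hPe hPg)
    have := h g hg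
    omega
  · intro h g hg
    by_contra! hlt
    obtain ⟨P, hP, hPc⟩ := exists_subset_card_eq (show 2 ≤ (e ∩ g).card by omega)
    exact h P (mem_shadowPairs.2 ⟨hPc, g, hg, hP.trans inter_subset_right⟩)
      (hP.trans inter_subset_left)

theorem card_shadowPairs_le (hu : ∀ e ∈ L, e.card = r) :
    (shadowPairs L).card ≤ L.card * r.choose 2 := by
  refine card_biUnion_le_card_mul _ _ _ fun g hg => ?_
  rw [card_powersetCard, hu g hg]

theorem le_card_shadowPairs (hu : ∀ e ∈ L, e.card = r)
    (hi : ∀ e ∈ L, ∀ f ∈ L, e ≠ f → (e ∩ f).card ≤ 2) :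
    L.card * r.choose 2 ≤ (shadowPairs L).card + (linkedPairs L).card := by
  have h := sum_card_filter_le_add_offDiag (powersetCard 2 (univ : Finset (Fin n))) L
    (fun g P => P ⊆ g)
  have hf : ∀ g : Finset (Fin n), (powersetCard 2 univ).filter (fun P => P ⊆ g) =
      powersetCard 2 g := by
    intro g
    ext P
    simp only [mem_filter, mem_powersetCard, subset_univ, true_and]
    tauto
  have h1 : ∑ g ∈ L, ((powersetCard 2 univ).filter fun P => P ⊆ g).card =
      L.card * r.choose 2 := by
    refine sum_const_nat fun g hg => ?_
    rw [hf, card_powersetCard, hu g hg]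
  have h2 : ((powersetCard 2 univ).filter fun P => ∃ g ∈ L, P ⊆ g) = shadowPairs L := by
    ext P
    simp only [mem_filter, mem_powersetCard, subset_univ, true_and, mem_shadowPairs]
  have h3 : ∑ x ∈ L.offDiag, ((powersetCard 2 univ).filter fun P => P ⊆ x.1 ∧ P ⊆ x.2).card ≤
      (linkedPairs L).card := by
    rw [linkedPairs, card_filter]
    refine le_trans ?_ (sum_le_sum_of_subset (fun x hx => ?_ : L.offDiag ⊆ L ×ˢ L))
    · refine sum_le_sum fun x hx => ?_
      rw [mem_offDiag] at hx
      have h4 : ((powersetCard 2 univ).filter fun P => P ⊆ x.1 ∧ P ⊆ x.2) =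
          powersetCard 2 (x.1 ∩ x.2) := by
        rw [← hf (x.1 ∩ x.2)]
        exact filter_congr fun P _ => subset_inter_iff.symm
      rw [h4, card_powersetCard]
      have := hi x.1 hx.1 x.2 hx.2.1 hx.2.2
      generalize (x.1 ∩ x.2).card = c at this ⊢
      interval_cases c <;> simp
    · rw [mem_offDiag] at hx
      exact mem_product.2 ⟨hx.1, hx.2.1⟩
  rw [h1, h2] at h
  omega

theorem card_shadowPairs_filter_mem_le (hu : ∀ e ∈ L, e.card = r) (v : Fin n) :
    ((shadowPairs L).filter fun Q => v ∈ Q).card ≤ hdegree L v * r := by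
  have : ((shadowPairs L).filter fun Q => v ∈ Q) ⊆
      (L.filter fun g => v ∈ g).biUnion fun g => g.image fun w => {v, w} := by
    intro Q hQ
    rw [mem_filter, mem_shadowPairs] at hQ
    obtain ⟨⟨h2, g, hg, hQg⟩, hv⟩ := hQ
    simp only [mem_biUnion, mem_filter, mem_image]
    refine ⟨g, ⟨hg, hQg hv⟩, ?_⟩
    obtain ⟨a, b, hab, rfl⟩ := card_eq_two.1 h2
    rw [insert_subset_iff, singleton_subset_iff] at hQg
    simp only [mem_insert, mem_singleton] at hv
    rcases hv with rfl | rfl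
    · exact ⟨b, hQg.2, rfl⟩
    · exact ⟨a, hQg.1, pair_comm _ _⟩
  refine (card_le_card this).trans (card_biUnion_le_card_mul _ _ _ fun g hg => ?_)
  exact card_image_le.trans (hu g (mem_filter.1 hg).1).le

theorem card_offDiag_meeting_le (hu : ∀ e ∈ L, e.card = r) (hD : ∀ v, hdegree L v ≤ D) :
    ((shadowPairs L).offDiag.filter fun x => ¬ Disjoint x.1 x.2).card ≤
      (shadowPairs L).card * (2 * (D * r)) := by
  have : ((shadowPairs L).offDiag.filter fun x => ¬ Disjoint x.1 x.2) ⊆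
      (shadowPairs L).biUnion fun P => P.biUnion fun v =>
        ((shadowPairs L).filter fun Q => v ∈ Q).image fun Q => (P, Q) := by
    rintro ⟨P, Q⟩ hx
    rw [mem_filter, mem_offDiag, not_disjoint_iff] at hx
    obtain ⟨⟨hP, hQ, -⟩, v, hvP, hvQ⟩ := hx
    simp only [mem_biUnion, mem_image, mem_filter]
    exact ⟨P, hP, v, hvP, Q, ⟨hQ, hvQ⟩, rfl⟩
  refine (card_le_card this).trans (card_biUnion_le_card_mul _ _ _ fun P hP => ?_)
  rw [← (mem_shadowPairs.1 hP).1]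
  refine card_biUnion_le_card_mul _ _ _ fun v _ => card_image_le.trans ?_
  exact (card_shadowPairs_filter_mem_le hu v).trans (Nat.mul_le_mul_right _ (hD v))

/-- Inclusion-exclusion, to second order, for the objects avoiding all the pairs covered by a
hypergraph of bounded degree. -/
theorem sieve_bounds {ω : Type*} (Ω : Finset ω) (span : ω → Finset (Fin n))
    (bad : Finset (Fin n) → ω → Prop) [∀ P, DecidablePred (bad P)]
    [DecidablePred fun a => ∀ P ∈ shadowPairs L, ¬ bad P a]
    (hbs : ∀ P a, bad P a → P ⊆ span a) {κ T₁ : ℝ} (hκ : 0 ≤ κ)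
    (hT₁ : ∀ P ∈ shadowPairs L, ((Ω.filter (bad P)).card : ℝ) = T₁)
    (hspan : ∀ W : Finset (Fin n), ((Ω.filter fun a => W ⊆ span a).card : ℝ) ≤
      Ω.card * κ ^ W.card)
    (hu : ∀ e ∈ L, e.card = r) (hD : ∀ v, hdegree L v ≤ D) :
    (Ω.card : ℝ) - (shadowPairs L).card * T₁ ≤
        (Ω.filter fun a => ∀ P ∈ shadowPairs L, ¬ bad P a).card ∧
      ((Ω.filter fun a => ∀ P ∈ shadowPairs L, ¬ bad P a).card : ℝ) ≤
        Ω.card - (shadowPairs L).card * T₁ + Ω.card *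
          ((shadowPairs L).card * (2 * (D * r)) * κ ^ 3 + (shadowPairs L).card ^ 2 * κ ^ 4) := by
  classical
  have hcompl := card_filter_add_card_filter_not (s := Ω)
    (fun a => ∀ P ∈ shadowPairs L, ¬ bad P a)
  have hbad : (Ω.filter fun a => ¬ ∀ P ∈ shadowPairs L, ¬ bad P a) =
      Ω.filter fun a => ∃ P ∈ shadowPairs L, bad P a :=
    filter_congr fun a _ => by push Not; rfl
  rw [hbad] at hcompl
  have hcompl' : ((Ω.filter fun a => ∀ P ∈ shadowPairs L, ¬ bad P a).card : ℝ) +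
      (Ω.filter fun a => ∃ P ∈ shadowPairs L, bad P a).card = Ω.card := by exact_mod_cast hcompl
  have hsum : ((∑ P ∈ shadowPairs L, (Ω.filter (bad P)).card : ℕ) : ℝ) =
      (shadowPairs L).card * T₁ := by
    rw [Nat.cast_sum, sum_congr rfl hT₁, sum_const, nsmul_eq_mul]
  constructor
  · have h1 : (Ω.filter fun a => ∃ P ∈ shadowPairs L, bad P a).card ≤
        ∑ P ∈ shadowPairs L, (Ω.filter (bad P)).card := by
      refine (card_le_card ?_).trans card_biUnion_le
      intro a ha
      rw [mem_filter] at ha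
      obtain ⟨ha, P, hP, hb⟩ := ha
      exact mem_biUnion.2 ⟨P, hP, mem_filter.2 ⟨ha, hb⟩⟩
    have h1' : ((Ω.filter fun a => ∃ P ∈ shadowPairs L, bad P a).card : ℝ) ≤
        (shadowPairs L).card * T₁ := by
      rw [← hsum]; exact_mod_cast h1
    linarith
  · have h1 := sum_card_filter_le_add_offDiag Ω (shadowPairs L) bad
    have h2 : ((shadowPairs L).card : ℝ) * T₁ ≤
        (Ω.filter fun a => ∃ P ∈ shadowPairs L, bad P a).card +
        ∑ x ∈ (shadowPairs L).offDiag, ((Ω.filter fun a => bad x.1 a ∧ bad x.2 a).card : ℝ) := by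
      rw [← hsum]; exact_mod_cast h1
    have h3 : ∑ x ∈ (shadowPairs L).offDiag,
        ((Ω.filter fun a => bad x.1 a ∧ bad x.2 a).card : ℝ) ≤
        Ω.card * ((shadowPairs L).card * (2 * (D * r)) * κ ^ 3 +
          (shadowPairs L).card ^ 2 * κ ^ 4) := by
      have hx : ∀ x ∈ (shadowPairs L).offDiag,
          ((Ω.filter fun a => bad x.1 a ∧ bad x.2 a).card : ℝ) ≤
          Ω.card * κ ^ (x.1 ∪ x.2).card := by
        intro x _
        refine le_trans ?_ (hspan _)
        exact_mod_cast card_le_card fun a ha => by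
          rw [mem_filter] at ha ⊢
          exact ⟨ha.1, union_subset (hbs _ _ ha.2.1) (hbs _ _ ha.2.2)⟩
      rw [← sum_filter_add_sum_filter_not (shadowPairs L).offDiag (fun x => ¬ Disjoint x.1 x.2),
        mul_add]
      apply add_le_add
      · calc _ ≤ ∑ x ∈ (shadowPairs L).offDiag.filter (fun x => ¬ Disjoint x.1 x.2),
              (Ω.card * κ ^ 3 : ℝ) := by
              refine sum_le_sum fun x hx' => ?_
              rw [mem_filter] at hx'
              have h := mem_offDiag.1 hx'.1
              refine (hx x hx'.1).trans (le_of_eq ?_)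
              have h1 := (mem_shadowPairs.1 h.1).1
              have h2 := (mem_shadowPairs.1 h.2.1).1
              have h3 := card_union_add_card_inter x.1 x.2
              have h4 : 0 < (x.1 ∩ x.2).card := by
                rw [card_pos, ← not_disjoint_iff_nonempty_inter]
                exact hx'.2
              have h5 : (x.1 ∩ x.2).card ≠ 2 := by
                intro h5
                have e1 := eq_of_subset_of_card_le (inter_subset_left : x.1 ∩ x.2 ⊆ x.1)
                  (by omega)
                have e2 := eq_of_subset_of_card_le (inter_subset_right : x.1 ∩ x.2 ⊆ x.2)
                  (by omega)
                exact h.2.2 (e1.symm.trans e2)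
              have h6 : (x.1 ∩ x.2).card ≤ x.1.card := card_le_card inter_subset_left
              rw [show (x.1 ∪ x.2).card = 3 by omega]
          _ = ((shadowPairs L).offDiag.filter (fun x => ¬ Disjoint x.1 x.2)).card *
              (Ω.card * κ ^ 3) := by
              rw [sum_const, nsmul_eq_mul]
          _ ≤ ((shadowPairs L).card * (2 * (D * r)) : ℝ) * (Ω.card * κ ^ 3) := by
              gcongr
              exact_mod_cast card_offDiag_meeting_le hu hD
          _ = _ := by ring
      · calc _ ≤ ∑ x ∈ (shadowPairs L).offDiag.filter (fun x => ¬ ¬ Disjoint x.1 x.2),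
              (Ω.card * κ ^ 4 : ℝ) := by
              refine sum_le_sum fun x hx' => ?_
              rw [mem_filter, not_not] at hx'
              have h := mem_offDiag.1 hx'.1
              refine (hx x hx'.1).trans (le_of_eq ?_)
              rw [card_union_of_disjoint hx'.2, (mem_shadowPairs.1 h.1).1,
                (mem_shadowPairs.1 h.2.1).1]
          _ = ((shadowPairs L).offDiag.filter (fun x => ¬ ¬ Disjoint x.1 x.2)).card *
              (Ω.card * κ ^ 4) := by
              rw [sum_const, nsmul_eq_mul]
          _ ≤ ((shadowPairs L).card ^ 2 : ℝ) * (Ω.card * κ ^ 4) := by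
              gcongr
              have h1 : ((shadowPairs L).offDiag.filter (fun x => ¬ ¬ Disjoint x.1 x.2)).card ≤
                  (shadowPairs L).card ^ 2 := by
                refine (card_filter_le _ _).trans ?_
                rw [offDiag_card, sq]
                exact Nat.sub_le _ _
              exact_mod_cast h1
          _ = _ := by ring
    linarith

end Sieve

/-- The edges whose addition to `L` creates one more isolated edge. -/
noncomputable def isolatedAdditions {n : ℕ} (r D s h : ℕ) (L : Finset (Finset (Fin n))) :
    Finset (Finset (Fin n)) :=
  (powersetCard r univ).filter fun e =>
    (∀ g ∈ L, (e ∩ g).card ≤ 1) ∧ insert e L ∈ admissibleClass n r D (s + 1) h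

/-- The ordered linked pairs whose addition to `L` creates one more Type-4 cluster. -/
noncomputable def linkedAdditions {n : ℕ} (r D s h : ℕ) (L : Finset (Finset (Fin n))) :
    Finset (Finset (Fin n) × Finset (Fin n)) :=
  (linkedSets n r).filter fun p =>
    (∀ g ∈ L, (p.1 ∩ g).card ≤ 1 ∧ (p.2 ∩ g).card ≤ 1) ∧
      insert p.1 (insert p.2 L) ∈ admissibleClass n r D s (h + 1)

/-- The number of isolated edges at a vertex. -/
def isolatedDegree {n : ℕ} (v : Fin n) (K : Finset (Finset (Fin n))) : ℕ :=
  ((isolatedEdges K).filter fun e => v ∈ e).card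

/-- The number of ordered linked pairs whose span contains a vertex. -/
def linkedDegree {n : ℕ} (v : Fin n) (K : Finset (Finset (Fin n))) : ℕ :=
  ((linkedPairs K).filter fun p => v ∈ p.1 ∪ p.2).card

/-- The number of pairs of ordered linked pairs with intersecting spans. -/
def meetingPairs {n : ℕ} (K : Finset (Finset (Fin n))) : ℕ :=
  ∑ p ∈ linkedPairs K, ((linkedPairs ((K.erase p.1).erase p.2)).filter fun q =>
    ¬ Disjoint (p.1 ∪ p.2) (q.1 ∪ q.2)).card

/-- The falling product `q (q - c) (q - 2 * c) ⋯` with `t` factors. -/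
def stepFactorial (c : ℕ) : ℕ → ℕ → ℕ
  | 0, _ => 1
  | t + 1, q => q * stepFactorial c t (q - c)

section DoubleCounting

theorem pow_mul_factorial_le_stepFactorial (c : ℕ) :
    ∀ {t q : ℕ}, c * t ≤ q → c ^ t * t.factorial ≤ stepFactorial c t q
  | 0, q, _ => by simp [stepFactorial]
  | t + 1, q, hq => by
    have ih := pow_mul_factorial_le_stepFactorial c (t := t) (q := q - c) (by
      rw [mul_add, mul_one] at hq
      omega)
    calc c ^ (t + 1) * (t + 1).factorial = (c * (t + 1)) * (c ^ t * t.factorial) := by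
          rw [Nat.factorial_succ]; ring
      _ ≤ q * stepFactorial c t (q - c) := Nat.mul_le_mul hq ih

/-- Moments of a statistic along a chain of levels linked by double counting. -/
theorem sum_stepFactorial_le {α : Type*} (A : ℕ → Finset α) (p : α → ℕ) (c S : ℕ) {κ B : ℝ}
    (hκ : 0 ≤ κ) (hB : 0 ≤ B) (h0 : ∀ K ∈ A 0, p K = 0)
    (hrec : ∀ j < S, ∀ f : ℕ → ℕ, (∑ K ∈ A (j + 1), (p K : ℝ) * f (p K - c)) ≤
      B * ∑ L ∈ A j, (f (p L) : ℝ))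
    (hA : ∀ j < S, ((A j).card : ℝ) * B ≤ κ * (A (j + 1)).card) (t : ℕ) :
    ∀ j ≤ S, (∑ K ∈ A j, (stepFactorial c t (p K) : ℝ)) ≤ κ ^ t * (A j).card := by
  induction t with
  | zero => intro j _; simp [stepFactorial]
  | succ t ih =>
    intro j hj
    rcases j with _ | j
    · rw [sum_eq_zero]
      · positivity
      · intro K hK
        simp [stepFactorial, h0 K hK]
    · calc ∑ K ∈ A (j + 1), (stepFactorial c (t + 1) (p K) : ℝ)
          = ∑ K ∈ A (j + 1), (p K : ℝ) * stepFactorial c t (p K - c) := by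
            simp [stepFactorial]
        _ ≤ B * ∑ L ∈ A j, (stepFactorial c t (p L) : ℝ) := hrec j (by omega) _
        _ ≤ B * (κ ^ t * (A j).card) := by gcongr; exact ih j (by omega)
        _ = κ ^ t * ((A j).card * B) := by ring
        _ ≤ κ ^ t * (κ * (A (j + 1)).card) := 
            mul_le_mul_of_nonneg_left (hA j (by omega)) (by positivity)
        _ = _ := by ring

theorem card_filter_le_of_sum_stepFactorial_le {α : Type*} (A : Finset α) (p : α → ℕ) (c t : ℕ)
    {M : ℝ} (h : (∑ K ∈ A, (stepFactorial c t (p K) : ℝ)) ≤ M) :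
    ((A.filter fun K => c * t ≤ p K).card : ℝ) * ((c : ℝ) ^ t * t.factorial) ≤ M := by
  refine le_trans ?_ h
  rw [← nsmul_eq_mul, ← sum_const]
  calc ∑ K ∈ A.filter (fun K => c * t ≤ p K), (c : ℝ) ^ t * t.factorial
      ≤ ∑ K ∈ A.filter (fun K => c * t ≤ p K), (stepFactorial c t (p K) : ℝ) := by
        refine sum_le_sum fun K hK => ?_
        exact_mod_cast pow_mul_factorial_le_stepFactorial c (mem_filter.1 hK).2
    _ ≤ _ := sum_le_sum_of_subset_of_nonneg (filter_subset _ _) fun _ _ _ => Nat.cast_nonneg _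

variable {n r D s h : ℕ} {K L : Finset (Finset (Fin n))}

theorem mem_isolatedAdditions {e : Finset (Fin n)} : e ∈ isolatedAdditions r D s h L ↔
    e.card = r ∧ (∀ g ∈ L, (e ∩ g).card ≤ 1) ∧
      insert e L ∈ admissibleClass n r D (s + 1) h := by
  simp [isolatedAdditions, mem_powersetCard]

theorem mem_linkedAdditions {p : Finset (Fin n) × Finset (Fin n)} :
    p ∈ linkedAdditions r D s h L ↔ p ∈ linkedSets n r ∧
      (∀ g ∈ L, (p.1 ∩ g).card ≤ 1 ∧ (p.2 ∩ g).card ≤ 1) ∧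
      insert p.1 (insert p.2 L) ∈ admissibleClass n r D s (h + 1) := by
  simp [linkedAdditions]

theorem sum_isolated_erase (hr : 3 ≤ r) (F : Finset (Finset (Fin n)) → Finset (Fin n) → ℝ) :
    ∑ K ∈ admissibleClass n r D (s + 1) h, ∑ e ∈ isolatedEdges K, F (K.erase e) e =
      ∑ L ∈ admissibleClass n r D s h, ∑ e ∈ isolatedAdditions r D s h L, F L e := by
  rw [sum_sigma', sum_sigma']
  refine sum_bij' (fun x _ => ⟨x.1.erase x.2, x.2⟩) (fun x _ => ⟨insert x.2 x.1, x.2⟩)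
    ?_ ?_ ?_ ?_ ?_
  · rintro ⟨K, e⟩ hx
    obtain ⟨hK, he⟩ := mem_sigma.1 hx
    have hK' := (mem_admissibleClass.1 hK).1
    have heK := (mem_isolatedEdges.1 he).1
    refine mem_sigma.2 ⟨erase_isolated_mem hr hK he, mem_isolatedAdditions.2
      ⟨hK'.unif e heK, hK'.sparse_of_isolated he, ?_⟩⟩
    simpa only [insert_erase heK] using hK
  · rintro ⟨L, e⟩ hx
    obtain ⟨hL, he⟩ := mem_sigma.1 hx
    obtain ⟨h1, h2, h3⟩ := mem_isolatedAdditions.1 he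
    refine mem_sigma.2 ⟨h3, ?_⟩
    dsimp only at *
    rw [isolatedEdges_insert (by omega) h2]
    exact mem_insert_self _ _
  · rintro ⟨K, e⟩ hx
    obtain ⟨hK, he⟩ := mem_sigma.1 hx
    simp only [insert_erase (mem_isolatedEdges.1 he).1]
  · rintro ⟨L, e⟩ hx
    obtain ⟨hL, he⟩ := mem_sigma.1 hx
    obtain ⟨h1, h2, h3⟩ := mem_isolatedAdditions.1 he
    dsimp only at *
    simp only [erase_insert (notMem_of_sparse (by omega) h2)]
  · intros; rfl

theorem erase_erase_insert_insert (hr : 3 ≤ r) {e f : Finset (Fin n)} (he : e.card = r)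
    (hf : f.card = r) (hef : (e ∩ f).card = 2) (hse : ∀ g ∈ L, (e ∩ g).card ≤ 1)
    (hsf : ∀ g ∈ L, (f ∩ g).card ≤ 1) : ((insert e (insert f L)).erase e).erase f = L := by
  have hne : e ≠ f := by
    rintro rfl
    rw [inter_self] at hef
    omega
  rw [erase_insert, erase_insert (notMem_of_sparse (by omega) hsf)]
  rw [mem_insert, not_or]
  exact ⟨hne, notMem_of_sparse (by omega) hse⟩

theorem sum_linked_erase (hr : 3 ≤ r)
    (F : Finset (Finset (Fin n)) → Finset (Fin n) × Finset (Fin n) → ℝ) :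
    ∑ K ∈ admissibleClass n r D s (h + 1), ∑ p ∈ linkedPairs K, F ((K.erase p.1).erase p.2) p =
      ∑ L ∈ admissibleClass n r D s h, ∑ p ∈ linkedAdditions r D s h L, F L p := by
  rw [sum_sigma', sum_sigma']
  refine sum_bij' (fun x _ => ⟨(x.1.erase x.2.1).erase x.2.2, x.2⟩)
    (fun x _ => ⟨insert x.2.1 (insert x.2.2 x.1), x.2⟩) ?_ ?_ ?_ ?_ ?_
  · rintro ⟨K, e, f⟩ hx
    obtain ⟨hK, he⟩ := mem_sigma.1 hx
    have hK' := (mem_admissibleClass.1 hK).1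
    obtain ⟨h1, h2, h3⟩ := mem_linkedPairs.1 he
    refine mem_sigma.2 ⟨erase_linked_mem hr hK he, mem_linkedAdditions.2
      ⟨mem_linkedSets.2 ⟨hK'.unif _ h1, hK'.unif _ h2, h3⟩, fun g hg =>
        ⟨hK'.sparse_of_linked he g hg, hK'.sparse_of_linked' he g hg⟩, ?_⟩⟩
    dsimp only at *
    rwa [insert_erase_erase_of_linked hr hK' he]
  · rintro ⟨L, e, f⟩ hx
    obtain ⟨hL, he⟩ := mem_sigma.1 hx
    obtain ⟨h1, h2, h3⟩ := mem_linkedAdditions.1 he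
    refine mem_sigma.2 ⟨h3, mem_linkedPairs.2 ⟨mem_insert_self _ _,
      mem_insert_of_mem (mem_insert_self _ _), (mem_linkedSets.1 h1).2.2⟩⟩
  · rintro ⟨K, e, f⟩ hx
    obtain ⟨hK, he⟩ := mem_sigma.1 hx
    dsimp only at *
    rw [insert_erase_erase_of_linked hr (mem_admissibleClass.1 hK).1 he]
  · rintro ⟨L, e, f⟩ hx
    obtain ⟨hL, he⟩ := mem_sigma.1 hx
    obtain ⟨h1, h2, h3⟩ := mem_linkedAdditions.1 he
    obtain ⟨h4, h5, h6⟩ := mem_linkedSets.1 h1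
    dsimp only at *
    rw [erase_erase_insert_insert hr h4 h5 h6 (fun g hg => (h2 g hg).1) fun g hg => (h2 g hg).2]
  · intros; rfl

theorem succ_mul_card_admissibleClass_isolated (hr : 3 ≤ r) :
    ((s + 1 : ℕ) : ℝ) * (admissibleClass n r D (s + 1) h).card =
      ∑ L ∈ admissibleClass n r D s h, ((isolatedAdditions r D s h L).card : ℝ) := by
  have := sum_isolated_erase (n := n) (D := D) (s := s) (h := h) hr fun _ _ => 1
  simp only [sum_const, nsmul_eq_mul, mul_one] at this
  rw [← this, mul_comm, ← nsmul_eq_mul, ← sum_const]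
  refine sum_congr rfl fun K hK => ?_
  rw [(mem_admissibleClass.1 hK).2.1]

theorem succ_mul_card_admissibleClass_linked (hr : 3 ≤ r) :
    ((2 * (h + 1) : ℕ) : ℝ) * (admissibleClass n r D s (h + 1)).card =
      ∑ L ∈ admissibleClass n r D s h, ((linkedAdditions r D s h L).card : ℝ) := by
  have := sum_linked_erase (n := n) (D := D) (s := s) (h := h) hr fun _ _ => 1
  simp only [sum_const, nsmul_eq_mul, mul_one] at this
  rw [← this, mul_comm, ← nsmul_eq_mul, ← sum_const]
  refine sum_congr rfl fun K hK => ?_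
  rw [(mem_admissibleClass.1 hK).2.2]

theorem hdegree_le_isolatedDegree_add_linkedDegree (v : Fin n) :
    hdegree K v ≤ isolatedDegree v K + linkedDegree v K := by
  classical
  have : (K.filter fun e => v ∈ e) ⊆ ((isolatedEdges K).filter fun e => v ∈ e) ∪
      ((linkedPairs K).filter fun p => v ∈ p.1 ∪ p.2).image Prod.fst := by
    intro e he
    rw [mem_filter] at he
    by_cases h : e ∈ isolatedEdges K
    · exact mem_union_left _ (mem_filter.2 ⟨h, he.2⟩)
    · rw [mem_isolatedEdges] at h
      push Not at h
      obtain ⟨f, hf, h2⟩ := h he.1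
      exact mem_union_right _ (mem_image.2 ⟨(e, f), mem_filter.2
        ⟨mem_linkedPairs.2 ⟨he.1, hf, h2⟩, mem_union_left _ he.2⟩, rfl⟩)
  refine (card_le_card this).trans ((card_union_le _ _).trans ?_)
  exact Nat.add_le_add le_rfl card_image_le

theorem isolatedDegree_erase (hr : 3 ≤ r) (hK : IsAdmissible r D K) {e : Finset (Fin n)}
    (he : e ∈ isolatedEdges K) {v : Fin n} (hv : v ∈ e) :
    isolatedDegree v (K.erase e) = isolatedDegree v K - 1 := by
  have h1 := (mem_isolatedEdges.1 he).1
  have h2 := hK.unif e h1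
  have h3 := hK.sparse_of_isolated he
  have h4 := isolatedEdges_insert (by omega) h3
  rw [insert_erase h1] at h4
  rw [isolatedDegree, isolatedDegree, h4, filter_insert, if_pos hv, card_insert_of_notMem]
  · rfl
  · intro h
    exact notMem_erase e K (mem_isolatedEdges.1 (mem_filter.1 h).1).1

theorem linkedDegree_erase (hr : 3 ≤ r) (hK : IsAdmissible r D K)
    {p : Finset (Fin n) × Finset (Fin n)} (hp : p ∈ linkedPairs K) {v : Fin n}
    (hv : v ∈ p.1 ∪ p.2) :
    linkedDegree v ((K.erase p.1).erase p.2) = linkedDegree v K - 2 := by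
  obtain ⟨e, f⟩ := p
  obtain ⟨h1, h2, h3⟩ := mem_linkedPairs.1 hp
  dsimp only at *
  have he := hK.unif e h1
  have hf := hK.unif f h2
  have hne := ne_of_linked hr hK hp
  have h4 := linkedPairs_insert_insert (by omega) (by omega) h3 (hK.sparse_of_linked hp)
    (hK.sparse_of_linked' hp)
  rw [insert_erase_erase_of_linked hr hK hp] at h4
  have hn : ∀ x, (e, x) ∉ linkedPairs ((K.erase e).erase f) := fun x hx => by
    have := (mem_linkedPairs.1 hx).1
    simp at this
  have hn' : ∀ x, (f, x) ∉ linkedPairs ((K.erase e).erase f) := fun x hx => by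
    have := (mem_linkedPairs.1 hx).1
    simp at this
  rw [linkedDegree, linkedDegree, h4, filter_insert, if_pos hv, filter_insert,
    if_pos (by rwa [union_comm]), card_insert_of_notMem, card_insert_of_notMem]
  · rfl
  · exact fun h => hn' _ (mem_filter.1 h).1
  · rw [mem_insert, not_or]
    exact ⟨fun h => hne (Prod.ext_iff.1 h).1, fun h => hn _ (mem_filter.1 h).1⟩

end DoubleCounting

section Moments

variable {n r D s h : ℕ} {K L : Finset (Finset (Fin n))}

theorem card_filter_mem_isolatedAdditions_le (hrn : r ≤ n) (v : Fin n) :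
    (((isolatedAdditions r D s h L).filter fun e => v ∈ e).card : ℝ) ≤
      n.choose r * ((r : ℝ) / n) := by
  have h1 := card_supersets_le hrn ({v} : Finset (Fin n))
  rw [card_singleton, pow_one] at h1
  refine le_trans ?_ h1
  refine Nat.cast_le.2 (card_le_card fun e he => ?_)
  rw [mem_filter, mem_isolatedAdditions] at he
  exact mem_filter.2 ⟨mem_powersetCard.2 ⟨subset_univ _, he.1.1⟩, singleton_subset_iff.2 he.2⟩

theorem card_filter_mem_linkedAdditions_le (hr : 3 ≤ r) (hrn : 2 * r - 2 ≤ n) (v : Fin n) :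
    (((linkedAdditions r D s h L).filter fun p => v ∈ p.1 ∪ p.2).card : ℝ) ≤
      (linkedSets n r).card * (2 * (r : ℝ) / n) := by
  have h1 := card_linkedSets_filter_span_le (by omega : 2 ≤ r) hrn ({v} : Finset (Fin n))
  rw [card_singleton, pow_one] at h1
  refine le_trans ?_ h1
  refine Nat.cast_le.2 (card_le_card fun p hp => ?_)
  rw [mem_filter, mem_linkedAdditions] at hp
  exact mem_filter.2 ⟨hp.1.1, singleton_subset_iff.2 hp.2⟩

theorem sum_isolatedDegree_mul_le (hr : 3 ≤ r) (hrn : r ≤ n) (v : Fin n) (f : ℕ → ℕ) :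
    ∑ K ∈ admissibleClass n r D (s + 1) h, (isolatedDegree v K : ℝ) *
        f (isolatedDegree v K - 1) ≤
      n.choose r * ((r : ℝ) / n) *
        ∑ L ∈ admissibleClass n r D s h, (f (isolatedDegree v L) : ℝ) := by
  let F : Finset (Finset (Fin n)) → Finset (Fin n) → ℝ :=
    fun L e => if v ∈ e then (f (isolatedDegree v L) : ℝ) else 0
  calc _ = ∑ K ∈ admissibleClass n r D (s + 1) h, ∑ e ∈ isolatedEdges K, F (K.erase e) e := by
        refine sum_congr rfl fun K hK => ?_
        dsimp only [F]
        rw [← sum_filter, sum_congr rfl fun e he => by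
          rw [isolatedDegree_erase hr (mem_admissibleClass.1 hK).1 (mem_filter.1 he).1
            (mem_filter.1 he).2], sum_const, nsmul_eq_mul, isolatedDegree]
    _ = ∑ L ∈ admissibleClass n r D s h, ∑ e ∈ isolatedAdditions r D s h L,
        F L e := sum_isolated_erase hr F
    _ ≤ _ := by
        rw [mul_sum]
        refine sum_le_sum fun L _ => ?_
        dsimp only [F]
        rw [← sum_filter, sum_const, nsmul_eq_mul]
        exact mul_le_mul_of_nonneg_right (card_filter_mem_isolatedAdditions_le hrn v)
          (Nat.cast_nonneg _)

theorem sum_linkedDegree_mul_le (hr : 3 ≤ r) (hrn : 2 * r - 2 ≤ n) (v : Fin n) (f : ℕ → ℕ) :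
    ∑ K ∈ admissibleClass n r D s (h + 1), (linkedDegree v K : ℝ) *
        f (linkedDegree v K - 2) ≤
      (linkedSets n r).card * (2 * (r : ℝ) / n) *
        ∑ L ∈ admissibleClass n r D s h, (f (linkedDegree v L) : ℝ) := by
  let F : Finset (Finset (Fin n)) → Finset (Fin n) × Finset (Fin n) → ℝ :=
    fun L p => if v ∈ p.1 ∪ p.2 then (f (linkedDegree v L) : ℝ) else 0
  calc _ = ∑ K ∈ admissibleClass n r D s (h + 1), ∑ p ∈ linkedPairs K,
        F ((K.erase p.1).erase p.2) p := by
        refine sum_congr rfl fun K hK => ?_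
        dsimp only [F]
        rw [← sum_filter, sum_congr rfl fun e he => by
          rw [linkedDegree_erase hr (mem_admissibleClass.1 hK).1 (mem_filter.1 he).1
            (mem_filter.1 he).2], sum_const, nsmul_eq_mul, linkedDegree]
    _ = ∑ L ∈ admissibleClass n r D s h, ∑ p ∈ linkedAdditions r D s h L,
        F L p := sum_linked_erase hr F
    _ ≤ _ := by
        rw [mul_sum]
        refine sum_le_sum fun L _ => ?_
        dsimp only [F]
        rw [← sum_filter, sum_const, nsmul_eq_mul]
        exact mul_le_mul_of_nonneg_right (card_filter_mem_linkedAdditions_le hr hrn v)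
          (Nat.cast_nonneg _)

theorem card_admissibleClass_mul_le_isolated (hr : 3 ≤ r)
    (hmin : ∀ L ∈ admissibleClass n r D s h,
      (n.choose r : ℝ) / 2 ≤ (isolatedAdditions r D s h L).card) :
    ((admissibleClass n r D s h).card : ℝ) * (n.choose r : ℝ) ≤
      2 * (s + 1 : ℕ) * (admissibleClass n r D (s + 1) h).card := by
  have h1 := succ_mul_card_admissibleClass_isolated (n := n) (D := D) (s := s) (h := h) hr
  have h2 := card_nsmul_le_sum _ _ _ hmin
  rw [nsmul_eq_mul] at h2
  linarith

theorem card_admissibleClass_mul_le_linked (hr : 3 ≤ r)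
    (hmin : ∀ L ∈ admissibleClass n r D s h,
      ((linkedSets n r).card : ℝ) / 2 ≤ (linkedAdditions r D s h L).card) :
    ((admissibleClass n r D s h).card : ℝ) * ((linkedSets n r).card : ℝ) ≤
      4 * (h + 1 : ℕ) * (admissibleClass n r D s (h + 1)).card := by
  have h1 := succ_mul_card_admissibleClass_linked (n := n) (D := D) (s := s) (h := h) hr
  have h2 := card_nsmul_le_sum _ _ _ hmin
  rw [nsmul_eq_mul] at h2
  push_cast at h1 ⊢
  linarith

/-- Tail bound for the number of isolated edges at a vertex. -/
theorem card_isolatedDegree_tail_le (hr : 3 ≤ r) (hrn : r ≤ n) {S : ℕ}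
    (hmin : ∀ j < S, ∀ L ∈ admissibleClass n r D j h,
      (n.choose r : ℝ) / 2 ≤ (isolatedAdditions r D j h L).card) (hs : s ≤ S) (v : Fin n) (t : ℕ) :
    (((admissibleClass n r D s h).filter fun K => t ≤ isolatedDegree v K).card : ℝ) *
      t.factorial ≤ (2 * S * r / n) ^ t * (admissibleClass n r D s h).card := by
  have h1 := sum_stepFactorial_le (fun j => admissibleClass n r D j h) (isolatedDegree v) 1 S
    (κ := 2 * S * r / n) (B := n.choose r * ((r : ℝ) / n)) (by positivity) (by positivity)
    (fun K hK => by
      have := (mem_admissibleClass.1 hK).2.1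
      rw [card_eq_zero] at this
      rw [isolatedDegree, this]; rfl)
    (fun j _ f => sum_isolatedDegree_mul_le hr hrn v f)
    (fun j hj => by
      have h2 := card_admissibleClass_mul_le_isolated hr (hmin j hj)
      have h3 : ((j + 1 : ℕ) : ℝ) ≤ S := by exact_mod_cast hj
      calc _ = ((admissibleClass n r D j h).card : ℝ) * (n.choose r : ℝ) * ((r : ℝ) / n) := by
            ring
        _ ≤ (2 * S * (admissibleClass n r D (j + 1) h).card) * ((r : ℝ) / n) := by
            refine mul_le_mul_of_nonneg_right (h2.trans ?_) (by positivity)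
            gcongr
        _ = _ := by ring) t s hs
  simpa using card_filter_le_of_sum_stepFactorial_le _ _ _ _ h1

/-- Tail bound for the number of linked pairs at a vertex. -/
theorem card_linkedDegree_tail_le (hr : 3 ≤ r) (hrn : 2 * r - 2 ≤ n) {H : ℕ}
    (hmin : ∀ j < H, ∀ L ∈ admissibleClass n r D s j,
      ((linkedSets n r).card : ℝ) / 2 ≤ (linkedAdditions r D s j L).card) (hh : h ≤ H) (v : Fin n)
    (t : ℕ) :
    (((admissibleClass n r D s h).filter fun K => 2 * t ≤ linkedDegree v K).card : ℝ) ≤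
      (8 * H * r / n) ^ t * (admissibleClass n r D s h).card := by
  have h1 := sum_stepFactorial_le (fun j => admissibleClass n r D s j) (linkedDegree v) 2 H
    (κ := 8 * H * r / n) (B := (linkedSets n r).card * (2 * (r : ℝ) / n)) (by positivity)
    (by positivity)
    (fun K hK => by
      have := (mem_admissibleClass.1 hK).2.2
      rw [mul_zero, card_eq_zero] at this
      rw [linkedDegree, this]; rfl)
    (fun j _ f => sum_linkedDegree_mul_le hr hrn v f)
    (fun j hj => by
      have h2 := card_admissibleClass_mul_le_linked hr (hmin j hj)
      have h3 : ((j + 1 : ℕ) : ℝ) ≤ H := by exact_mod_cast hj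
      calc _ = ((admissibleClass n r D s j).card : ℝ) * ((linkedSets n r).card : ℝ) *
            (2 * (r : ℝ) / n) := by ring
        _ ≤ (4 * H * (admissibleClass n r D s (j + 1)).card) * (2 * (r : ℝ) / n) := by
            refine mul_le_mul_of_nonneg_right (h2.trans ?_) (by positivity)
            gcongr
        _ = _ := by ring) t h hh
  refine le_trans ?_ (card_filter_le_of_sum_stepFactorial_le _ _ _ _ h1)
  refine le_mul_of_one_le_right (Nat.cast_nonneg _) ?_
  have : 1 ≤ 2 ^ t * t.factorial := Nat.mul_pos (by positivity) (Nat.factorial_pos t)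
  exact_mod_cast this

theorem card_span_le {p : Finset (Fin n) × Finset (Fin n)} (hp : p ∈ linkedSets n r) :
    (p.1 ∪ p.2).card = 2 * r - 2 := by
  obtain ⟨h1, h2, h3⟩ := mem_linkedSets.1 hp
  have := card_union_add_card_inter p.1 p.2
  omega

theorem mem_linkedSets_of_mem_linkedPairs (hu : ∀ e ∈ K, e.card = r)
    {p : Finset (Fin n) × Finset (Fin n)} (hp : p ∈ linkedPairs K) : p ∈ linkedSets n r := by
  obtain ⟨h1, h2, h3⟩ := mem_linkedPairs.1 hp
  exact mem_linkedSets.2 ⟨hu _ h1, hu _ h2, h3⟩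

/-- On average few linked pairs have intersecting spans. -/
theorem sum_meetingPairs_le (hr : 3 ≤ r) (hrn : 2 * r - 2 ≤ n)
    (hmin : ∀ j < h, ∀ L ∈ admissibleClass n r D s j,
      ((linkedSets n r).card : ℝ) / 2 ≤ (linkedAdditions r D s j L).card) :
    ∑ K ∈ admissibleClass n r D s h, (meetingPairs K : ℝ) ≤
      32 * h ^ 2 * r ^ 2 / n * (admissibleClass n r D s h).card := by
  rcases h with _ | h
  · rw [sum_eq_zero]
    · positivity
    · intro K hK
      have := (mem_admissibleClass.1 hK).2.2
      rw [mul_zero, card_eq_zero] at this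
      rw [meetingPairs, this, sum_empty, Nat.cast_zero]
  have h1 := card_admissibleClass_mul_le_linked hr (hmin h (Nat.lt_succ_self h))
  have hT : ∀ L ∈ admissibleClass n r D s h,
      ∑ p ∈ linkedAdditions r D s h L, (((linkedPairs L).filter fun q =>
        ¬ Disjoint (p.1 ∪ p.2) (q.1 ∪ q.2)).card : ℝ) ≤
      2 * h * (2 * r * ((linkedSets n r).card * (2 * (r : ℝ) / n))) := by
    intro L hL
    have hL' := mem_admissibleClass.1 hL
    have h2 : ∑ p ∈ linkedAdditions r D s h L, ((linkedPairs L).filter fun q =>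
        ¬ Disjoint (p.1 ∪ p.2) (q.1 ∪ q.2)).card =
        ∑ q ∈ linkedPairs L, ((linkedAdditions r D s h L).filter fun p =>
          ¬ Disjoint (p.1 ∪ p.2) (q.1 ∪ q.2)).card :=
      sum_card_bipartiteAbove_eq_sum_card_bipartiteBelow
        (fun p q : Finset (Fin n) × Finset (Fin n) => ¬ Disjoint (p.1 ∪ p.2) (q.1 ∪ q.2))
    rw [← Nat.cast_sum, h2, Nat.cast_sum]
    calc _ ≤ (linkedPairs L).card • (2 * r * ((linkedSets n r).card * (2 * (r : ℝ) / n))) := by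
          refine sum_le_card_nsmul _ _ _ fun q hq => ?_
          have h3 : ((linkedAdditions r D s h L).filter fun p =>
              ¬ Disjoint (p.1 ∪ p.2) (q.1 ∪ q.2)) ⊆ (q.1 ∪ q.2).biUnion fun v =>
                (linkedAdditions r D s h L).filter fun p => v ∈ p.1 ∪ p.2 := by
            intro p hp
            rw [mem_filter, not_disjoint_iff] at hp
            obtain ⟨hp, v, hv, hv'⟩ := hp
            exact mem_biUnion.2 ⟨v, hv', mem_filter.2 ⟨hp, hv⟩⟩
          have h4 : (((linkedAdditions r D s h L).filter fun p =>
              ¬ Disjoint (p.1 ∪ p.2) (q.1 ∪ q.2)).card : ℝ) ≤ ∑ v ∈ q.1 ∪ q.2,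
                (((linkedAdditions r D s h L).filter fun p => v ∈ p.1 ∪ p.2).card : ℝ) := by
            exact_mod_cast (card_le_card h3).trans card_biUnion_le
          refine h4.trans ((sum_le_card_nsmul _ _ _ fun v _ =>
            card_filter_mem_linkedAdditions_le hr hrn v).trans ?_)
          rw [nsmul_eq_mul, card_span_le (mem_linkedSets_of_mem_linkedPairs hL'.1.unif hq)]
          have : ((2 * r - 2 : ℕ) : ℝ) ≤ 2 * r := by exact_mod_cast Nat.sub_le _ _
          gcongr
      _ = _ := by rw [nsmul_eq_mul, hL'.2.2]; push_cast; ring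
  let F : Finset (Finset (Fin n)) → Finset (Fin n) × Finset (Fin n) → ℝ := fun L p =>
    (((linkedPairs L).filter fun q => ¬ Disjoint (p.1 ∪ p.2) (q.1 ∪ q.2)).card : ℝ)
  calc ∑ K ∈ admissibleClass n r D s (h + 1), (meetingPairs K : ℝ)
      = ∑ K ∈ admissibleClass n r D s (h + 1), ∑ p ∈ linkedPairs K,
          F ((K.erase p.1).erase p.2) p := by
        refine sum_congr rfl fun K _ => ?_
        rw [meetingPairs, Nat.cast_sum]
    _ = ∑ L ∈ admissibleClass n r D s h, ∑ p ∈ linkedAdditions r D s h L, F L p :=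
        sum_linked_erase hr F
    _ ≤ (admissibleClass n r D s h).card •
        (2 * h * (2 * r * ((linkedSets n r).card * (2 * (r : ℝ) / n)))) :=
        sum_le_card_nsmul _ _ _ hT
    _ = ((admissibleClass n r D s h).card * (linkedSets n r).card) * (8 * h * r ^ 2 / n) := by
        rw [nsmul_eq_mul]; ring
    _ ≤ (4 * (h + 1 : ℕ) * (admissibleClass n r D s (h + 1)).card) *
        (8 * (h + 1 : ℕ) * r ^ 2 / n) := by
        gcongr
        exact Nat.le_succ h
    _ = _ := by ring

end Moments

/-- The vertices of degree at least `d`. -/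
def highVertices {n : ℕ} (d : ℕ) (L : Finset (Finset (Fin n))) : Finset (Fin n) :=
  univ.filter fun v => d ≤ hdegree L v

section Additions

variable {n r D s h : ℕ} {L : Finset (Finset (Fin n))}

theorem card_highVertices_mul_le (hu : ∀ e ∈ L, e.card = r) (d : ℕ) :
    (highVertices d L).card * d ≤ L.card * r := by
  calc (highVertices d L).card * d ≤ ∑ v ∈ highVertices d L, hdegree L v := by
        rw [← smul_eq_mul]
        exact card_nsmul_le_sum _ _ _ fun v hv => (mem_filter.1 hv).2
    _ ≤ ∑ v, hdegree L v := sum_le_sum_of_subset (subset_univ _)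
    _ = ∑ e ∈ L, ((univ : Finset (Fin n)).filter fun v => v ∈ e).card :=
        sum_card_bipartiteAbove_eq_sum_card_bipartiteBelow fun v e => v ∈ e
    _ = L.card * r := by
        refine sum_const_nat fun e he => ?_
        rw [filter_mem_eq_inter, univ_inter, hu e he]

theorem cast_card_biUnion_le {α β : Type*} [DecidableEq β] (A : Finset α) (f : α → Finset β)
    {c : ℝ} (hc : ∀ a ∈ A, ((f a).card : ℝ) ≤ c) : ((A.biUnion f).card : ℝ) ≤ A.card * c := by
  calc ((A.biUnion f).card : ℝ) ≤ ∑ a ∈ A, ((f a).card : ℝ) := by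
        exact_mod_cast card_biUnion_le
    _ ≤ A.card • c := sum_le_card_nsmul _ _ _ hc
    _ = _ := nsmul_eq_mul _ _

theorem isolatedAdditions_bounds (hr : 3 ≤ r) (hrn : r ≤ n)
    (hL : L ∈ admissibleClass n r D s h) :
    (n.choose r : ℝ) - (shadowPairs L).card * (n - 2).choose (r - 2) -
        (highVertices D L).card * (n.choose r * ((r : ℝ) / n)) ≤
      (isolatedAdditions r D s h L).card ∧
    ((isolatedAdditions r D s h L).card : ℝ) ≤
      n.choose r - (shadowPairs L).card * (n - 2).choose (r - 2) + n.choose r *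
        ((shadowPairs L).card * (2 * (D * r)) * ((r : ℝ) / n) ^ 3 +
          (shadowPairs L).card ^ 2 * ((r : ℝ) / n) ^ 4) := by
  classical
  have hL' := (mem_admissibleClass.1 hL).1
  obtain ⟨h1, h2⟩ := sieve_bounds (L := L) (D := D) (r := r) (powersetCard r univ) id
    (fun P e => P ⊆ e) (fun P a h => h) (κ := (r : ℝ) / n) (T₁ := (n - 2).choose (r - 2))
    (by positivity)
    (fun P hP => by
      have hP2 := (mem_shadowPairs.1 hP).1
      rw [card_supersets (by omega), hP2])
    (fun W => by
      rw [card_powersetCard, card_univ, Fintype.card_fin]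
      exact card_supersets_le hrn W) hL'.unif hL'.deg
  rw [card_powersetCard, card_univ, Fintype.card_fin] at h1 h2
  set G := (powersetCard r (univ : Finset (Fin n))).filter fun e =>
    ∀ P ∈ shadowPairs L, ¬ P ⊆ e with hG
  constructor
  · have h3 : G ⊆ isolatedAdditions r D s h L ∪ (highVertices D L).biUnion fun v =>
        (powersetCard r univ).filter fun e => {v} ⊆ e := by
      intro e he
      rw [hG, mem_filter, mem_powersetCard, ← card_inter_le_one_iff] at he
      obtain ⟨⟨-, he⟩, hs⟩ := he
      by_cases hd : ∀ v ∈ e, hdegree L v < D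
      · exact mem_union_left _ (mem_isolatedAdditions.2
          ⟨he, hs, insert_isolated_mem hr hL he hs hd⟩)
      · push Not at hd
        obtain ⟨v, hv, hd⟩ := hd
        exact mem_union_right _ (mem_biUnion.2 ⟨v, mem_filter.2 ⟨mem_univ _, hd⟩,
          mem_filter.2 ⟨mem_powersetCard.2 ⟨subset_univ _, he⟩, singleton_subset_iff.2 hv⟩⟩)
    have h4 : (G.card : ℝ) ≤ (isolatedAdditions r D s h L).card +
        ((highVertices D L).biUnion fun v =>
          (powersetCard r univ).filter fun e => {v} ⊆ e).card := by
      exact_mod_cast (card_le_card h3).trans (card_union_le _ _)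
    have h5 : (((highVertices D L).biUnion fun v =>
        (powersetCard r univ).filter fun e => {v} ⊆ e).card : ℝ) ≤
        (highVertices D L).card * (n.choose r * ((r : ℝ) / n)) :=
      cast_card_biUnion_le _ _ fun v _ => by
        simpa using card_supersets_le hrn ({v} : Finset (Fin n))
    linarith
  · refine le_trans ?_ h2
    refine Nat.cast_le.2 (card_le_card fun e he => ?_)
    obtain ⟨he, hs, -⟩ := mem_isolatedAdditions.1 he
    exact mem_filter.2 ⟨mem_powersetCard.2 ⟨subset_univ _, he⟩, card_inter_le_one_iff.1 hs⟩

theorem exists_pair_of_card_union_lt {X Y Z : Finset (Fin n)} {a : ℕ} (ha : 2 ≤ a)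
    (hX : X.card = a) (hY : Y.card = a) (hZ : Z.card = a) (hXY : (X ∩ Y).card ≤ 1)
    (hXZ : (X ∩ Z).card ≤ 1) (hYZ : (Y ∩ Z).card ≤ 1) (h : (X ∪ Y ∪ Z).card < 3 * a - 2) :
    ¬ Disjoint X Y ∧ ∃ W ∈ powersetCard 2 (X ∪ Y), W ⊆ Z := by
  have h1 := card_union_add_card_inter X Y
  have h2 := card_union_add_card_inter (X ∪ Y) Z
  have h3 : ((X ∪ Y) ∩ Z).card ≤ (X ∩ Z).card + (Y ∩ Z).card := by
    rw [union_inter_distrib_right]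
    exact card_union_le _ _
  constructor
  · rw [disjoint_iff_inter_eq_empty, ← card_eq_zero]
    omega
  · obtain ⟨W, hW, hWc⟩ := exists_subset_card_eq (show 2 ≤ ((X ∪ Y) ∩ Z).card by omega)
    exact ⟨W, mem_powersetCard.2 ⟨hW.trans inter_subset_left, hWc⟩, hW.trans inter_subset_right⟩

theorem choose_two_le_half_sq (a : ℕ) : ((a.choose 2 : ℕ) : ℝ) ≤ (a : ℝ) ^ 2 / 2 := by
  rw [Nat.cast_choose_two]
  nlinarith [(Nat.cast_nonneg a : (0 : ℝ) ≤ a)]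

/-- The linked pairs sharing with the span of a fixed set of pairs of vertices. -/
theorem cast_card_biUnion_supersets_le (hr : 3 ≤ r) (hrn : 2 * r - 2 ≤ n) (U : Finset (Fin n))
    {b : ℝ} (hU : (U.card : ℝ) ≤ b) :
    (((powersetCard 2 U).biUnion fun W =>
      (linkedSets n r).filter fun p => W ⊆ p.1 ∪ p.2).card : ℝ) ≤
      b ^ 2 / 2 * ((linkedSets n r).card * (2 * (r : ℝ) / n) ^ 2) := by
  refine (cast_card_biUnion_le _ _ fun W hW => by
    have := card_linkedSets_filter_span_le (by omega : 2 ≤ r) hrn W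
    rwa [(mem_powersetCard.1 hW).2] at this).trans ?_
  rw [card_powersetCard]
  refine mul_le_mul_of_nonneg_right ((choose_two_le_half_sq _).trans ?_) (by positivity)
  gcongr

theorem linkedAdditions_bounds (hr : 3 ≤ r) (hrn : 2 * r - 2 ≤ n)
    (hL : L ∈ admissibleClass n r D s h) :
    ((linkedSets n r).card : ℝ) - (shadowPairs L).card * (((r : ℝ) ^ 2 - r - 1) *
          ((n - 2).choose (r - 2) * (n - r).choose (r - 2))) -
        (linkedSets n r).card * ((highVertices (D - 1) L).card * (2 * (r : ℝ) / n) +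
          16 * h * r ^ 4 / n ^ 2 + meetingPairs L * (32 * r ^ 4 / n ^ 2)) ≤
      (linkedAdditions r D s h L).card ∧
    ((linkedAdditions r D s h L).card : ℝ) ≤
      (linkedSets n r).card - (shadowPairs L).card * (((r : ℝ) ^ 2 - r - 1) *
          ((n - 2).choose (r - 2) * (n - r).choose (r - 2))) + (linkedSets n r).card *
        ((shadowPairs L).card * (2 * (D * r)) * (2 * (r : ℝ) / n) ^ 3 +
          (shadowPairs L).card ^ 2 * (2 * (r : ℝ) / n) ^ 4) := by
  classical
  have hL' := (mem_admissibleClass.1 hL).1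
  obtain ⟨h1, h2⟩ := sieve_bounds (L := L) (D := D) (r := r) (linkedSets n r)
    (fun p => p.1 ∪ p.2) (fun P p => P ⊆ p.1 ∨ P ⊆ p.2)
    (fun P a h => h.elim (fun h => h.trans subset_union_left) fun h => h.trans subset_union_right)
    (κ := 2 * (r : ℝ) / n)
    (T₁ := ((r : ℝ) ^ 2 - r - 1) * ((n - 2).choose (r - 2) * (n - r).choose (r - 2)))
    (by positivity)
    (fun P hP => card_linkedSets_filter_or (by omega) (mem_shadowPairs.1 hP).1)
    (fun W => card_linkedSets_filter_span_le (by omega) hrn W) hL'.unif hL'.deg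
  set T := linkedSets n r with hT
  set G := T.filter fun p => ∀ P ∈ shadowPairs L, ¬ (P ⊆ p.1 ∨ P ⊆ p.2) with hG
  have hGs : ∀ p : Finset (Fin n) × Finset (Fin n),
      (∀ P ∈ shadowPairs L, ¬ (P ⊆ p.1 ∨ P ⊆ p.2)) ↔
        ∀ g ∈ L, (p.1 ∩ g).card ≤ 1 ∧ (p.2 ∩ g).card ≤ 1 := by
    intro p
    have e1 := card_inter_le_one_iff (L := L) (e := p.1)
    have e2 := card_inter_le_one_iff (L := L) (e := p.2)
    constructor
    · intro hp g hg
      exact ⟨e1.2 (fun P hP h => hp P hP (Or.inl h)) g hg,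
        e2.2 (fun P hP h => hp P hP (Or.inr h)) g hg⟩
    · rintro hp P hP (h | h)
      · exact e1.1 (fun g hg => (hp g hg).1) P hP h
      · exact e2.1 (fun g hg => (hp g hg).2) P hP h
  constructor
  · set B₁ := (highVertices (D - 1) L).biUnion fun v => T.filter fun p => {v} ⊆ p.1 ∪ p.2
      with hB₁
    set B₂ := (linkedPairs L).biUnion fun q => (powersetCard 2 (q.1 ∪ q.2)).biUnion fun W =>
      T.filter fun p => W ⊆ p.1 ∪ p.2 with hB₂
    set B₃ := (linkedPairs L).biUnion fun q => ((linkedPairs ((L.erase q.1).erase q.2)).filter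
      fun q' => ¬ Disjoint (q.1 ∪ q.2) (q'.1 ∪ q'.2)).biUnion fun q' =>
        (powersetCard 2 ((q.1 ∪ q.2) ∪ (q'.1 ∪ q'.2))).biUnion fun W =>
          T.filter fun p => W ⊆ p.1 ∪ p.2 with hB₃
    have h3 : G ⊆ linkedAdditions r D s h L ∪ (B₁ ∪ B₂ ∪ B₃) := by
      intro p hp
      rw [hG, mem_filter, hGs] at hp
      obtain ⟨hpT, hs⟩ := hp
      obtain ⟨hp1, hp2, hp3⟩ := mem_linkedSets.1 hpT
      by_contra hcon
      simp only [mem_union, not_or] at hcon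
      obtain ⟨hc, ⟨hc1, hc2⟩, hc3⟩ := hcon
      have hspan : ∀ q ∈ linkedPairs L, ((q.1 ∪ q.2) ∩ (p.1 ∪ p.2)).card ≤ 1 := by
        intro q hq
        by_contra! hlt
        obtain ⟨W, hW, hWc⟩ := exists_subset_card_eq (show 2 ≤ _ from hlt)
        exact hc2 (mem_biUnion.2 ⟨q, hq, mem_biUnion.2 ⟨W, mem_powersetCard.2
          ⟨hW.trans inter_subset_left, hWc⟩, mem_filter.2 ⟨hpT, hW.trans inter_subset_right⟩⟩⟩)
      refine hc (mem_linkedAdditions.2 ⟨hpT, hs, insert_linked_mem hr hL hp1 hp2 hp3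
        (fun g hg => (hs g hg).1) (fun g hg => (hs g hg).2) hspan ?_ ?_⟩)
      · intro q hq q' hq' hne1 hne2
        by_contra! hlt
        have hcq := card_span_le (mem_linkedSets_of_mem_linkedPairs hL'.unif hq)
        have hcq' := card_span_le (mem_linkedSets_of_mem_linkedPairs hL'.unif hq')
        obtain ⟨hd, W, hW, hWp⟩ := exists_pair_of_card_union_lt (a := 2 * r - 2) (by omega)
          hcq hcq' (card_span_le hpT) (hL'.span_two q q' hq hq' hne1 hne2) (hspan q hq)
          (hspan q' hq') (by omega)
        refine hc3 (mem_biUnion.2 ⟨q, hq, mem_biUnion.2 ⟨q', mem_filter.2 ⟨?_, hd⟩,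
          mem_biUnion.2 ⟨W, hW, mem_filter.2 ⟨hpT, hWp⟩⟩⟩⟩)
        obtain ⟨m1, m2, m3⟩ := mem_linkedPairs.1 hq'
        refine mem_linkedPairs.2 ⟨mem_erase.2 ⟨hne2, mem_erase.2 ⟨hne1, m1⟩⟩,
          mem_erase.2 ⟨?_, mem_erase.2 ⟨?_, m2⟩⟩, m3⟩
        · intro h
          refine hne1 (hL'.matching q.2 q.1 q'.1 (linkedPairs_swap hq) ?_).symm
          have := linkedPairs_swap hq'
          rwa [Prod.swap, h] at this
        · intro h
          refine hne2 (hL'.matching q.1 q.2 q'.1 hq ?_).symm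
          have := linkedPairs_swap hq'
          rwa [Prod.swap, h] at this
      · intro v hv
        by_contra! hlt
        exact hc1 (mem_biUnion.2 ⟨v, mem_filter.2 ⟨mem_univ _, by omega⟩,
          mem_filter.2 ⟨hpT, singleton_subset_iff.2 hv⟩⟩)
    have h4 : (G.card : ℝ) ≤ (linkedAdditions r D s h L).card + (B₁.card + B₂.card + B₃.card) := by
      have := (card_le_card h3).trans (card_union_le _ _)
      have := card_union_le (B₁ ∪ B₂) B₃
      have := card_union_le B₁ B₂
      have h5 : G.card ≤ (linkedAdditions r D s h L).card + (B₁.card + B₂.card + B₃.card) := by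
        omega
      exact_mod_cast h5
    have hb1 : (B₁.card : ℝ) ≤ (highVertices (D - 1) L).card * (T.card * (2 * (r : ℝ) / n)) :=
      cast_card_biUnion_le _ _ fun v _ => by
        simpa using card_linkedSets_filter_span_le (by omega : 2 ≤ r) hrn ({v} : Finset (Fin n))
    have hq : ∀ q ∈ linkedPairs L, ((q.1 ∪ q.2).card : ℝ) ≤ 2 * r := by
      intro q hq
      rw [card_span_le (mem_linkedSets_of_mem_linkedPairs hL'.unif hq)]
      exact_mod_cast Nat.sub_le _ _
    have hb2 : (B₂.card : ℝ) ≤ T.card * (16 * h * r ^ 4 / n ^ 2) := by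
      refine (cast_card_biUnion_le _ _ fun q hq' =>
        cast_card_biUnion_supersets_le hr hrn _ (hq q hq')).trans (le_of_eq ?_)
      rw [(mem_admissibleClass.1 hL).2.2]
      push_cast
      ring
    have hb3 : (B₃.card : ℝ) ≤ T.card * (meetingPairs L * (32 * r ^ 4 / n ^ 2)) := by
      calc (B₃.card : ℝ) ≤ _ := Nat.cast_le.2 card_biUnion_le
        _ ≤ ∑ q ∈ linkedPairs L, (((linkedPairs ((L.erase q.1).erase q.2)).filter
            fun q' => ¬ Disjoint (q.1 ∪ q.2) (q'.1 ∪ q'.2)).card : ℝ) *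
              ((4 * r) ^ 2 / 2 * (T.card * (2 * (r : ℝ) / n) ^ 2)) := by
            rw [Nat.cast_sum]
            refine sum_le_sum fun q hq' => cast_card_biUnion_le _ _ fun q' hq'' =>
              cast_card_biUnion_supersets_le hr hrn _ ?_
            have h6 : q' ∈ linkedPairs L := linkedPairs_mono
              ((erase_subset _ _).trans (erase_subset _ _)) (mem_filter.1 hq'').1
            have h7 := hq q hq'
            have h8 := hq q' h6
            have h9 : (((q.1 ∪ q.2) ∪ (q'.1 ∪ q'.2)).card : ℝ) ≤
              (q.1 ∪ q.2).card + (q'.1 ∪ q'.2).card := by exact_mod_cast card_union_le _ _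
            linarith
        _ = _ := by
            rw [← sum_mul, meetingPairs, Nat.cast_sum]
            ring
    linarith
  · refine le_trans ?_ h2
    refine Nat.cast_le.2 (card_le_card fun p hp => ?_)
    obtain ⟨hp, hs, -⟩ := mem_linkedAdditions.1 hp
    exact mem_filter.2 ⟨hp, (hGs p).2 hs⟩

end Additions

/-- The range of parameters in which the switching estimates hold. -/
structure SparseRegime (n r m : ℕ) : Prop where
  three_le : 3 ≤ r
  one_le : 1 ≤ (n : ℝ) / (r : ℝ) ^ 2
  le_edges : (n : ℝ) / (r : ℝ) ^ 2 ≤ m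
  clusters : (M4 n r m : ℝ) * (8 * Real.exp 40) ≤ (n : ℝ) / (r : ℝ) ^ 2

/-- The relative error of the switching estimates. -/
noncomputable def switchingError (n r m : ℕ) : ℝ :=
  ((r : ℝ) ^ 6 * m * n * Real.log ((n : ℝ) / (r : ℝ) ^ 2) + (r : ℝ) ^ 8 * (m : ℝ) ^ 2) /
    (n : ℝ) ^ 4

namespace SparseRegime

variable {n r m s h : ℕ} {L : Finset (Finset (Fin n))}

theorem params (R : SparseRegime n r m) : ∃ x y l : ℝ, (n : ℝ) = (r : ℝ) ^ 2 * x ∧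
    (m : ℝ) = x * y ∧ 1 ≤ x ∧ 1 ≤ y ∧ 0 ≤ l ∧ Real.exp l = x ∧
    switchingError n r m = (y * l + y ^ 2) / x ^ 2 ∧
    l + 81 * y ≤ M0star n r m ∧ M0star n r m ≤ l + 81 * y + 1 ∧
    l + 81 / 2 * y ^ 2 ≤ M4 n r m ∧ M4 n r m ≤ l + 81 / 2 * y ^ 2 + 1 ∧
    M4 n r m * (8 * Real.exp 40) ≤ x := by
  have hr : (0 : ℝ) < r := by exact_mod_cast (by have := R.three_le; omega : 0 < r)
  have hx := R.one_le
  have hE := R.clusters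
  have hm := R.le_edges
  set x := (n : ℝ) / (r : ℝ) ^ 2 with hxdef
  have hx0 : 0 < x := by linarith
  have hn : (n : ℝ) = (r : ℝ) ^ 2 * x := by rw [hxdef]; field_simp
  set y := (m : ℝ) / x with hydef
  have hmy : (m : ℝ) = x * y := by rw [hydef]; field_simp
  have hy : 1 ≤ y := by rw [hydef, le_div_iff₀ hx0]; linarith
  have hl : 0 ≤ Real.log x := Real.log_nonneg hx
  have hD : M0star n r m = ⌈Real.log x + 81 * y⌉₊ := by
    rw [M0star, ← hxdef]
    congr 2
    rw [hn, hmy]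
    field_simp
  have hM : M4 n r m = ⌈Real.log x + 81 / 2 * y ^ 2⌉₊ := by
    rw [M4, ← hxdef]
    congr 2
    rw [hn, hmy]
    field_simp
  refine ⟨x, y, Real.log x, hn, hmy, hx, hy, hl, Real.exp_log hx0, ?_, ?_, ?_, ?_, ?_, hE⟩
  · rw [switchingError, ← hxdef, hn, hmy]
    field_simp
  · rw [hD]; exact Nat.le_ceil _
  · rw [hD]; exact (Nat.ceil_lt_add_one (by positivity)).le
  · rw [hM]; exact Nat.le_ceil _
  · rw [hM]; exact (Nat.ceil_lt_add_one (by positivity)).le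

theorem two_pow_le_exp : (2 : ℝ) ^ 40 ≤ Real.exp 40 := by
  have h1 : (2 : ℝ) ≤ Real.exp 1 := by
    have := Real.add_one_le_exp (1 : ℝ)
    linarith
  calc (2 : ℝ) ^ 40 ≤ Real.exp 1 ^ 40 := by gcongr
    _ = Real.exp 40 := by rw [← Real.exp_nat_mul]; norm_num

theorem clusters_mul_le {x : ℝ}
    (hx : M4 n r m * (8 * Real.exp 40) ≤ x) : (M4 n r m : ℝ) * 10 ^ 12 ≤ x := by
  have := two_pow_le_exp
  have h0 : (0 : ℝ) ≤ M4 n r m := Nat.cast_nonneg _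
  nlinarith

theorem two_mul_le (R : SparseRegime n r m) : 2 * r - 2 ≤ n ∧ r ≤ n := by
  have h1 := R.one_le
  have hr := R.three_le
  rw [one_le_div (by positivity)] at h1
  have h2 : r ^ 2 ≤ n := by exact_mod_cast h1
  constructor <;> nlinarith [Nat.sub_le (2 * r) 2]

theorem four_mul_clusters_le (R : SparseRegime n r m) : 4 * M4 n r m ≤ m := by
  obtain ⟨x, y, l, hn, hm, hx, hy, hl, hexp, herr, hD1, hD2, hM1, hM2, hE⟩ := R.params
  have h1 := clusters_mul_le hE
  have h2 : (4 * M4 n r m : ℝ) ≤ m := by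
    rw [hm]
    nlinarith [(Nat.cast_nonneg (M4 n r m) : (0 : ℝ) ≤ M4 n r m)]
  exact_mod_cast h2

theorem switchingError_nonneg (R : SparseRegime n r m) : 0 ≤ switchingError n r m := by
  obtain ⟨x, y, l, hn, hm, hx, hy, hl, hexp, herr, hD1, hD2, hM1, hM2, hE⟩ := R.params
  rw [herr]
  positivity

theorem switchingError_le (R : SparseRegime n r m) : switchingError n r m * 10 ^ 12 ≤ 1 := by
  obtain ⟨x, y, l, hn, hm, hx, hy, hl, hexp, herr, hD1, hD2, hM1, hM2, hE⟩ := R.params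
  have h1 := clusters_mul_le hE
  rw [herr, div_mul_eq_mul_div, div_le_one (by positivity)]
  have h2 : y ≤ M4 n r m := by nlinarith
  have h3 : l ≤ M4 n r m := by nlinarith
  have h4 : (M4 n r m : ℝ) ^ 2 * 10 ^ 24 ≤ x ^ 2 := by nlinarith
  have h5 : y * l ≤ (M4 n r m : ℝ) ^ 2 := by nlinarith
  have h6 : y ^ 2 ≤ (M4 n r m : ℝ) ^ 2 := by nlinarith
  nlinarith [sq_nonneg (M4 n r m : ℝ)]

theorem cast_card_shadowPairs_le (hL : L ∈ admissibleClass n r (M0star n r m) s h)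
    (hsm : s + 2 * h ≤ m) : ((shadowPairs L).card : ℝ) ≤ r.choose 2 * m := by
  obtain ⟨hA, hs, hh⟩ := mem_admissibleClass.1 hL
  have h1 := card_shadowPairs_le hA.unif
  have h2 := card_eq_isolated_add_linked hA.matching
  rw [hs, hh] at h2
  have h3 : (shadowPairs L).card ≤ r.choose 2 * m := by
    rw [h2] at h1
    calc _ ≤ _ := h1
      _ ≤ m * r.choose 2 := Nat.mul_le_mul_right _ hsm
      _ = _ := mul_comm _ _
  exact_mod_cast h3

theorem le_cast_card_shadowPairs (hL : L ∈ admissibleClass n r (M0star n r m) s h)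
    (hsm : m ≤ s + 2 * h + 2) :
    (r.choose 2 : ℝ) * m - (2 * r.choose 2 + 2 * h) ≤ (shadowPairs L).card := by
  obtain ⟨hA, hs, hh⟩ := mem_admissibleClass.1 hL
  have h1 := le_card_shadowPairs hA.unif hA.inter
  have h2 := card_eq_isolated_add_linked hA.matching
  rw [hs, hh] at h2
  rw [h2, hh] at h1
  have h3 : r.choose 2 * m ≤ (shadowPairs L).card + 2 * h + 2 * r.choose 2 := by
    calc r.choose 2 * m ≤ r.choose 2 * (s + 2 * h + 2) := Nat.mul_le_mul_left _ hsm
      _ = (s + 2 * h) * r.choose 2 + 2 * r.choose 2 := by ring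
      _ ≤ _ := by omega
  have h4 : (r.choose 2 : ℝ) * m ≤ (shadowPairs L).card + 2 * h + 2 * r.choose 2 := by
    exact_mod_cast h3
  linarith

theorem choose_sub_two_le (hr : 2 ≤ r) (hrn : r ≤ n) :
    ((n - 2).choose (r - 2) : ℝ) ≤ n.choose r * ((r : ℝ) / n) ^ 2 := by
  obtain ⟨P, -, hP⟩ := exists_subset_card_eq (s := (univ : Finset (Fin n))) (n := 2)
    (by rw [card_univ, Fintype.card_fin]; omega)
  have h1 := card_supersets_le hrn P
  rwa [card_supersets (by omega), hP] at h1

/-- The number of linked pairs broken by forbidding one pair of vertices. -/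
noncomputable def pairLoss (n r : ℕ) : ℝ :=
  ((r : ℝ) ^ 2 - r - 1) * ((n - 2).choose (r - 2) * (n - r).choose (r - 2))

theorem pairLoss_nonneg (hr : 3 ≤ r) : 0 ≤ pairLoss n r := by
  have : (3 : ℝ) ≤ r := by exact_mod_cast hr
  have h : 0 ≤ (r : ℝ) ^ 2 - r - 1 := by nlinarith
  unfold pairLoss
  positivity

theorem pairLoss_le (hr : 3 ≤ r) (hrn : r ≤ n) :
    pairLoss n r ≤ (linkedSets n r).card * (2 * ((r : ℝ) / n) ^ 2) := by
  have h1 := choose_sub_two_le (by omega : 2 ≤ r) hrn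
  have h3 : (3 : ℝ) ≤ r := by exact_mod_cast hr
  rw [pairLoss, card_linkedSets (by omega)]
  push_cast
  rw [Nat.cast_choose_two]
  calc _ ≤ ((r : ℝ) * (r - 1)) * ((n.choose r * ((r : ℝ) / n) ^ 2) * (n - r).choose (r - 2)) := by
        gcongr
        · nlinarith
        · nlinarith
    _ = _ := by ring

theorem choose_two_mul_le {x y : ℝ} (hm : (m : ℝ) = x * y) (hx : 0 ≤ x) (hy : 0 ≤ y) :
    (r.choose 2 : ℝ) * m ≤ (r : ℝ) ^ 2 / 2 * (x * y) := by
  rw [hm]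
  exact mul_le_mul_of_nonneg_right (choose_two_le_half_sq r) (by positivity)

theorem cast_card_highVertices_le {D x y : ℝ} {d : ℕ} (hm : (m : ℝ) = x * y) (hy : 0 < y)
    (hL : L ∈ admissibleClass n r (M0star n r m) s h) (hsm : s + 2 * h ≤ m)
    (hD : D * y ≤ d) : (highVertices d L).card * D ≤ x * r := by
  obtain ⟨hA, hs, hh⟩ := mem_admissibleClass.1 hL
  have h1 := card_highVertices_mul_le hA.unif d
  rw [card_eq_isolated_add_linked hA.matching, hs, hh] at h1
  have h2 : ((highVertices d L).card : ℝ) * d ≤ m * r := by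
    exact_mod_cast h1.trans (Nat.mul_le_mul_right _ hsm)
  have h3 : ((highVertices d L).card : ℝ) * (D * y) ≤ x * y * r := by
    rw [← hm]
    exact (mul_le_mul_of_nonneg_left hD (Nat.cast_nonneg _)).trans h2
  refine le_of_mul_le_mul_right ?_ hy
  linarith

/-- The number of edges that can be added as isolated edges, to first order. -/
noncomputable def isolatedMain (n r m : ℕ) : ℝ :=
  n.choose r - r.choose 2 * m * (n - 2).choose (r - 2)

/-- The number of linked pairs that can be added, to first order. -/
noncomputable def linkedMain (n r m : ℕ) : ℝ :=
  (linkedSets n r).card - r.choose 2 * m * pairLoss n r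

theorem half_le_isolatedMain (R : SparseRegime n r m) :
    (n.choose r : ℝ) / 2 ≤ isolatedMain n r m - n.choose r / 4 := by
  obtain ⟨x, y, l, hn, hm, hx, hy, hl, hexp, herr, hD1, hD2, hM1, hM2, hE⟩ := R.params
  have h0 := clusters_mul_le hE
  have hr : (0 : ℝ) < r := by exact_mod_cast (by have := R.three_le; omega : 0 < r)
  have h1 := choose_sub_two_le (by have := R.three_le; omega : 2 ≤ r) R.two_mul_le.2
  have h2 := choose_two_mul_le (r := r) hm (by linarith) (by linarith)
  have h3 : (r.choose 2 : ℝ) * m * (n - 2).choose (r - 2) ≤ n.choose r * (1 / 4) := by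
    calc _ ≤ (r : ℝ) ^ 2 / 2 * (x * y) * (n.choose r * ((r : ℝ) / n) ^ 2) := by gcongr
      _ = n.choose r * (y / (2 * x)) := by rw [hn]; field_simp
      _ ≤ _ := by
        refine mul_le_mul_of_nonneg_left ?_ (by positivity)
        rw [div_le_iff₀ (by positivity)]
        nlinarith
  rw [isolatedMain]
  linarith

theorem half_le_linkedMain (R : SparseRegime n r m) :
    ((linkedSets n r).card : ℝ) / 2 ≤ linkedMain n r m - (linkedSets n r).card / 4 := by
  obtain ⟨x, y, l, hn, hm, hx, hy, hl, hexp, herr, hD1, hD2, hM1, hM2, hE⟩ := R.params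
  have h0 := clusters_mul_le hE
  have hr : (0 : ℝ) < r := by exact_mod_cast (by have := R.three_le; omega : 0 < r)
  have h1 := pairLoss_le R.three_le R.two_mul_le.2
  have h2 := choose_two_mul_le (r := r) hm (by linarith) (by linarith)
  have h4 := pairLoss_nonneg (n := n) R.three_le
  have h3 : (r.choose 2 : ℝ) * m * pairLoss n r ≤ (linkedSets n r).card * (1 / 4) := by
    calc _ ≤ (r : ℝ) ^ 2 / 2 * (x * y) * ((linkedSets n r).card * (2 * ((r : ℝ) / n) ^ 2)) := by
          gcongr
      _ = (linkedSets n r).card * (y / x) := by rw [hn]; field_simp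
      _ ≤ _ := by
        refine mul_le_mul_of_nonneg_left ?_ (by positivity)
        rw [div_le_iff₀ (by positivity)]
        nlinarith
  rw [linkedMain]
  linarith

theorem isolatedMain_sub_le (R : SparseRegime n r m)
    (hL : L ∈ admissibleClass n r (M0star n r m) s h) (hsm : s + 2 * h ≤ m) :
    isolatedMain n r m - n.choose r * ((highVertices (M0star n r m) L).card * ((r : ℝ) / n)) ≤
      (isolatedAdditions r (M0star n r m) s h L).card := by
  have h1 := (isolatedAdditions_bounds R.three_le R.two_mul_le.2 hL).1
  have h2 := mul_le_mul_of_nonneg_right (cast_card_shadowPairs_le hL hsm)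
    (Nat.cast_nonneg (α := ℝ) ((n - 2).choose (r - 2)))
  rw [isolatedMain]
  linarith

theorem linkedMain_sub_le (R : SparseRegime n r m)
    (hL : L ∈ admissibleClass n r (M0star n r m) s h) (hsm : s + 2 * h ≤ m) :
    linkedMain n r m - (linkedSets n r).card *
        ((highVertices (M0star n r m - 1) L).card * (2 * (r : ℝ) / n) +
          16 * h * r ^ 4 / n ^ 2 + meetingPairs L * (32 * r ^ 4 / n ^ 2)) ≤
      (linkedAdditions r (M0star n r m) s h L).card := by
  have h1 := (linkedAdditions_bounds R.three_le R.two_mul_le.1 hL).1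
  have h2 := mul_le_mul_of_nonneg_right (cast_card_shadowPairs_le hL hsm)
    (pairLoss_nonneg (n := n) R.three_le)
  rw [linkedMain]
  rw [← pairLoss] at h1
  linarith

theorem half_le_isolatedAdditions (R : SparseRegime n r m)
    (hL : L ∈ admissibleClass n r (M0star n r m) s h) (hsm : s + 2 * h ≤ m) :
    (n.choose r : ℝ) / 2 ≤ (isolatedAdditions r (M0star n r m) s h L).card := by
  refine le_trans ?_ (R.isolatedMain_sub_le hL hsm)
  refine R.half_le_isolatedMain.trans (sub_le_sub_left ?_ _)
  obtain ⟨x, y, l, hn, hm, hx, hy, hl, hexp, herr, hD1, hD2, hM1, hM2, hE⟩ := R.params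
  have hr : (3 : ℝ) ≤ r := by exact_mod_cast R.three_le
  have h1 := cast_card_highVertices_le (d := M0star n r m) (D := 81) hm (by linarith) hL hsm
    (by linarith)
  rw [div_eq_mul_one_div (n.choose r : ℝ)]
  refine mul_le_mul_of_nonneg_left ?_ (by positivity)
  rw [hn, mul_div_assoc', div_le_iff₀ (by positivity)]
  have h2 : ((highVertices (M0star n r m) L).card : ℝ) ≤ x * r / 4 := by
    have : 0 ≤ x * r := by positivity
    linarith
  calc _ ≤ x * r / 4 * r := by gcongr
    _ = _ := by ring

theorem meetingPairs_le (hL : L ∈ admissibleClass n r (M0star n r m) s h) :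
    (meetingPairs L : ℝ) ≤ 4 * h ^ 2 := by
  obtain ⟨hA, hs, hh⟩ := mem_admissibleClass.1 hL
  have h1 : meetingPairs L ≤ (linkedPairs L).card • (linkedPairs L).card :=
    sum_le_card_nsmul _ _ _ fun p _ => (card_le_card (filter_subset _ _)).trans
      (card_le_card (linkedPairs_mono ((erase_subset _ _).trans (erase_subset _ _))))
  rw [hh, smul_eq_mul] at h1
  have h2 : (meetingPairs L : ℝ) ≤ (2 * h) * (2 * h) := by exact_mod_cast h1
  linarith

theorem half_le_linkedAdditions (R : SparseRegime n r m)
    (hL : L ∈ admissibleClass n r (M0star n r m) s h) (hsm : s + 2 * h ≤ m)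
    (hh : h ≤ M4 n r m) :
    ((linkedSets n r).card : ℝ) / 2 ≤ (linkedAdditions r (M0star n r m) s h L).card := by
  refine le_trans ?_ (R.linkedMain_sub_le hL hsm)
  refine R.half_le_linkedMain.trans (sub_le_sub_left ?_ _)
  obtain ⟨x, y, l, hn, hm, hx, hy, hl, hexp, herr, hD1, hD2, hM1, hM2, hE⟩ := R.params
  have h0 := clusters_mul_le hE
  have hr : (3 : ℝ) ≤ r := by exact_mod_cast R.three_le
  have hD : (80 : ℝ) * y ≤ (M0star n r m - 1 : ℕ) := by
    rw [Nat.cast_sub (by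
      have : (1 : ℝ) ≤ M0star n r m := by linarith
      exact_mod_cast this)]
    push_cast
    linarith
  have h1 := cast_card_highVertices_le (D := 80) hm (by linarith) hL hsm hD
  have h2 : ((highVertices (M0star n r m - 1) L).card : ℝ) ≤ x * r / 80 := by linarith
  have hh' : (h : ℝ) ≤ M4 n r m := by exact_mod_cast hh
  have hM : (0 : ℝ) ≤ M4 n r m := Nat.cast_nonneg _
  have hM' : (M4 n r m : ℝ) ≤ x / 10 ^ 12 := by linarith
  rw [div_eq_mul_one_div ((linkedSets n r).card : ℝ)]
  refine mul_le_mul_of_nonneg_left ?_ (by positivity)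
  have e1 : ((highVertices (M0star n r m - 1) L).card : ℝ) * (2 * (r : ℝ) / n) ≤ 1 / 40 := by
    calc _ ≤ x * r / 80 * (2 * (r : ℝ) / n) := by gcongr
      _ = 1 / 40 := by rw [hn]; field_simp; norm_num
  have e2 : 16 * (h : ℝ) * r ^ 4 / n ^ 2 ≤ 16 / 10 ^ 12 := by
    calc _ ≤ 16 * (x / 10 ^ 12) * r ^ 4 / n ^ 2 := by
          gcongr
          exact hh'.trans hM'
      _ = 16 / 10 ^ 12 * (1 / x) := by rw [hn]; field_simp
      _ ≤ 16 / 10 ^ 12 * 1 := by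
          gcongr
          rw [div_le_one (by linarith)]
          exact hx
      _ = _ := by ring
  have e3 : (meetingPairs L : ℝ) * (32 * r ^ 4 / n ^ 2) ≤ 128 / 10 ^ 24 := by
    calc _ ≤ 4 * (x / 10 ^ 12) ^ 2 * (32 * r ^ 4 / n ^ 2) := by
          have : (h : ℝ) ≤ x / 10 ^ 12 := hh'.trans hM'
          refine mul_le_mul_of_nonneg_right ((meetingPairs_le hL).trans ?_) (by positivity)
          gcongr
      _ = _ := by rw [hn]; field_simp; norm_num
  calc _ ≤ (1 : ℝ) / 40 + 16 / 10 ^ 12 + 128 / 10 ^ 24 := add_le_add (add_le_add e1 e2) e3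
    _ ≤ 1 / 4 := by norm_num

/-- The error terms of the sieve are of the order of the relative error. -/
theorem sieve_error_le (R : SparseRegime n r m) {S c : ℝ} (hS0 : 0 ≤ S) (hc : 1 ≤ c)
    (hS : S ≤ r.choose 2 * m) :
    S * (2 * (M0star n r m * r)) * (c * (r : ℝ) / n) ^ 3 + S ^ 2 * (c * (r : ℝ) / n) ^ 4 ≤
      84 * c ^ 4 * switchingError n r m := by
  obtain ⟨x, y, l, hn, hm, hx, hy, hl, hexp, herr, hD1, hD2, hM1, hM2, hE⟩ := R.params
  have hr : (3 : ℝ) ≤ r := by exact_mod_cast R.three_le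
  have h1 := hS.trans (choose_two_mul_le (r := r) hm (by linarith) (by linarith))
  have hD : (M0star n r m : ℝ) ≤ l + 82 * y := by linarith
  calc _ ≤ ((r : ℝ) ^ 2 / 2 * (x * y)) * (2 * ((l + 82 * y) * r)) * (c * (r : ℝ) / n) ^ 3 +
        ((r : ℝ) ^ 2 / 2 * (x * y)) ^ 2 * (c * (r : ℝ) / n) ^ 4 := by gcongr
    _ = (c ^ 3 * (y * (l + 82 * y)) + c ^ 4 * y ^ 2 / 4) / x ^ 2 := by
        rw [hn]; field_simp; ring
    _ ≤ (84 * c ^ 4 * (y * l + y ^ 2)) / x ^ 2 := by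
        gcongr
        have h2 : c ^ 3 ≤ c ^ 4 := pow_le_pow_right₀ hc (by norm_num)
        have h3 : 0 ≤ y * (l + 82 * y) := by positivity
        have h4 : 0 ≤ c ^ 4 * (y * l) := by positivity
        have h5 : 0 ≤ c ^ 4 * y ^ 2 := by positivity
        nlinarith
    _ = _ := by rw [herr]; ring

theorem cluster_error_le (R : SparseRegime n r m) (hh : h ≤ M4 n r m) :
    (h : ℝ) * r ^ 4 / n ^ 2 ≤ 42 * switchingError n r m ∧
      (r : ℝ) ^ 4 / n ^ 2 ≤ switchingError n r m := by
  obtain ⟨x, y, l, hn, hm, hx, hy, hl, hexp, herr, hD1, hD2, hM1, hM2, hE⟩ := R.params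
  have hr : (3 : ℝ) ≤ r := by exact_mod_cast R.three_le
  have hh' : (h : ℝ) ≤ M4 n r m := by exact_mod_cast hh
  have h1 : (h : ℝ) ≤ 42 * (y * l + y ^ 2) := by nlinarith
  constructor
  · calc _ ≤ 42 * (y * l + y ^ 2) * r ^ 4 / n ^ 2 := by gcongr
      _ = _ := by rw [hn, herr]; field_simp
  · calc (r : ℝ) ^ 4 / n ^ 2 = 1 / x ^ 2 := by rw [hn]; field_simp
      _ ≤ _ := by
        rw [herr]
        gcongr
        nlinarith [mul_nonneg (zero_le_one.trans hy) hl]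

theorem shadow_defect_le (R : SparseRegime n r m) (hh : h ≤ M4 n r m) :
    (2 * (r.choose 2 : ℝ) + 2 * h) * ((r : ℝ) / n) ^ 2 ≤ 43 * switchingError n r m := by
  obtain ⟨h1, h2⟩ := R.cluster_error_le hh
  have hr : (3 : ℝ) ≤ r := by exact_mod_cast R.three_le
  have h3 := choose_two_le_half_sq r
  have h4 : (2 : ℝ) ≤ r ^ 2 := by nlinarith
  calc _ ≤ ((r : ℝ) ^ 2 + r ^ 2 * h) * ((r : ℝ) / n) ^ 2 := by
        gcongr
        linarith
    _ = (r : ℝ) ^ 4 / n ^ 2 + h * r ^ 4 / n ^ 2 := by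
        ring
    _ ≤ _ := by linarith

theorem isolatedAdditions_le (R : SparseRegime n r m)
    (hL : L ∈ admissibleClass n r (M0star n r m) s h) (hsm : s + 2 * h ≤ m)
    (hms : m ≤ s + 2 * h + 2) (hh : h ≤ M4 n r m) :
    ((isolatedAdditions r (M0star n r m) s h L).card : ℝ) ≤
      isolatedMain n r m + n.choose r * (127 * switchingError n r m) := by
  have h1 := (isolatedAdditions_bounds R.three_le R.two_mul_le.2 hL).2
  have h2 := R.sieve_error_le (c := 1) (Nat.cast_nonneg _) le_rfl
    (cast_card_shadowPairs_le hL hsm)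
  rw [one_mul, one_pow, mul_one] at h2
  have h3 := mul_le_mul_of_nonneg_right (le_cast_card_shadowPairs hL hms)
    (Nat.cast_nonneg (α := ℝ) ((n - 2).choose (r - 2)))
  have h4 := choose_sub_two_le (by have := R.three_le; omega : 2 ≤ r) R.two_mul_le.2
  have h5 : (2 * (r.choose 2 : ℝ) + 2 * h) * (n - 2).choose (r - 2) ≤
      n.choose r * (43 * switchingError n r m) := by
    calc _ ≤ (2 * (r.choose 2 : ℝ) + 2 * h) * (n.choose r * ((r : ℝ) / n) ^ 2) := by gcongr
      _ = n.choose r * ((2 * (r.choose 2 : ℝ) + 2 * h) * ((r : ℝ) / n) ^ 2) := by ring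
      _ ≤ _ := mul_le_mul_of_nonneg_left (R.shadow_defect_le hh) (Nat.cast_nonneg _)
  have h6 := mul_le_mul_of_nonneg_left h2 (Nat.cast_nonneg (α := ℝ) (n.choose r))
  rw [isolatedMain]
  linarith

theorem linkedAdditions_le (R : SparseRegime n r m)
    (hL : L ∈ admissibleClass n r (M0star n r m) s h) (hsm : s + 2 * h ≤ m)
    (hms : m ≤ s + 2 * h + 2) (hh : h ≤ M4 n r m) :
    ((linkedAdditions r (M0star n r m) s h L).card : ℝ) ≤
      linkedMain n r m + (linkedSets n r).card * (1430 * switchingError n r m) := by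
  have h1 := (linkedAdditions_bounds R.three_le R.two_mul_le.1 hL).2
  rw [← pairLoss] at h1
  have h2 := R.sieve_error_le (c := 2) (Nat.cast_nonneg _) one_le_two
    (cast_card_shadowPairs_le hL hsm)
  have h3 := mul_le_mul_of_nonneg_right (le_cast_card_shadowPairs hL hms)
    (pairLoss_nonneg (n := n) R.three_le)
  have h4 := pairLoss_le R.three_le R.two_mul_le.2
  have h5 : (2 * (r.choose 2 : ℝ) + 2 * h) * pairLoss n r ≤
      (linkedSets n r).card * (86 * switchingError n r m) := by
    calc _ ≤ (2 * (r.choose 2 : ℝ) + 2 * h) *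
          ((linkedSets n r).card * (2 * ((r : ℝ) / n) ^ 2)) := by gcongr
      _ = (linkedSets n r).card * (2 * ((2 * (r.choose 2 : ℝ) + 2 * h) * ((r : ℝ) / n) ^ 2)) := by
          ring
      _ ≤ _ := by
          refine mul_le_mul_of_nonneg_left ?_ (Nat.cast_nonneg _)
          linarith [R.shadow_defect_le hh]
  have h6 := mul_le_mul_of_nonneg_left h2 (Nat.cast_nonneg (α := ℝ) (linkedSets n r).card)
  rw [linkedMain]
  linarith

theorem exp_three_le : Real.exp 3 ≤ 21 := by
  have h := Real.exp_one_lt_d9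
  calc Real.exp 3 = Real.exp 1 ^ 3 := by rw [← Real.exp_nat_mul]; norm_num
    _ ≤ 2.7182818286 ^ 3 := by gcongr
    _ ≤ 21 := by norm_num

theorem mul_inv_pow_le_one {r t : ℕ} (ht : 1 ≤ t) : (r : ℝ) * (1 / r) ^ t ≤ 1 := by
  rcases Nat.eq_zero_or_pos r with rfl | hr
  · simp
  have hr' : (1 : ℝ) ≤ r := by exact_mod_cast hr
  obtain ⟨t, rfl⟩ := Nat.exists_eq_add_of_le' ht
  rw [pow_succ, ← mul_assoc, mul_comm (r : ℝ), mul_assoc, mul_one_div_cancel (by positivity),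
    mul_one]
  refine pow_le_one₀ (by positivity) ?_
  rw [div_le_one (by positivity)]
  exact hr'

theorem isolatedDegree_tail_le (R : SparseRegime n r m) (hsm : s + 2 * h ≤ m) {y l : ℝ}
    (hn : (n : ℝ) * y = (r : ℝ) ^ 2 * m) (hy : 1 ≤ y) (hl : 0 ≤ l) {t : ℕ}
    (ht : 2 * l + 42 * y ≤ 3 * t) (v : Fin n) :
    r * (((admissibleClass n r (M0star n r m) s h).filter fun K =>
      t ≤ isolatedDegree v K).card : ℝ) ≤
      Real.exp (-(2 * l)) * (admissibleClass n r (M0star n r m) s h).card := by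
  have h1 := card_isolatedDegree_tail_le R.three_le R.two_mul_le.2
    (fun j hj L hL => R.half_le_isolatedAdditions (s := j) (h := h) hL (by omega)) le_rfl v t
    (s := s)
  have hr : (3 : ℝ) ≤ r := by exact_mod_cast R.three_le
  have hn0 : (0 : ℝ) < n := by exact_mod_cast (by have := v.2; omega : 0 < n)
  have ht1 : 1 ≤ t := by
    by_contra! h0
    have : (t : ℝ) = 0 := by exact_mod_cast (by omega : t = 0)
    rw [this] at ht
    linarith
  have h2 : 2 * (s : ℝ) * r / n ≤ 2 * y * (1 / r) := by
    have : (s : ℝ) ≤ m := by exact_mod_cast (by omega : s ≤ m)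
    rw [div_le_iff₀ hn0]
    calc 2 * (s : ℝ) * r ≤ 2 * m * r := by gcongr
      _ = 2 * ((r : ℝ) ^ 2 * m) * (1 / r) := by field_simp
      _ = _ := by rw [← hn]; ring
  have h3 : (2 * y) ^ t ≤ t.factorial * Real.exp (-(2 * l)) := by
    have h4 := Real.pow_div_factorial_le_exp (Real.exp 3 * (2 * y)) (by positivity) t
    rw [div_le_iff₀ (by positivity), mul_pow, ← Real.exp_nat_mul] at h4
    have h5 : (2 * y) ^ t = Real.exp (-((t : ℝ) * 3)) * (Real.exp (t * 3) * (2 * y) ^ t) := by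
      rw [← mul_assoc, ← Real.exp_add]
      simp
    rw [h5]
    calc _ ≤ Real.exp (-((t : ℝ) * 3)) * (Real.exp (Real.exp 3 * (2 * y)) * t.factorial) := by
          gcongr
      _ = t.factorial * Real.exp (-((t : ℝ) * 3) + Real.exp 3 * (2 * y)) := by
          rw [Real.exp_add]; ring
      _ ≤ _ := by
          gcongr
          nlinarith [exp_three_le]
  have h6 : (((admissibleClass n r (M0star n r m) s h).filter fun K =>
      t ≤ isolatedDegree v K).card : ℝ) ≤ Real.exp (-(2 * l)) * (1 / r) ^ t *
        (admissibleClass n r (M0star n r m) s h).card := by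
    refine le_of_mul_le_mul_right ?_ (by positivity : (0 : ℝ) < t.factorial)
    refine h1.trans ?_
    calc _ ≤ (2 * y * (1 / r)) ^ t * ((admissibleClass n r (M0star n r m) s h).card : ℝ) := by
          gcongr
      _ = (2 * y) ^ t * ((1 / r) ^ t * (admissibleClass n r (M0star n r m) s h).card) := by
          rw [mul_pow]; ring
      _ ≤ (t.factorial * Real.exp (-(2 * l))) *
          ((1 / r) ^ t * (admissibleClass n r (M0star n r m) s h).card) := by gcongr
      _ = _ := by ring
  calc _ ≤ (r : ℝ) * (Real.exp (-(2 * l)) * (1 / r) ^ t *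
        (admissibleClass n r (M0star n r m) s h).card) := by gcongr
    _ = (r * (1 / r) ^ t) * (Real.exp (-(2 * l)) *
        (admissibleClass n r (M0star n r m) s h).card) := by ring
    _ ≤ _ := mul_le_of_le_one_left (by positivity) (mul_inv_pow_le_one ht1)

theorem linkedDegree_tail_le (R : SparseRegime n r m) (hsm : s + 2 * h ≤ m)
    (hh : h ≤ M4 n r m) {l : ℝ} {t : ℕ} (ht1 : 1 ≤ t) (ht : l ≤ 20 * t) (v : Fin n) :
    r * (((admissibleClass n r (M0star n r m) s h).filter fun K =>
      2 * t ≤ linkedDegree v K).card : ℝ) ≤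
      Real.exp (-(2 * l)) * (admissibleClass n r (M0star n r m) s h).card := by
  have h1 := card_linkedDegree_tail_le R.three_le R.two_mul_le.1
    (fun j hj L hL => R.half_le_linkedAdditions (s := s) (h := j) hL (by omega) (by omega)) le_rfl
    v t (h := h)
  have hr : (3 : ℝ) ≤ r := by exact_mod_cast R.three_le
  have hn0 : (0 : ℝ) < n := by exact_mod_cast (by have := v.2; omega : 0 < n)
  have h2 : 8 * (h : ℝ) * r / n ≤ Real.exp (-40) * (1 / r) := by
    have h3 := R.clusters
    have h4 : (h : ℝ) ≤ M4 n r m := by exact_mod_cast hh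
    rw [le_div_iff₀ (by positivity)] at h3
    rw [div_le_iff₀ hn0]
    calc 8 * (h : ℝ) * r ≤ 8 * M4 n r m * r := by gcongr
      _ = Real.exp (-40) * (1 / r) * (M4 n r m * (8 * Real.exp 40) * r ^ 2) := by
          rw [Real.exp_neg]; field_simp
      _ ≤ _ := by gcongr
  calc _ ≤ (r : ℝ) * ((Real.exp (-40) * (1 / r)) ^ t *
        (admissibleClass n r (M0star n r m) s h).card) := by
        refine mul_le_mul_of_nonneg_left (h1.trans ?_) (by positivity)
        gcongr
    _ = (r * (1 / r) ^ t) * (Real.exp (t * (-40)) *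
        (admissibleClass n r (M0star n r m) s h).card) := by
        rw [Real.exp_nat_mul, mul_pow]; ring
    _ ≤ Real.exp (t * (-40)) * (admissibleClass n r (M0star n r m) s h).card :=
        mul_le_of_le_one_left (by positivity) (mul_inv_pow_le_one ht1)
    _ ≤ _ := by
        gcongr
        linarith

theorem hdegree_tail_le (R : SparseRegime n r m) (hsm : s + 2 * h ≤ m)
    (hh : h ≤ M4 n r m) (v : Fin n) :
    r * (((admissibleClass n r (M0star n r m) s h).filter fun K =>
      M0star n r m - 1 ≤ hdegree K v).card : ℝ) ≤
      2 * switchingError n r m * (admissibleClass n r (M0star n r m) s h).card := by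
  classical
  obtain ⟨x, y, l, hn, hm, hx, hy, hl, hexp, herr, hD1, hD2, hM1, hM2, hE⟩ := R.params
  set d := M0star n r m - 1 with hd
  have hd1 : l + 80 * y ≤ (d : ℝ) := by
    rw [hd, Nat.cast_sub (by
      have : (1 : ℝ) ≤ M0star n r m := by linarith
      exact_mod_cast this)]
    push_cast
    linarith
  obtain ⟨t, u, htu, hu, ht⟩ : ∃ t u : ℕ, t + 2 * u = d ∧ d ≤ 10 * u + 9 ∧ 8 * d ≤ 10 * t :=
    ⟨d - 2 * (d / 10), d / 10, by omega, by omega, by omega⟩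
  have hu' : (d : ℝ) ≤ 10 * u + 9 := by exact_mod_cast hu
  have ht' : 8 * (d : ℝ) ≤ 10 * t := by exact_mod_cast ht
  have hu1 : 1 ≤ u := by
    have : (0 : ℝ) < u := by linarith
    exact_mod_cast this
  have h1 := R.isolatedDegree_tail_le hsm (y := y) (l := l) (t := t)
    (by rw [hn, hm]; ring) hy hl (by linarith) v
  have h2 := R.linkedDegree_tail_le hsm hh (l := l) hu1 (by linarith) v
  have h3 : ((admissibleClass n r (M0star n r m) s h).filter fun K => d ≤ hdegree K v) ⊆
      ((admissibleClass n r (M0star n r m) s h).filter fun K => t ≤ isolatedDegree v K) ∪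
      ((admissibleClass n r (M0star n r m) s h).filter fun K => 2 * u ≤ linkedDegree v K) := by
    intro K hK
    rw [mem_filter] at hK
    have := hdegree_le_isolatedDegree_add_linkedDegree (K := K) v
    rw [mem_union, mem_filter, mem_filter]
    by_cases hc : t ≤ isolatedDegree v K
    · exact Or.inl ⟨hK.1, hc⟩
    · exact Or.inr ⟨hK.1, by omega⟩
  have h4 : (((admissibleClass n r (M0star n r m) s h).filter fun K =>
      d ≤ hdegree K v).card : ℝ) ≤ ((admissibleClass n r (M0star n r m) s h).filter fun K =>
        t ≤ isolatedDegree v K).card + ((admissibleClass n r (M0star n r m) s h).filter fun K =>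
          2 * u ≤ linkedDegree v K).card := by
    exact_mod_cast (card_le_card h3).trans (card_union_le _ _)
  have h5 : Real.exp (-(2 * l)) ≤ switchingError n r m := by
    have : Real.exp (-(2 * l)) = 1 / x ^ 2 := by
      rw [Real.exp_neg, two_mul, Real.exp_add, hexp, sq, one_div]
    rw [this, herr]
    gcongr
    nlinarith [mul_nonneg (zero_le_one.trans hy) hl]
  calc _ ≤ (r : ℝ) * _ := mul_le_mul_of_nonneg_left h4 (Nat.cast_nonneg _)
    _ ≤ 2 * Real.exp (-(2 * l)) * (admissibleClass n r (M0star n r m) s h).card := by linarith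
    _ ≤ _ := by gcongr

theorem sum_card_highVertices_le (R : SparseRegime n r m) (hsm : s + 2 * h ≤ m)
    (hh : h ≤ M4 n r m) :
    ∑ L ∈ admissibleClass n r (M0star n r m) s h,
      ((highVertices (M0star n r m - 1) L).card : ℝ) * ((r : ℝ) / n) ≤
      2 * switchingError n r m * (admissibleClass n r (M0star n r m) s h).card := by
  have h1 : ∑ L ∈ admissibleClass n r (M0star n r m) s h,
      (highVertices (M0star n r m - 1) L).card = ∑ v : Fin n,
        ((admissibleClass n r (M0star n r m) s h).filter fun K =>
          M0star n r m - 1 ≤ hdegree K v).card :=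
    sum_card_bipartiteAbove_eq_sum_card_bipartiteBelow
      fun (K : Finset (Finset (Fin n))) v => M0star n r m - 1 ≤ hdegree K v
  have hr := R.three_le
  have hn := R.two_mul_le.2
  have hn0 : (0 : ℝ) < n := by exact_mod_cast (by omega : 0 < n)
  rw [← sum_mul, ← Nat.cast_sum, h1, Nat.cast_sum, mul_div_assoc', div_le_iff₀ hn0, sum_mul]
  calc _ ≤ (univ : Finset (Fin n)).card • (2 * switchingError n r m *
        (admissibleClass n r (M0star n r m) s h).card) :=
        sum_le_card_nsmul _ _ _ fun v _ => by
          rw [mul_comm]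
          exact R.hdegree_tail_le hsm hh v
    _ = _ := by rw [card_univ, Fintype.card_fin, nsmul_eq_mul, mul_comm]

/-- Asymptotics for the average number of isolated edges that can be added. -/
theorem abs_sum_isolatedAdditions_sub_le (R : SparseRegime n r m) (hsm : s + 2 * h ≤ m)
    (hms : m ≤ s + 2 * h + 2) (hh : h ≤ M4 n r m) :
    |∑ L ∈ admissibleClass n r (M0star n r m) s h,
      ((isolatedAdditions r (M0star n r m) s h L).card : ℝ) -
        (admissibleClass n r (M0star n r m) s h).card * isolatedMain n r m| ≤
      10 ^ 5 * switchingError n r m *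
        ((admissibleClass n r (M0star n r m) s h).card * isolatedMain n r m) := by
  have hη := R.switchingError_nonneg
  have hN := R.half_le_isolatedMain
  have hN0 : (0 : ℝ) ≤ n.choose r := Nat.cast_nonneg _
  set 𝒦 := admissibleClass n r (M0star n r m) s h with h𝒦
  have h𝒦0 : (0 : ℝ) ≤ 𝒦.card := Nat.cast_nonneg _
  have hup : ∑ L ∈ 𝒦, ((isolatedAdditions r (M0star n r m) s h L).card : ℝ) ≤
      𝒦.card * (isolatedMain n r m + n.choose r * (127 * switchingError n r m)) := by
    rw [← nsmul_eq_mul]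
    exact sum_le_card_nsmul _ _ _ fun L hL => R.isolatedAdditions_le hL hsm hms hh
  have hlow : 𝒦.card * isolatedMain n r m - n.choose r * (2 * switchingError n r m * 𝒦.card) ≤
      ∑ L ∈ 𝒦, ((isolatedAdditions r (M0star n r m) s h L).card : ℝ) := by
    calc _ ≤ 𝒦.card * isolatedMain n r m - n.choose r * ∑ L ∈ 𝒦,
          ((highVertices (M0star n r m - 1) L).card : ℝ) * ((r : ℝ) / n) := by
          gcongr
          exact R.sum_card_highVertices_le hsm hh
      _ = ∑ L ∈ 𝒦, (isolatedMain n r m - n.choose r *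
          ((highVertices (M0star n r m - 1) L).card * ((r : ℝ) / n))) := by
          rw [sum_sub_distrib, sum_const, nsmul_eq_mul, mul_sum]
      _ ≤ _ := by
          refine sum_le_sum fun L hL => le_trans ?_ (R.isolatedMain_sub_le hL hsm)
          gcongr
          intro v hv
          have := (mem_filter.1 hv).2
          exact mem_filter.2 ⟨mem_univ _, by omega⟩
  have h1 : (n.choose r : ℝ) ≤ 2 * isolatedMain n r m := by linarith
  have h2 : n.choose r * (switchingError n r m * 𝒦.card) ≤
      2 * isolatedMain n r m * (switchingError n r m * 𝒦.card) := by gcongr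
  have h3 : 0 ≤ n.choose r * (switchingError n r m * 𝒦.card) := by positivity
  rw [abs_le]
  constructor <;> linarith

/-- Asymptotics for the average number of linked pairs that can be added. -/
theorem abs_sum_linkedAdditions_sub_le (R : SparseRegime n r m) (hsm : s + 2 * h ≤ m)
    (hms : m ≤ s + 2 * h + 2) (hh : h ≤ M4 n r m) :
    |∑ L ∈ admissibleClass n r (M0star n r m) s h,
      ((linkedAdditions r (M0star n r m) s h L).card : ℝ) -
        (admissibleClass n r (M0star n r m) s h).card * linkedMain n r m| ≤
      10 ^ 5 * switchingError n r m *
        ((admissibleClass n r (M0star n r m) s h).card * linkedMain n r m) := by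
  have hη := R.switchingError_nonneg
  have hN := R.half_le_linkedMain
  have hN0 : (0 : ℝ) ≤ (linkedSets n r).card := Nat.cast_nonneg _
  obtain ⟨hc1, hc2⟩ := R.cluster_error_le hh
  have hmeet := sum_meetingPairs_le (D := M0star n r m) (s := s) (h := h) R.three_le
    R.two_mul_le.1
    (fun j hj L hL => R.half_le_linkedAdditions (s := s) (h := j) hL (by omega) (by omega))
  have hhigh := R.sum_card_highVertices_le hsm hh
  set 𝒦 := admissibleClass n r (M0star n r m) s h with h𝒦
  set T : ℝ := ((linkedSets n r).card : ℝ) with hT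
  have h𝒦0 : (0 : ℝ) ≤ 𝒦.card := Nat.cast_nonneg _
  have hr : (3 : ℝ) ≤ r := by exact_mod_cast R.three_le
  have hn0 : (0 : ℝ) < n := by
    have h1 := R.three_le
    have h2 := R.two_mul_le.2
    exact_mod_cast (by omega : 0 < n)
  have hup : ∑ L ∈ 𝒦, ((linkedAdditions r (M0star n r m) s h L).card : ℝ) ≤
      𝒦.card * (linkedMain n r m + T * (1430 * switchingError n r m)) := by
    rw [← nsmul_eq_mul]
    exact sum_le_card_nsmul _ _ _ fun L hL => R.linkedAdditions_le hL hsm hms hh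
  have hmeet' : (∑ L ∈ 𝒦, (meetingPairs L : ℝ)) * (32 * r ^ 4 / n ^ 2) ≤
      43008 * switchingError n r m * 𝒦.card := by
    have hq : (h : ℝ) * r ^ 2 / n ≤ 1 := by
      obtain ⟨x, y, l, hn, hm, hx, hy, hl, hexp, herr, hD1, hD2, hM1, hM2, hE⟩ := R.params
      have h1 := clusters_mul_le hE
      have h2 : (h : ℝ) ≤ M4 n r m := by exact_mod_cast hh
      rw [div_le_one hn0, hn, mul_comm]
      have : (0 : ℝ) ≤ M4 n r m := Nat.cast_nonneg _
      gcongr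
      linarith
    calc _ ≤ 32 * (h : ℝ) ^ 2 * r ^ 2 / n * 𝒦.card * (32 * r ^ 4 / n ^ 2) := by gcongr
      _ = 1024 * ((h : ℝ) * r ^ 4 / n ^ 2) * ((h : ℝ) * r ^ 2 / n) * 𝒦.card := by
          field_simp; ring
      _ ≤ 1024 * (42 * switchingError n r m) * 1 * 𝒦.card := by gcongr
      _ = _ := by ring
  have hlow : 𝒦.card * linkedMain n r m - T * (43684 * switchingError n r m * 𝒦.card) ≤
      ∑ L ∈ 𝒦, ((linkedAdditions r (M0star n r m) s h L).card : ℝ) := by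
    calc _ ≤ 𝒦.card * linkedMain n r m - T * (2 * (∑ L ∈ 𝒦,
            ((highVertices (M0star n r m - 1) L).card : ℝ) * ((r : ℝ) / n)) +
          𝒦.card * (16 * (h * r ^ 4 / n ^ 2)) +
          (∑ L ∈ 𝒦, (meetingPairs L : ℝ)) * (32 * r ^ 4 / n ^ 2)) := by
          refine sub_le_sub_left (mul_le_mul_of_nonneg_left ?_ hN0) _
          have := mul_le_mul_of_nonneg_left hc1 h𝒦0
          linarith
      _ = ∑ L ∈ 𝒦, (linkedMain n r m - T *
          ((highVertices (M0star n r m - 1) L).card * (2 * (r : ℝ) / n) +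
          16 * h * r ^ 4 / n ^ 2 + meetingPairs L * (32 * r ^ 4 / n ^ 2))) := by
          rw [sum_sub_distrib, sum_const, nsmul_eq_mul, ← mul_sum, sum_add_distrib,
            sum_add_distrib, sum_const, nsmul_eq_mul, ← sum_mul, ← sum_mul, ← sum_mul]
          ring
      _ ≤ _ := sum_le_sum fun L hL => R.linkedMain_sub_le hL hsm
  have h1 : T ≤ 2 * linkedMain n r m := by linarith
  have h2 : T * (switchingError n r m * 𝒦.card) ≤
      2 * linkedMain n r m * (switchingError n r m * 𝒦.card) := by gcongr
  have h3 : 0 ≤ T * (switchingError n r m * 𝒦.card) := by positivity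
  rw [abs_le]
  constructor <;> linarith

end SparseRegime

theorem SparseRegime.of_le {n r m : ℕ} {ε : ℝ} (hr : 3 ≤ r) (hn : 0 < n) (hε : 0 < ε)
    (hε1 : ε * (44 * (8 * Real.exp 40)) ≤ 1) (hlb : (n : ℝ) / (r : ℝ) ^ 2 ≤ m)
    (hub : (m : ℝ) ≤ ε * ((n : ℝ) ^ ((3 : ℝ) / 2) / (r : ℝ) ^ 3)) : SparseRegime n r m := by
  have hr0 : (0 : ℝ) < r := by exact_mod_cast (by omega : 0 < r)
  have hn0 : (0 : ℝ) < n := by exact_mod_cast hn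
  have hM : M4 n r m = ⌈Real.log ((n : ℝ) / (r : ℝ) ^ 2) +
      81 / 2 * ((m : ℝ) / (n / (r : ℝ) ^ 2)) ^ 2⌉₊ := by
    rw [M4]
    congr 2
    field_simp
  have hsq : (m : ℝ) ^ 2 ≤ ε ^ 2 * (n / (r : ℝ) ^ 2) ^ 3 := by
    calc (m : ℝ) ^ 2 ≤ (ε * ((n : ℝ) ^ ((3 : ℝ) / 2) / (r : ℝ) ^ 3)) ^ 2 := by gcongr
      _ = ε ^ 2 * (((n : ℝ) ^ ((3 : ℝ) / 2)) ^ 2 / (r : ℝ) ^ 6) := by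
          rw [mul_pow, div_pow, ← pow_mul]
      _ = ε ^ 2 * ((n : ℝ) ^ 3 / (r : ℝ) ^ 6) := by
          rw [← Real.rpow_natCast ((n : ℝ) ^ ((3 : ℝ) / 2)), ← Real.rpow_mul hn0.le,
            ← Real.rpow_natCast (n : ℝ) 3]
          norm_num
      _ = _ := by rw [div_pow, ← pow_mul]
  set x := (n : ℝ) / (r : ℝ) ^ 2 with hx
  have hx0 : 0 < x := by positivity
  have hK : 1 ≤ Real.exp 40 := Real.one_le_exp (by norm_num)
  set K := 8 * Real.exp 40 with hKdef
  have hεx : 1 ≤ ε ^ 2 * x := by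
    have h1 : x ^ 2 ≤ ε ^ 2 * x ^ 3 := le_trans (by gcongr) hsq
    refine le_of_mul_le_mul_right ?_ (pow_pos hx0 2)
    linarith
  have hε2 : ε ≤ 1 := by nlinarith
  have hx1 : 1 ≤ x := by nlinarith [pow_le_one₀ hε.le hε2 (n := 2)]
  have hy : (m / x) ^ 2 ≤ ε ^ 2 * x := by
    rw [div_pow, div_le_iff₀ (by positivity)]
    linarith
  have hsqrt : √x ≤ ε * x := by
    rw [Real.sqrt_le_left (by positivity)]
    nlinarith
  have hlog : Real.log x ≤ 2 * (ε * x) := by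
    have h1 := Real.log_le_sub_one_of_pos (Real.sqrt_pos.2 hx0)
    rw [Real.log_sqrt hx0.le] at h1
    linarith
  refine ⟨hr, hx1, hlb, ?_⟩
  have hceil : (M4 n r m : ℝ) ≤ Real.log x + 81 / 2 * (m / x) ^ 2 + 1 := by
    rw [hM]
    exact (Nat.ceil_lt_add_one (add_nonneg (Real.log_nonneg hx1) (by positivity))).le
  have hεε : ε ^ 2 * x ≤ ε * x := by nlinarith [mul_pos hε hx0]
  calc (M4 n r m : ℝ) * K ≤ (44 * (ε * x)) * K := by gcongr; linarith
    _ = (ε * (44 * K)) * x := by ring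
    _ ≤ x := by nlinarith

theorem eventually_sparseRegime {r m : ℕ → ℕ} (hr : ∀ n, 3 ≤ r n)
    (hlb : ∀ᶠ n : ℕ in atTop, (n : ℝ) / (r n : ℝ) ^ 2 ≤ (m n : ℝ))
    (hub : (fun n => (m n : ℝ)) =o[atTop]
      (fun n => (n : ℝ) ^ ((3 : ℝ) / 2) / (r n : ℝ) ^ 3)) :
    ∀ᶠ n : ℕ in atTop, SparseRegime n (r n) (m n) := by
  have hε : 0 < (1 : ℝ) / (44 * (8 * Real.exp 40)) := by positivity
  filter_upwards [hlb, hub.def hε, eventually_gt_atTop 0] with n h1 h2 h3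
  refine SparseRegime.of_le (hr n) h3 hε (one_div_mul_cancel (by positivity)).le h1 ?_
  rwa [Real.norm_of_nonneg (by positivity), Real.norm_of_nonneg (by positivity)] at h2

namespace SparseRegime

variable {n r m s h : ℕ}

theorem linkedMain_eq (hr : 3 ≤ r) : linkedMain n r m =
    ((2 * r - 2).choose 2 : ℝ) * ((2 * r - 4).choose (r - 2) : ℝ) *
      ((n.choose (2 * r - 2) : ℝ) -
        ((r : ℝ) ^ 2 - (r : ℝ) - 1) / (((r : ℝ) - 1) * (2 * (r : ℝ) - 3)) *
          (r.choose 2 : ℝ) * (m : ℝ) * ((n - 2).choose (2 * r - 4) : ℝ)) := by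
  have hr' : (3 : ℝ) ≤ r := by exact_mod_cast hr
  have h1 : (2 * r - 2).choose r * r.choose 2 =
      (2 * r - 2).choose 2 * (2 * r - 4).choose (r - 2) := by
    rw [Nat.choose_mul (by omega)]
    rfl
  have h2 : (n - 2).choose (2 * r - 4) * (2 * r - 4).choose (r - 2) =
      (n - 2).choose (r - 2) * (n - r).choose (r - 2) := by
    rw [Nat.choose_mul (by omega), show n - 2 - (r - 2) = n - r by omega,
      show 2 * r - 4 - (r - 2) = r - 2 by omega]
  have h3 : ((2 * r - 2).choose 2 : ℝ) = ((r : ℝ) - 1) * (2 * (r : ℝ) - 3) := by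
    rw [Nat.cast_choose_two, Nat.cast_sub (by omega)]
    push_cast
    ring
  have h4 : ((r : ℝ) - 1) * (2 * (r : ℝ) - 3) ≠ 0 := by
    have : 0 < ((r : ℝ) - 1) * (2 * (r : ℝ) - 3) := mul_pos (by linarith) (by linarith)
    exact this.ne'
  have h2' : ((n - 2).choose (2 * r - 4) : ℝ) * (2 * r - 4).choose (r - 2) =
      (n - 2).choose (r - 2) * (n - r).choose (r - 2) := by exact_mod_cast h2
  have h5 : ((linkedSets n r).card : ℝ) = n.choose (2 * r - 2) *
      ((((r : ℝ) - 1) * (2 * (r : ℝ) - 3)) * (2 * r - 4).choose (r - 2)) := by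
    rw [card_linkedSets_eq_mul (by omega), h1, ← h3]
    push_cast
    ring
  rw [linkedMain, pairLoss, ← h2', h5, h3]
  generalize ((r : ℝ) - 1) * (2 * (r : ℝ) - 3) = c at h4
  field_simp

theorem isolatedMain_pos (R : SparseRegime n r m) : 0 < isolatedMain n r m := by
  have h1 := R.half_le_isolatedMain
  have h2 : (0 : ℝ) < n.choose r := by exact_mod_cast Nat.choose_pos R.two_mul_le.2
  linarith

theorem linkedMain_pos (R : SparseRegime n r m) : 0 < linkedMain n r m := by
  have h1 := R.half_le_linkedMain
  have h2 : 0 < (linkedSets n r).card := by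
    have := R.three_le
    rw [card_linkedSets_eq_mul (by omega)]
    have h3 := Nat.choose_pos R.two_mul_le.1
    have h4 : 0 < (2 * r - 2).choose r := Nat.choose_pos (by omega)
    have h5 : 0 < r.choose 2 := Nat.choose_pos (by omega)
    positivity
  have h2' : (0 : ℝ) < (linkedSets n r).card := by exact_mod_cast h2
  linarith

theorem card_pos_of_isolated (R : SparseRegime n r m) (hsm : s + 2 * h ≤ m)
    (hK : 0 < (admissibleClass n r (M0star n r m) s h).card) :
    0 < (admissibleClass n r (M0star n r m) (s + 1) h).card := by
  have h1 := card_admissibleClass_mul_le_isolated (n := n) R.three_le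
    fun L hL => R.half_le_isolatedAdditions (s := s) (h := h) hL hsm
  have h2 : 0 < n.choose r := Nat.choose_pos R.two_mul_le.2
  refine Nat.pos_of_ne_zero fun h0 => ?_
  rw [h0, Nat.cast_zero, mul_zero] at h1
  have h3 := mul_pos (Nat.cast_pos (α := ℝ).2 hK) (Nat.cast_pos (α := ℝ).2 h2)
  linarith

theorem card_pos_of_linked {D : ℕ} (hr : 3 ≤ r)
    (hK : 0 < (admissibleClass n r D s (h + 1)).card) :
    0 < (admissibleClass n r D s h).card := by
  have h1 := succ_mul_card_admissibleClass_linked (n := n) (D := D) (s := s) (h := h) hr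
  refine Nat.pos_of_ne_zero fun h0 => ?_
  rw [card_eq_zero.1 h0, sum_empty] at h1
  have h3 := mul_pos (Nat.cast_pos (α := ℝ).2 (by omega : 0 < 2 * (h + 1)))
    (Nat.cast_pos (α := ℝ).2 hK)
  linarith

theorem card_pos_of_switch (R : SparseRegime n r m) (hsm : s + 2 * (h + 1) = m)
    (hK : 0 < (admissibleClass n r (M0star n r m) s (h + 1)).card) :
    0 < (admissibleClass n r (M0star n r m) (s + 2) h).card :=
  R.card_pos_of_isolated (s := s + 1) (by omega)
    (R.card_pos_of_isolated (by omega) (card_pos_of_linked R.three_le hK))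

end SparseRegime

/-- Three approximate proportionalities combine to an approximate ratio. -/
theorem abs_div_sub_le_of_approx {a k₀ k₁ k₂ A N η p q t : ℝ} (hk₀ : 0 < k₀)
    (hk₂ : 0 < k₂) (hA : 0 < A) (hN : 0 < N) (hp : 0 < p) (hq : 0 < q) (ht : 0 < t)
    (hη : 0 ≤ η) (hη1 : η ≤ 1 / 10) (h₀ : |t * a - k₀ * A| ≤ η * (k₀ * A))
    (h₁ : |p * k₁ - k₀ * N| ≤ η * (k₀ * N)) (h₂ : |q * k₂ - k₁ * N| ≤ η * (k₁ * N)) :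
    |a / k₂ - A * (p * q) / (t * N ^ 2)| ≤ 10 * η * |A * (p * q) / (t * N ^ 2)| := by
  rw [abs_of_pos (a := A * (p * q) / (t * N ^ 2)) (by positivity)]
  obtain ⟨h0a, h0b⟩ := abs_le.1 h₀
  obtain ⟨h1a, h1b⟩ := abs_le.1 h₁
  obtain ⟨h2a, h2b⟩ := abs_le.1 h₂
  have hkN : 0 < k₀ * N := by positivity
  have hlow : (1 - η) ^ 2 * (k₀ * N ^ 2) ≤ p * q * k₂ := by
    have e1 : (1 - η) * (k₀ * N) ≤ p * k₁ := by linarith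
    have e2 : (1 - η) * (k₁ * N) ≤ q * k₂ := by linarith
    calc _ = (1 - η) * N * ((1 - η) * (k₀ * N)) := by ring
      _ ≤ (1 - η) * N * (p * k₁) := by
          refine mul_le_mul_of_nonneg_left e1 (mul_nonneg (by linarith) hN.le)
      _ = p * ((1 - η) * (k₁ * N)) := by ring
      _ ≤ p * (q * k₂) := by gcongr
      _ = _ := by ring
  have hup : p * q * k₂ ≤ (1 + η) ^ 2 * (k₀ * N ^ 2) := by
    have e1 : p * k₁ ≤ (1 + η) * (k₀ * N) := by linarith
    have e2 : q * k₂ ≤ (1 + η) * (k₁ * N) := by linarith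
    calc _ = p * (q * k₂) := by ring
      _ ≤ p * ((1 + η) * (k₁ * N)) := by gcongr
      _ = (1 + η) * N * (p * k₁) := by ring
      _ ≤ (1 + η) * N * ((1 + η) * (k₀ * N)) := by gcongr
      _ = _ := by ring
  have hkey : |t * a * N ^ 2 - A * (p * q * k₂)| ≤ 10 * η * (A * (p * q * k₂)) := by
    have hB : 0 < k₀ * A * N ^ 2 := by positivity
    have c1 : t * a * N ^ 2 ≤ (1 + η) * (k₀ * A * N ^ 2) := by
      calc _ ≤ ((1 + η) * (k₀ * A)) * N ^ 2 :=
            mul_le_mul_of_nonneg_right (by linarith) (by positivity)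
        _ = _ := by ring
    have c2 : (1 - η) * (k₀ * A * N ^ 2) ≤ t * a * N ^ 2 := by
      calc _ = ((1 - η) * (k₀ * A)) * N ^ 2 := by ring
        _ ≤ _ := mul_le_mul_of_nonneg_right (by linarith) (by positivity)
    have c3 : (1 - η) ^ 2 * (k₀ * A * N ^ 2) ≤ A * (p * q * k₂) := by
      calc _ = A * ((1 - η) ^ 2 * (k₀ * N ^ 2)) := by ring
        _ ≤ _ := by gcongr
    have c4 : A * (p * q * k₂) ≤ (1 + η) ^ 2 * (k₀ * A * N ^ 2) := by
      calc _ ≤ A * ((1 + η) ^ 2 * (k₀ * N ^ 2)) := by gcongr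
        _ = _ := by ring
    have c5 : (1 + η) * (k₀ * A * N ^ 2) ≤
        (1 + 10 * η) * ((1 - η) ^ 2 * (k₀ * A * N ^ 2)) := by
      rw [← mul_assoc (1 + 10 * η)]
      refine mul_le_mul_of_nonneg_right ?_ hB.le
      nlinarith [mul_nonneg hη (sub_nonneg.2 hη1), mul_nonneg (mul_nonneg hη hη) hη]
    have c6 : (1 - 10 * η) * ((1 + η) ^ 2 * (k₀ * A * N ^ 2)) ≤
        (1 - η) * (k₀ * A * N ^ 2) := by
      rw [← mul_assoc]
      refine mul_le_mul_of_nonneg_right ?_ hB.le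
      nlinarith [mul_nonneg hη (sub_nonneg.2 hη1), mul_nonneg (mul_nonneg hη hη) hη]
    have c7 := mul_le_mul_of_nonneg_left c3 (by linarith : (0 : ℝ) ≤ 1 + 10 * η)
    have c8 := mul_le_mul_of_nonneg_left c4 (by linarith : (0 : ℝ) ≤ 1 - 10 * η)
    rw [abs_le]
    constructor <;> linarith
  have e1 : a / k₂ - A * (p * q) / (t * N ^ 2) =
      (t * a * N ^ 2 - A * (p * q * k₂)) / (t * N ^ 2 * k₂) := by
    field_simp
  have e2 : 10 * η * (A * (p * q) / (t * N ^ 2)) =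
      10 * η * (A * (p * q * k₂)) / (t * N ^ 2 * k₂) := by
    field_simp
  rw [e1, e2, abs_div, abs_of_pos (a := t * N ^ 2 * k₂) (by positivity)]
  gcongr

theorem SparseRegime.abs_card_div_card_sub_le {n r m s h : ℕ} (R : SparseRegime n r m)
    (hsm : s + 2 * (h + 1) = m) (hh : h + 1 ≤ M4 n r m)
    (hK : 0 < (admissibleClass n r (M0star n r m) s (h + 1)).card) :
    |((admissibleClass n r (M0star n r m) s (h + 1)).card : ℝ) /
        (admissibleClass n r (M0star n r m) (s + 2) h).card -
        linkedMain n r m * ((s + 1 : ℕ) * (s + 2 : ℕ)) /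
          ((2 * (h + 1) : ℕ) * isolatedMain n r m ^ 2)| ≤
      10 * (10 ^ 5 * switchingError n r m) *
        |linkedMain n r m * ((s + 1 : ℕ) * (s + 2 : ℕ)) /
          ((2 * (h + 1) : ℕ) * isolatedMain n r m ^ 2)| := by
  have hk₀ := card_pos_of_linked R.three_le hK
  have hk₂ := R.card_pos_of_switch hsm hK
  have h₀ := R.abs_sum_linkedAdditions_sub_le (s := s) (h := h) (by omega) (by omega) (by omega)
  have h₁ := R.abs_sum_isolatedAdditions_sub_le (s := s) (h := h) (by omega) (by omega)
    (by omega)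
  have h₂ := R.abs_sum_isolatedAdditions_sub_le (s := s + 1) (h := h) (by omega) (by omega)
    (by omega)
  rw [← succ_mul_card_admissibleClass_linked R.three_le] at h₀
  rw [← succ_mul_card_admissibleClass_isolated R.three_le] at h₁ h₂
  have hη := R.switchingError_nonneg
  have hη1 := R.switchingError_le
  exact abs_div_sub_le_of_approx (by exact_mod_cast hk₀) (by exact_mod_cast hk₂)
    R.linkedMain_pos R.isolatedMain_pos (by positivity) (by positivity)
    (by positivity) (by positivity) (by linarith) h₀ h₁ h₂

/-- **Corollary 5.16**: emptiness propagation and the ratio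
`|C^{++}_{0,0,0,h₄}| / |C^{++}_{0,0,0,h₄-1}|` for `1 ≤ h₄ ≤ M₄`. -/
theorem statement13 (r m : ℕ → ℕ) (hr : ∀ n, 3 ≤ r n)
    (hlb : ∀ᶠ n : ℕ in atTop, (n : ℝ) / (r n : ℝ) ^ 2 ≤ (m n : ℝ))
    (hub : (fun n => (m n : ℝ)) =o[atTop]
      (fun n => (n : ℝ) ^ ((3 : ℝ) / 2) / (r n : ℝ) ^ 3)) :
    ∃ C > (0 : ℝ), ∃ n₀ : ℕ, ∀ n ≥ n₀, ∀ h₄ : ℕ, 1 ≤ h₄ → h₄ ≤ M4 n (r n) (m n) →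
      ((h₄ < M4 n (r n) (m n) → Cplusplus n (r n) (m n) 0 0 0 h₄ = ∅ →
          Cplusplus n (r n) (m n) 0 0 0 (h₄ + 1) = ∅) ∧
       (Cplusplus n (r n) (m n) 0 0 0 h₄ ≠ ∅ →
        |((Cplusplus n (r n) (m n) 0 0 0 h₄).ncard : ℝ)
              / ((Cplusplus n (r n) (m n) 0 0 0 (h₄ - 1)).ncard : ℝ)
            - (((2 * r n - 2).choose 2 : ℝ) * ((2 * r n - 4).choose (r n - 2) : ℝ)
                * ((m n - 2 * (h₄ - 1)).choose 2 : ℝ)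
                * ((n.choose (2 * r n - 2) : ℝ)
                  - ((r n : ℝ) ^ 2 - (r n : ℝ) - 1)
                      / (((r n : ℝ) - 1) * (2 * (r n : ℝ) - 3))
                    * ((r n).choose 2 : ℝ) * (m n : ℝ)
                    * ((n - 2).choose (2 * r n - 4) : ℝ)))
              / ((h₄ : ℝ) * ((n.choose (r n) : ℝ)
                  - ((r n).choose 2 : ℝ) * (m n : ℝ)
                    * ((n - 2).choose (r n - 2) : ℝ)) ^ 2)|
          ≤ C * (((r n : ℝ) ^ 6 * (m n : ℝ) * (n : ℝ)
                  * Real.log ((n : ℝ) / (r n : ℝ) ^ 2)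
                + (r n : ℝ) ^ 8 * (m n : ℝ) ^ 2) / (n : ℝ) ^ 4)
            * |(((2 * r n - 2).choose 2 : ℝ) * ((2 * r n - 4).choose (r n - 2) : ℝ)
                * ((m n - 2 * (h₄ - 1)).choose 2 : ℝ)
                * ((n.choose (2 * r n - 2) : ℝ)
                  - ((r n : ℝ) ^ 2 - (r n : ℝ) - 1)
                      / (((r n : ℝ) - 1) * (2 * (r n : ℝ) - 3))
                    * ((r n).choose 2 : ℝ) * (m n : ℝ)
                    * ((n - 2).choose (2 * r n - 4) : ℝ)))
              / ((h₄ : ℝ) * ((n.choose (r n) : ℝ)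
                  - ((r n).choose 2 : ℝ) * (m n : ℝ)
                    * ((n - 2).choose (r n - 2) : ℝ)) ^ 2)|)) := by
  obtain ⟨n₀, hn₀⟩ := eventually_atTop.1 (eventually_sparseRegime hr hlb hub)
  refine ⟨10 ^ 6, by norm_num, n₀, fun n hn h₄ h1 hM => ?_⟩
  have R := hn₀ n hn
  have hm := R.four_mul_clusters_le
  obtain ⟨h, rfl⟩ := Nat.exists_eq_add_of_le' h1
  rw [coe_admissibleClass R.three_le hM (by omega)]
  refine ⟨fun hlt hempty => ?_, fun hne => ?_⟩
  · rw [coe_admissibleClass R.three_le hlt (by omega), coe_eq_empty, ← card_eq_zero]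
    rw [coe_eq_empty, ← card_eq_zero] at hempty
    by_contra hK
    have := R.card_pos_of_switch (s := m n - 2 * (h + 1 + 1)) (h := h + 1) (by omega)
      (Nat.pos_of_ne_zero hK)
    rw [show m n - 2 * (h + 1 + 1) + 2 = m n - 2 * (h + 1) by omega] at this
    omega
  · rw [Ne, coe_eq_empty, ← card_eq_zero] at hne
    obtain ⟨s, hs⟩ := Nat.exists_eq_add_of_le' (show 2 * (h + 1) ≤ m n by omega)
    have hmain := R.abs_card_div_card_sub_le (s := s) (h := h) hs.symm hM (by
      rw [show s = m n - 2 * (h + 1) by omega]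
      exact Nat.pos_of_ne_zero hne)
    rw [Nat.add_sub_cancel, coe_admissibleClass R.three_le (by omega) (by omega),
      Set.ncard_coe_finset, Set.ncard_coe_finset, show m n - 2 * (h + 1) = s by omega,
      show m n - 2 * h = s + 2 by omega]
    have hval : SparseRegime.linkedMain n (r n) (m n) * ((s + 1 : ℕ) * (s + 2 : ℕ)) /
        ((2 * (h + 1) : ℕ) * SparseRegime.isolatedMain n (r n) (m n) ^ 2) =
        ((2 * r n - 2).choose 2 : ℝ) * ((2 * r n - 4).choose (r n - 2) : ℝ)
          * ((s + 2).choose 2 : ℝ)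
          * ((n.choose (2 * r n - 2) : ℝ)
            - ((r n : ℝ) ^ 2 - (r n : ℝ) - 1)
                / (((r n : ℝ) - 1) * (2 * (r n : ℝ) - 3))
              * ((r n).choose 2 : ℝ) * (m n : ℝ)
              * ((n - 2).choose (2 * r n - 4) : ℝ))
        / (((h + 1 : ℕ) : ℝ) * ((n.choose (r n) : ℝ)
            - ((r n).choose 2 : ℝ) * (m n : ℝ)
              * ((n - 2).choose (r n - 2) : ℝ)) ^ 2) := by
      have hpos := R.isolatedMain_pos
      have hchoose : ((s + 2).choose 2 : ℝ) = (s + 2) * (s + 1) / 2 := by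
        rw [Nat.cast_choose_two]
        push_cast
        ring
      rw [SparseRegime.linkedMain_eq R.three_le, hchoose, ← SparseRegime.isolatedMain]
      generalize (n.choose (2 * r n - 2) : ℝ) - _ = B
      push_cast
      field_simp
    rw [hval] at hmain
    rw [switchingError] at hmain
    refine hmain.trans (mul_le_mul_of_nonneg_right (le_of_eq ?_) (abs_nonneg _))
    ring
end

section
/- Let N ≥ 2 be an integer, and for 1 ≤ i ≤ N let real numbers A(i), B(i) be given with A(i) ≥ 0 and 1 − (i−1)B(i) ≥ 0. Set A_1 = min_i A(i), A_2 = max_i A(i), C_1 = min_i A(i)B(i), C_2 = max_i A(i)B(i). Suppose there exists a real number ĉ with 0 < ĉ < 1/3 such that max{A/N, |C|} ≤ ĉ for all A ∈ [A_1, A_2] and C ∈ [C_1, C_2]. Define n_0, n_1, …, n_N by n_0 = 1 and n_i / n_{i−1} = (A(i)/i)(1 − (i−1)B(i)) for 1 ≤ i ≤ N, with the interpretation that if A(i) = 0 or 1 − (i−1)B(i) = 0 then n_j = 0 for all i ≤ j ≤ N. Then Σ_1 ≤ Σ_{i=0}^{N} n_i ≤ Σ_2, where Σ_1 = exp[ A_1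 − (1/2)A_1 C_2 ] − (2eĉ)^N and Σ_2 = exp[ A_2 − (1/2)A_2 C_1 + (1/2)A_2 C_1^2 ] + (2eĉ)^N. -/
open Finset Real

/-- The `i`-th term of the expansion of `(1 + c) ^ (a / c)` (of `exp a` if `c = 0`). -/
noncomputable def binomTerm (a c : ℝ) (i : ℕ) : ℝ :=
  ∏ j ∈ range i, (a - j * c) / (j + 1)

theorem binomTerm_zero (a c : ℝ) : binomTerm a c 0 = 1 := by simp [binomTerm]

theorem binomTerm_succ (a c : ℝ) (i : ℕ) :
    binomTerm a c (i + 1) = binomTerm a c i * ((a - i * c) / (i + 1)) := by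
  rw [binomTerm, prod_range_succ, binomTerm]

theorem binomTerm_nonneg {a c : ℝ} {n i : ℕ} (h : ∀ j < n, 0 ≤ a - j * c) (hi : i ≤ n) :
    0 ≤ binomTerm a c i :=
  prod_nonneg fun j hj => div_nonneg (h j ((mem_range.mp hj).trans_le hi)) (by positivity)

theorem binomTerm_zero_right (a : ℝ) (i : ℕ) : binomTerm a 0 i = a ^ i / i.factorial := by
  induction i with
  | zero => simp [binomTerm_zero]
  | succ i ih =>
    rw [binomTerm_succ, ih, Nat.factorial_succ]
    push_cast
    field_simp
    ring

theorem binomTerm_eq_choose {a c : ℝ} (hc : c ≠ 0) (i : ℕ) :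
    binomTerm a c i = Ring.choose (a / c) i * c ^ i := by
  have key : (i.factorial : ℝ) * Ring.choose (a / c) i = ∏ j ∈ range i, (a / c - j) := by
    rw [← nsmul_eq_mul, ← Ring.descPochhammer_eq_factorial_smul_choose]
    induction i with
    | zero => simp
    | succ n ih =>
      rw [prod_range_succ, ← ih]
      simp [descPochhammer_succ_right, Polynomial.smeval_mul, Polynomial.smeval_natCast]
  have hf : (i.factorial : ℝ) ≠ 0 := by positivity
  have h2 : ∏ j ∈ range i, ((j : ℝ) + 1) = i.factorial := by
    rw [← prod_range_add_one_eq_factorial]; push_cast; rfl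
  have h3 : ∏ j ∈ range i, (a - j * c) = (∏ j ∈ range i, (a / c - j)) * c ^ i := by
    rw [← card_range i, ← prod_const, card_range, ← prod_mul_distrib]
    refine prod_congr rfl fun j _ => ?_
    field_simp
  rw [binomTerm, prod_div_distrib, h2, h3, ← key]
  field_simp

theorem hasSum_binomTerm_zero_right (a : ℝ) : HasSum (binomTerm a 0) (exp a) := by
  rw [Real.exp_eq_exp_ℝ]
  simpa [funext (binomTerm_zero_right a)] using NormedSpace.expSeries_div_hasSum_exp a

theorem hasSum_binomTerm {a c : ℝ} (hc : c ≠ 0) (hc1 : |c| < 1) :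
    HasSum (binomTerm a c) (exp (a * (log (1 + c) / c))) := by
  have hpos : 0 < 1 + c := by linarith [(abs_lt.mp hc1).1]
  have h := (Real.one_add_rpow_hasFPowerSeriesOnBall_zero (a := a / c)).hasSum
    (y := c) (by
      rw [← ENNReal.ofReal_one, Metric.eball_ofReal]
      simpa using hc1)
  have e : exp (a * (log (1 + c) / c)) = (1 + (0 + c)) ^ (a / c) := by
    rw [zero_add, Real.rpow_def_of_pos hpos]
    congr 1
    ring
  rw [e]
  have ht : binomTerm a c = fun i => binomialSeries ℝ (a / c) i fun _ => c := by
    ext i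
    rw [binomTerm_eq_choose hc, binomialSeries_apply]
    simp
  rwa [ht]

theorem abs_log_one_add_div_sub_le {c : ℝ} (hc : c ≠ 0) (hc3 : |c| < 1 / 3) :
    |log (1 + c) / c - (1 - c / 2 + c ^ 2 / 3 - c ^ 3 / 4 + c ^ 4 / 5 - c ^ 5 / 6)|
      ≤ 3 / 2 * c ^ 6 := by
  have h := abs_log_sub_add_sum_range_le (x := -c) (by rw [abs_neg]; linarith) 6
  have hp : 0 < |c| := abs_pos.mpr hc
  rw [abs_neg, sub_neg_eq_add] at h
  have h2 : |c| ^ 7 / (1 - |c|) ≤ 3 / 2 * |c| ^ 7 := by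
    rw [div_le_iff₀ (by linarith)]
    nlinarith [pow_pos hp 7]
  have h3 : log (1 + c) / c - (1 - c / 2 + c ^ 2 / 3 - c ^ 3 / 4 + c ^ 4 / 5 - c ^ 5 / 6)
      = (∑ i ∈ range 6, (-c) ^ (i + 1) / ((i : ℝ) + 1) + log (1 + c)) / c := by
    simp only [sum_range_succ, range_zero, sum_empty]
    push_cast
    field_simp
    ring
  rw [h3, abs_div, div_le_iff₀ hp]
  calc _ ≤ 3 / 2 * |c| ^ 7 := h.trans h2
    _ = _ := by rw [pow_succ, Even.pow_abs (by decide)]; ring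

theorem le_log_one_add_div {c : ℝ} (hc : c ≠ 0) (hc3 : |c| < 1 / 3) :
    1 - c / 2 ≤ log (1 + c) / c := by
  have h := (abs_le.mp (abs_log_one_add_div_sub_le hc hc3)).1
  obtain ⟨h1, h2⟩ := abs_lt.mp hc3
  have hsq : c ^ 2 ≤ 1 / 9 := by nlinarith
  have : 0 ≤ c ^ 2 * (1 / 3 - c / 4 + c ^ 2 * (1 / 5 - c / 6) - 3 / 2 * (c ^ 2) ^ 2) := by
    apply mul_nonneg (sq_nonneg c)
    have : 0 ≤ c ^ 2 * (1 / 5 - c / 6) := mul_nonneg (sq_nonneg c) (by linarith)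
    nlinarith [sq_nonneg c]
  nlinarith

theorem log_one_add_div_le {c : ℝ} (hc : c ≠ 0) (hc3 : |c| < 1 / 3) :
    log (1 + c) / c ≤ 1 - c / 2 + c ^ 2 / 2 := by
  have h := (abs_le.mp (abs_log_one_add_div_sub_le hc hc3)).2
  obtain ⟨h1, h2⟩ := abs_lt.mp hc3
  have hsq : c ^ 2 ≤ 1 / 9 := by nlinarith
  have : 0 ≤ c ^ 2 * (1 / 6 + c / 4 - c ^ 2 * (1 / 5 - c / 6) - 3 / 2 * (c ^ 2) ^ 2) := by
    apply mul_nonneg (sq_nonneg c)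
    have : c ^ 2 * (1 / 5 - c / 6) ≤ 1 / 9 * (1 / 5 + 1 / 18) :=
      mul_le_mul hsq (by linarith) (by linarith) (by norm_num)
    nlinarith [sq_nonneg c]
  nlinarith

theorem exists_hasSum_binomTerm {a c : ℝ} (ha : 0 ≤ a) (hc3 : |c| < 1 / 3) :
    ∃ S, HasSum (binomTerm a c) S ∧ exp (a - a * c / 2) ≤ S ∧
      S ≤ exp (a - a * c / 2 + a * c ^ 2 / 2) := by
  rcases eq_or_ne c 0 with rfl | hc
  · exact ⟨_, hasSum_binomTerm_zero_right a, by simp, by simp⟩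
  · refine ⟨_, hasSum_binomTerm hc (by linarith), exp_le_exp.mpr ?_, exp_le_exp.mpr ?_⟩
    · nlinarith [le_log_one_add_div hc hc3]
    · nlinarith [log_one_add_div_le hc hc3]

theorem abs_binomTerm_le {a c ε : ℝ} {n : ℕ} (ha : 0 ≤ a) (han : a ≤ n * ε) (hc : |c| ≤ ε)
    (i : ℕ) : |binomTerm a c i| ≤ (n + i - 1).choose i * ε ^ i := by
  have hε : 0 ≤ ε := (abs_nonneg c).trans hc
  induction i with
  | zero => simp [binomTerm_zero]
  | succ i ih =>
    have h1 : |a - i * c| ≤ (n + i) * ε := by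
      calc |a - i * c| ≤ |a| + |i * c| := abs_sub _ _
        _ = a + i * |c| := by rw [abs_of_nonneg ha, abs_mul, Nat.abs_cast]
        _ ≤ n * ε + i * ε := by gcongr
        _ = _ := by ring
    have h2 : ((n + i).choose (i + 1) : ℝ) * (i + 1) = (n + i) * (n + i - 1).choose i := by
      rcases Nat.eq_zero_or_pos (n + i) with h | h
      · obtain ⟨rfl, rfl⟩ : n = 0 ∧ i = 0 := by omega
        simp
      · obtain ⟨m, hm⟩ : ∃ m, n + i = m + 1 := ⟨n + i - 1, by omega⟩
        have := Nat.add_one_mul_choose_eq m i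
        have hm' : (n : ℝ) + i = m + 1 := by exact_mod_cast hm
        rw [hm, hm', Nat.add_sub_cancel]
        exact_mod_cast this.symm
    rw [binomTerm_succ, abs_mul, abs_div, abs_of_pos (show (0 : ℝ) < i + 1 by positivity)]
    calc |binomTerm a c i| * (|a - i * c| / (i + 1))
        ≤ ((n + i - 1).choose i * ε ^ i) * ((n + i) * ε / (i + 1)) := by gcongr
      _ = (n + i).choose (i + 1) * ε ^ (i + 1) := by
        rw [eq_comm, ← mul_div_assoc, eq_div_iff (by positivity)]
        linear_combination ε ^ (i + 1) * h2
      _ = _ := by rw [← add_assoc, Nat.add_sub_cancel]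

theorem abs_binomTerm_succ_le {a c r : ℝ} {i : ℕ} (h : |a - i * c| ≤ r * (i + 1)) :
    |binomTerm a c (i + 1)| ≤ |binomTerm a c i| * r := by
  rw [binomTerm_succ, abs_mul, abs_div, abs_of_pos (show (0 : ℝ) < i + 1 by positivity)]
  gcongr
  rwa [div_le_iff₀ (by positivity)]

theorem abs_binomTerm_add_le {a c r : ℝ} (hr : 0 ≤ r) {m : ℕ}
    (h : ∀ i, m ≤ i → |a - i * c| ≤ r * (i + 1)) (k : ℕ) :
    |binomTerm a c (m + k)| ≤ |binomTerm a c m| * r ^ k := by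
  induction k with
  | zero => simp
  | succ k ih =>
    calc |binomTerm a c (m + k + 1)| ≤ |binomTerm a c (m + k)| * r :=
          abs_binomTerm_succ_le (h _ (by omega))
      _ ≤ |binomTerm a c m| * r ^ k * r := by gcongr
      _ = _ := by ring

/-- If the ratios of consecutive terms are bounded by `r < 1` from index `m` on, then the tail
is at most that of a geometric series. -/
theorem abs_sub_sum_binomTerm_le {a c r S : ℝ} (hr : 0 ≤ r) (hr1 : r < 1) {m : ℕ}
    (h : ∀ i, m ≤ i → |a - i * c| ≤ r * (i + 1)) (hS : HasSum (binomTerm a c) S) :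
    |S - ∑ i ∈ range m, binomTerm a c i| ≤ |binomTerm a c m| * (1 - r)⁻¹ := by
  have ht := (hasSum_nat_add_iff' m).mpr hS
  have hg := (hasSum_geometric_of_lt_one hr hr1).mul_left |binomTerm a c m|
  rw [← ht.tsum_eq, ← Real.norm_eq_abs]
  refine tsum_of_norm_bounded hg fun k => ?_
  rw [add_comm]
  exact abs_binomTerm_add_le hr h k

theorem abs_sub_sum_binomTerm_le_pow {a c ε S : ℝ} {n : ℕ} (ha : 0 ≤ a)
    (han : a ≤ n * ε) (hc : |c| ≤ ε) (hε : ε < 1 / 3) (hS : HasSum (binomTerm a c) S) :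
    |S - ∑ i ∈ range (n + 1), binomTerm a c i| ≤ (2 * exp 1 * ε) ^ n := by
  have hε0 : 0 ≤ ε := (abs_nonneg c).trans hc
  have h1 := abs_sub_sum_binomTerm_le (r := 2 / 3) (m := n + 1) (by norm_num) (by norm_num)
    (fun i hi => by
      have hi' : (n : ℝ) ≤ i := by exact_mod_cast (Nat.le_succ n).trans hi
      calc |a - i * c| ≤ |a| + |i * c| := abs_sub _ _
        _ = a + i * |c| := by rw [abs_of_nonneg ha, abs_mul, Nat.abs_cast]
        _ ≤ n * ε + i * ε := by gcongr
        _ ≤ i * (1 / 3) + i * (1 / 3) := by gcongr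
        _ ≤ 2 / 3 * (i + 1) := by linarith) hS
  have h2 : ((n + (n + 1) - 1).choose (n + 1) : ℝ) ≤ 4 ^ n := by
    have := Nat.choose_le_two_pow (n + (n + 1) - 1) (n + 1)
    rw [show n + (n + 1) - 1 = 2 * n by omega, pow_mul] at this
    rw [show n + (n + 1) - 1 = 2 * n by omega]
    exact_mod_cast this
  have h3 := abs_binomTerm_le ha han hc (n + 1)
  calc _ ≤ _ := h1
    _ ≤ (4 ^ n * ε ^ (n + 1)) * (1 - 2 / 3)⁻¹ := by
      gcongr
      exact h3.trans (by gcongr)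
    _ = (4 * ε) ^ n * (3 * ε) := by rw [mul_pow]; ring
    _ ≤ (4 * ε) ^ n * 1 := by gcongr; linarith
    _ ≤ (2 * exp 1 * ε) ^ n := by
      rw [mul_one]
      gcongr
      linarith [add_one_le_exp (1 : ℝ)]

/-- Truncating the series just before its first negative term does not decrease the sum. -/
theorem le_sum_binomTerm_of_first_neg {a c S : ℝ} (ha : 0 ≤ a) (hc : 0 ≤ c) (hc3 : c < 1 / 3)
    {k : ℕ} (hpos : ∀ j < k, 0 ≤ a - j * c) (hneg : a - k * c < 0)
    (hS : HasSum (binomTerm a c) S) : S ≤ ∑ i ∈ range (k + 1), binomTerm a c i := by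
  have hb : ∀ i, k ≤ i → |a - i * c| ≤ 1 / 3 * (i + 1) := fun i hi => by
    have hi' : (k : ℝ) ≤ i := by exact_mod_cast hi
    have h1 : (k : ℝ) * c ≤ i * c := by gcongr
    have h2 : (i : ℝ) * c ≤ i * (1 / 3) := by gcongr
    rw [abs_of_nonpos (by linarith)]
    linarith
  have h1 := abs_sub_sum_binomTerm_le (r := 1 / 3) (m := k + 1 + 1) (by norm_num) (by norm_num)
    (fun i hi => hb i (by omega)) hS
  have h2 := abs_binomTerm_succ_le (hb (k + 1) (by omega))
  have h3 : binomTerm a c (k + 1) ≤ 0 := by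
    rw [binomTerm_succ]
    exact mul_nonpos_of_nonneg_of_nonpos (binomTerm_nonneg hpos le_rfl)
      (div_nonpos_of_nonpos_of_nonneg hneg.le (by positivity))
  rw [sum_range_succ] at h1
  rw [abs_of_nonpos h3] at h2
  norm_num at h1
  linarith [(abs_le.mp h1).2]

/-- **Corollary 4.5 of Greenhill–McKay–Wang**: simplified summation lemma. -/
theorem statement15 (N : ℕ) (hN : 2 ≤ N) (A B : ℕ → ℝ)
    (hA : ∀ i, 1 ≤ i → i ≤ N → 0 ≤ A i)
    (hB : ∀ i, 1 ≤ i → i ≤ N → 0 ≤ 1 - ((i : ℝ) - 1) * B i)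
    (A₁ A₂ C₁ C₂ : ℝ)
    (hA₁ : A₁ = (Finset.Icc 1 N).inf' (Finset.nonempty_Icc.mpr (by omega)) A)
    (hA₂ : A₂ = (Finset.Icc 1 N).sup' (Finset.nonempty_Icc.mpr (by omega)) A)
    (hC₁ : C₁ = (Finset.Icc 1 N).inf' (Finset.nonempty_Icc.mpr (by omega))
      (fun i => A i * B i))
    (hC₂ : C₂ = (Finset.Icc 1 N).sup' (Finset.nonempty_Icc.mpr (by omega))
      (fun i => A i * B i))
    (chat : ℝ) (hc0 : 0 < chat) (hc3 : chat < 1 / 3)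
    (hrange : ∀ a c : ℝ, A₁ ≤ a → a ≤ A₂ → C₁ ≤ c → c ≤ C₂ →
      max (a / N) |c| ≤ chat)
    (nseq : ℕ → ℝ) (hn0 : nseq 0 = 1)
    (hrec : ∀ i, 1 ≤ i → i ≤ N →
      nseq i = nseq (i - 1) * ((A i / i) * (1 - ((i : ℝ) - 1) * B i))) :
    Real.exp (A₁ - A₁ * C₂ / 2) - (2 * Real.exp 1 * chat) ^ N
      ≤ ∑ i ∈ Finset.range (N + 1), nseq i ∧
    ∑ i ∈ Finset.range (N + 1), nseq i
      ≤ Real.exp (A₂ - A₂ * C₁ / 2 + A₂ * C₁ ^ 2 / 2) + (2 * Real.exp 1 * chat) ^ N := by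
  have hN0 : (0 : ℝ) < N := by exact_mod_cast (by omega : 0 < N)
  have hmem : ∀ i < N, i + 1 ∈ Icc 1 N := fun i hi => mem_Icc.mpr ⟨by omega, by omega⟩
  have lA₁ : ∀ i < N, A₁ ≤ A (i + 1) := fun i hi => hA₁ ▸ inf'_le A (hmem i hi)
  have lA₂ : ∀ i < N, A (i + 1) ≤ A₂ := fun i hi => hA₂ ▸ le_sup' A (hmem i hi)
  have lC₁ : ∀ i < N, C₁ ≤ A (i + 1) * B (i + 1) := fun i hi =>
    hC₁ ▸ inf'_le (fun i => A i * B i) (hmem i hi)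
  have lC₂ : ∀ i < N, A (i + 1) * B (i + 1) ≤ C₂ := fun i hi =>
    hC₂ ▸ le_sup' (fun i => A i * B i) (hmem i hi)
  have hA₁0 : 0 ≤ A₁ := hA₁ ▸ (le_inf'_iff _ _).mpr fun i hi =>
    hA i (mem_Icc.mp hi).1 (mem_Icc.mp hi).2
  have hA₁₂ : A₁ ≤ A₂ := (lA₁ 0 (by omega)).trans (lA₂ 0 (by omega))
  have hC₁₂ : C₁ ≤ C₂ := (lC₁ 0 (by omega)).trans (lC₂ 0 (by omega))
  obtain ⟨rA₁, rC₂⟩ := max_le_iff.mp (hrange A₁ C₂ le_rfl hA₁₂ hC₁₂ le_rfl)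
  obtain ⟨rA₂, rC₁⟩ := max_le_iff.mp (hrange A₂ C₁ hA₁₂ le_rfl le_rfl hC₁₂)
  rw [div_le_iff₀' hN0] at rA₁ rA₂
  have hstep : ∀ i < N, nseq (i + 1) =
      nseq i * ((A (i + 1) - i * (A (i + 1) * B (i + 1))) / (i + 1)) := fun i hi => by
    rw [hrec (i + 1) (by omega) (by omega)]
    push_cast
    ring
  have hfac : ∀ i < N, 0 ≤ A (i + 1) - i * (A (i + 1) * B (i + 1)) := fun i hi => by
    have hb := hB (i + 1) (by omega) (by omega)
    push_cast at hb
    linarith [mul_nonneg (hA (i + 1) (by omega) (by omega)) hb]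
  have hn : ∀ i ≤ N, 0 ≤ nseq i := fun i => by
    induction i with
    | zero => simp [hn0]
    | succ i ih =>
      intro hi
      rw [hstep i hi]
      exact mul_nonneg (ih (by omega)) (div_nonneg (hfac i hi) (by positivity))
  have hlow : ∀ i < N, A₁ - i * C₂ ≤ A (i + 1) - i * (A (i + 1) * B (i + 1)) := fun i hi =>
    sub_le_sub (lA₁ i hi) (mul_le_mul_of_nonneg_left (lC₂ i hi) (by positivity))
  have hupp : ∀ i < N, A (i + 1) - i * (A (i + 1) * B (i + 1)) ≤ A₂ - i * C₁ := fun i hi =>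
    sub_le_sub (lA₂ i hi) (mul_le_mul_of_nonneg_left (lC₁ i hi) (by positivity))
  have hpow : (0 : ℝ) ≤ (2 * exp 1 * chat) ^ N := by positivity
  constructor
  · obtain ⟨S, hS, hS₁, -⟩ := exists_hasSum_binomTerm hA₁0 (rC₂.trans_lt hc3)
    have hcmp : ∀ k ≤ N, (∀ j < k, 0 ≤ A₁ - j * C₂) →
        ∀ i ≤ k, binomTerm A₁ C₂ i ≤ nseq i := fun k hk hpos i => by
      induction i with
      | zero => simp [hn0, binomTerm_zero]
      | succ i ih =>
        intro hi
        rw [hstep i (by omega), binomTerm_succ]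
        have := hpos i hi
        have := hlow i (by omega)
        have := hn i (by omega)
        exact mul_le_mul (ih (by omega)) (by gcongr) (by positivity) this
    by_cases hpos : ∀ j < N, 0 ≤ A₁ - j * C₂
    · have h := abs_sub_sum_binomTerm_le_pow hA₁0 rA₁ rC₂ hc3 hS
      have hle : ∑ i ∈ range (N + 1), binomTerm A₁ C₂ i ≤ ∑ i ∈ range (N + 1), nseq i :=
        sum_le_sum fun i hi => hcmp N le_rfl hpos i (Nat.lt_succ_iff.mp (mem_range.mp hi))
      linarith [(abs_le.mp h).2]
    · classical
      have hex : ∃ j, j < N ∧ A₁ - j * C₂ < 0 := by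
        push Not at hpos
        exact hpos
      obtain ⟨k, ⟨hkN, hneg⟩, hmin⟩ : ∃ k, (k < N ∧ A₁ - k * C₂ < 0) ∧
          ∀ j < k, ¬ (j < N ∧ A₁ - j * C₂ < 0) :=
        ⟨Nat.find hex, Nat.find_spec hex, fun j hj => Nat.find_min hex hj⟩
      have hpos' : ∀ j < k, 0 ≤ A₁ - j * C₂ := fun j hj =>
        not_lt.mp fun h => hmin j hj ⟨hj.trans hkN, h⟩
      have hC₂0 : 0 ≤ C₂ := by
        by_contra! h
        have : (k : ℝ) * C₂ ≤ 0 := mul_nonpos_of_nonneg_of_nonpos (by positivity) h.le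
        linarith
      have hSle := le_sum_binomTerm_of_first_neg hA₁0 hC₂0
        ((le_abs_self C₂).trans_lt (rC₂.trans_lt hc3)) hpos' hneg hS
      have hle : ∑ i ∈ range (k + 1), binomTerm A₁ C₂ i ≤ ∑ i ∈ range (k + 1), nseq i :=
        sum_le_sum fun i hi =>
          hcmp k hkN.le hpos' i (Nat.lt_succ_iff.mp (mem_range.mp hi))
      have hle' : ∑ i ∈ range (k + 1), nseq i ≤ ∑ i ∈ range (N + 1), nseq i :=
        sum_le_sum_of_subset_of_nonneg (range_subset_range.mpr (by omega))
          fun i hi _ => hn i (Nat.lt_succ_iff.mp (mem_range.mp hi))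
      linarith
  · obtain ⟨S, hS, -, hS₂⟩ := exists_hasSum_binomTerm (hA₁0.trans hA₁₂) (rC₁.trans_lt hc3)
    have h := abs_sub_sum_binomTerm_le_pow (hA₁0.trans hA₁₂) rA₂ rC₁ hc3 hS
    have hcmp : ∀ i ≤ N, nseq i ≤ binomTerm A₂ C₁ i := fun i => by
      induction i with
      | zero => simp [hn0, binomTerm_zero]
      | succ i ih =>
        intro hi
        rw [hstep i hi, binomTerm_succ]
        have hf := hfac i hi
        have := hupp i hi
        exact mul_le_mul (ih (by omega)) (by gcongr) (by positivity)
          ((hn i (by omega)).trans (ih (by omega)))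
    have hle : ∑ i ∈ range (N + 1), nseq i ≤ ∑ i ∈ range (N + 1), binomTerm A₂ C₁ i :=
      sum_le_sum fun i hi => hcmp i (Nat.lt_succ_iff.mp (mem_range.mp hi))
    linarith [(abs_le.mp h).1]
end
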